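/- For any two skew shapes λ/μ and ν/ρ (partitions with at most k parts, μ ⊆ λ and ρ ⊆ ν), the symmetric function s_{(λ/μ)∨(ν/ρ)}·s_{(λ/μ)∧(ν/ρ)} − s_{λ/μ}·s_{ν/ρ} is Schur nonnegative. -/

import Mathlib

/-- The complete homogeneous symmetric function `h_m` in `N` variables,
with `h_m = 0` for `m < 0`. -/
noncomputable def homog (N : ℕ) (m : ℤ) : MvPolynomial (Fin N) ℤ :=
  if 0 ≤ m then MvPolynomial.hsymm (Fin N) ℤ m.toNat else 0

/-- The skew Schur polynomial `s_{λ/μ}` in `N` variables, given by the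
Jacobi–Trudi determinant `det (h_{λ_i - μ_j - i + j})_{i,j=1}^k`, where the
partitions `lam`, `mu` are recorded 0-indexed (`lam 0 = λ_1`). -/
noncomputable def skewSchur (N k : ℕ) (lam mu : ℕ → ℕ) : MvPolynomial (Fin N) ℤ :=
  Matrix.det (Matrix.of fun i j : Fin k =>
    homog N ((lam i : ℤ) - (mu j : ℤ) - (i : ℤ) + (j : ℤ)))

/-- A symmetric polynomial is Schur nonnegative if it is a linear combination
with nonnegative coefficients of Schur polynomials `s_λ`. -/
def IsSchurNonneg (N : ℕ) (f : MvPolynomial (Fin N) ℤ) : Prop :=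
  ∃ (m : ℕ) (c : Fin m → ℕ) (k : Fin m → ℕ) (lam : Fin m → ℕ → ℕ),
    (∀ i, Antitone (lam i)) ∧ (∀ i j, k i ≤ j → lam i j = 0) ∧
    f = ∑ i, (c i : ℤ) • skewSchur N (k i) (lam i) (fun _ => 0)

/-- Abstract crystal data; `st i x y` means `y = e_i x`. -/
structure Crys (V : Type) (ι : Type) where
  st : ι → V → V → Prop
  eps : ι → V → ℤ
  phi : ι → V → ℤ
  rank : V → ℕ
  cc : ι → ι → ℤ
  st_fun : ∀ {i x y y'}, st i x y → st i x y' → y = y'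
  st_inj : ∀ {i x x' y}, st i x y → st i x' y → x = x'
  eps_nonneg : ∀ i x, 0 ≤ eps i x
  ex_e : ∀ {i x}, 0 < eps i x → ∃ y, st i x y
  eps_pos : ∀ {i x y}, st i x y → 0 < eps i x
  ex_f : ∀ {i x}, 0 < phi i x → ∃ y, st i y x
  phi_pos : ∀ {i x y}, st i x y → 0 < phi i y
  eps_st : ∀ {i x y}, st i x y → eps i x = eps i y + 1
  wt_st : ∀ {i x y} (j), st i x y → phi j y - eps j y = phi j x - eps j x + cc i j
  rank_st : ∀ {i x y}, st i x y → rank x = rank y + 1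
  ax1 : ∀ {i j x y z}, i ≠ j → st i x y → st j x z →
    (∃ w, st j y w ∧ st i z w ∧ (phi j z = phi j w ∨ phi i y = phi i w)) ∨
    (∃ p q r s w, st j y p ∧ st j p q ∧ st i q w ∧ st i z r ∧ st i r s ∧ st j s w ∧
      phi j q ≠ phi j w ∧ phi i s ≠ phi i w)
  ax2 : ∀ {i j w y z}, i ≠ j → st j y w → st i z w →
    (phi j z = phi j w ∨ phi i y = phi i w) → ∃ x, st i x y ∧ st j x z
  ax3 : ∀ {i j w q s}, i ≠ j → st i q w → st j s w → phi j q ≠ phi j w → phi i s ≠ phi i w →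
    ∃ x y z p r, st i x y ∧ st j y p ∧ st j p q ∧ st j x z ∧ st i z r ∧ st i r s

namespace Crys

variable {V ι : Type} (C : Crys V ι)

def path : List ι → V → V → Prop
  | [], x, h => x = h
  | i :: w, x, h => ∃ y, C.st i x y ∧ path w y h

def HW (h : V) : Prop := ∀ i, C.eps i h = 0

def Reach (x h : V) : Prop := ∃ w, C.path w x h

theorem path_rank {w : List ι} {x h : V} (hp : C.path w x h) :
    C.rank x = C.rank h + w.length := by
  induction w generalizing x with
  | nil => simp [path] at hp; simp [hp]
  | cons i w ih =>
    obtain ⟨y, h1, h2⟩ := hp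
    rw [C.rank_st h1, ih h2]; simp; ring

theorem path_inj {w : List ι} {x x' h : V} (hp : C.path w x h) (hp' : C.path w x' h) :
    x = x' := by
  induction w generalizing x x' with
  | nil => simp [path] at hp hp'; simp [hp, hp']
  | cons i w ih =>
    obtain ⟨y, h1, h2⟩ := hp
    obtain ⟨y', h1', h2'⟩ := hp'
    obtain rfl := ih h2 h2'
    exact C.st_inj h1 h1'

theorem reach_refl (x : V) : C.Reach x x := ⟨[], rfl⟩

theorem reach_step {i : ι} {x y h : V} (h1 : C.st i x y) (h2 : C.Reach y h) : C.Reach x h := by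
  obtain ⟨w, hw⟩ := h2
  exact ⟨i :: w, y, h1, hw⟩

theorem reach_trans {x y z : V} (h1 : C.Reach x y) (h2 : C.Reach y z) : C.Reach x z := by
  obtain ⟨w, hw⟩ := h1
  induction w generalizing x with
  | nil => simp [path] at hw; rw [hw]; exact h2
  | cons i w ih =>
    obtain ⟨y', h1, h3⟩ := hw
    exact C.reach_step h1 (ih h3)

theorem hw_no_st {h y : V} {i : ι} (hh : C.HW h) : ¬ C.st i h y := by
  intro hs
  have := C.eps_pos hs
  rw [hh i] at this; exact absurd this (lt_irrefl _)

theorem exists_hw (x : V) : ∃ h, C.HW h ∧ C.Reach x h := by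
  induction hn : C.rank x generalizing x with
  | zero =>
    refine ⟨x, fun i => ?_, C.reach_refl x⟩
    by_contra hne
    have h0 := C.eps_nonneg i x
    obtain ⟨y, hy⟩ := C.ex_e (i := i) (x := x) (by omega)
    have := C.rank_st hy; omega
  | succ n ih =>
    by_cases hh : C.HW x
    · exact ⟨x, hh, C.reach_refl x⟩
    · simp only [HW, not_forall] at hh
      obtain ⟨i, hne⟩ := hh
      have h0 := C.eps_nonneg i x
      obtain ⟨y, hy⟩ := C.ex_e (i := i) (x := x) (by omega)
      have := C.rank_st hy
      obtain ⟨h, h1, h2⟩ := ih y (by omega)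
      exact ⟨h, h1, C.reach_step hy h2⟩

theorem reach_up_aux (n : ℕ) : ∀ x i y h, C.rank x < n → C.HW h → C.Reach x h → C.st i x y →
    C.Reach y h := by
  induction n with
  | zero => intro x i y h hx; omega
  | succ n ih =>
    have key : ∀ w x z h, C.rank x < n → C.HW h → C.Reach x h → C.path w x z → C.Reach z h := by
      intro w
      induction w with
      | nil => intro x z h _ _ hr hp; simp [path] at hp; rw [← hp]; exact hr
      | cons i w ihw =>
        intro x z h hx hh hr hp
        obtain ⟨y, h1, h2⟩ := hp
        have := C.rank_st h1
        exact ihw y z h (by omega) hh (ih x i y h hx hh hr h1) h2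
    intro x i y h hx hh hr hs
    obtain ⟨v, hv⟩ := hr
    cases v with
    | nil => simp [path] at hv; subst hv; exact absurd hs (C.hw_no_st hh)
    | cons j v =>
      obtain ⟨z, h1, h2⟩ := hv
      have hrz := C.rank_st h1
      by_cases hij : i = j
      · subst hij; rw [C.st_fun hs h1]; exact ⟨v, h2⟩
      · rcases C.ax1 hij hs h1 with ⟨w, a1, a2, -⟩ | ⟨p, q, r, s, w, a1, a2, a3, a4, a5, a6, -⟩
        · exact C.reach_step a1 (key [i] z w h (by omega) hh ⟨v, h2⟩ ⟨w, a2, rfl⟩)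
        · exact C.reach_step a1 (C.reach_step a2 (C.reach_step a3
            (key [i, i, j] z w h (by omega) hh ⟨v, h2⟩ ⟨r, a4, s, a5, w, a6, rfl⟩)))

theorem reach_up {x y h : V} {i : ι} (hh : C.HW h) (hr : C.Reach x h) (hs : C.st i x y) :
    C.Reach y h := C.reach_up_aux (C.rank x + 1) x i y h (by omega) hh hr hs

theorem reach_unique {x h h' : V} (hh : C.HW h) (hh' : C.HW h') (hr : C.Reach x h)
    (hr' : C.Reach x h') : h = h' := by
  obtain ⟨w, hw⟩ := hr'
  induction w generalizing x with
  | nil =>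
    simp [path] at hw; subst hw
    obtain ⟨v, hv⟩ := hr
    cases v with
    | nil => exact hv.symm
    | cons j v => obtain ⟨z, h1, h2⟩ := hv; exact absurd h1 (C.hw_no_st hh')
  | cons i w ih =>
    obtain ⟨y, h1, h2⟩ := hw
    exact ih (C.reach_up hh hr h1) h2

/-- weights differ equally -/
theorem path_wt {w : List ι} {x h x' h' : V} (hp : C.path w x h) (hp' : C.path w x' h')
    (hc : ∀ i, C.phi i h - C.eps i h = C.phi i h' - C.eps i h') (j : ι) :
    C.phi j x - C.eps j x = C.phi j x' - C.eps j x' := by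
  induction w generalizing x x' with
  | nil => simp [path] at hp hp'; subst hp; subst hp'; exact hc j
  | cons i w ih =>
    obtain ⟨y, h1, h2⟩ := hp
    obtain ⟨y', h1', h2'⟩ := hp'
    have := ih h2 h2'
    have a := C.wt_st j h1
    have b := C.wt_st j h1'
    omega

def S (n : ℕ) : Prop := ∀ h h', C.HW h → C.HW h' → (∀ i, C.phi i h = C.phi i h') →
  ∀ w, w.length = n → ∀ x, C.path w x h →
    (∃ x', C.path w x' h') ∧
    ∀ x', C.path w x' h' → (∀ v, C.path v x h → C.path v x' h') ∧
      ∀ k, C.eps k x = C.eps k x'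

theorem S_all (n : ℕ) : C.S n := by
  induction n using Nat.strong_induction_on with
  | _ n IH =>
  cases n with
  | zero =>
    intro h h' hh hh' hph w hw x hx
    have : w = [] := List.length_eq_zero_iff.mp hw
    subst this
    simp only [path] at hx; subst hx
    refine ⟨⟨h', rfl⟩, ?_⟩
    intro x' hx'; simp only [path] at hx'; subst hx'
    refine ⟨?_, fun k => by rw [hh k, hh' k]⟩
    intro v hv
    have h1 := C.path_rank hv
    have : v = [] := List.length_eq_zero_iff.mp (by omega)
    subst this; rfl
  | succ n =>
    -- first the half statement
    have B : ∀ h h', C.HW h → C.HW h' → (∀ i, C.phi i h = C.phi i h') →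
        ∀ w, w.length = n + 1 → ∀ x, C.path w x h → ∀ x', C.path w x' h' →
          (∀ v, C.path v x h → C.path v x' h') := by
      intro h h' hh hh' hph w hw x hx x' hx' v hv
      have hc : ∀ i, C.phi i h - C.eps i h = C.phi i h' - C.eps i h' := by
        intro i; rw [hh i, hh' i, hph i]
      have tr : ∀ u x x', u.length ≤ n → C.path u x h → C.path u x' h' →
          ∀ k, C.phi k x = C.phi k x' := by
        intro u x x' hu hp hp' k
        have h1 := C.path_wt hp hp' hc k
        have h2 := ((IH u.length (by omega) h h' hh hh' hph u rfl x hp).2 x' hp').2 k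
        omega
      have trv : ∀ u x x', u.length ≤ n → C.path u x h → C.path u x' h' →
          ∀ v, C.path v x h → C.path v x' h' := by
        intro u x x' hu hp hp'
        exact ((IH u.length (by omega) h h' hh hh' hph u rfl x hp).2 x' hp').1
      have tre : ∀ u x, u.length ≤ n → C.path u x h → ∃ x', C.path u x' h' := by
        intro u x hu hp
        exact (IH u.length (by omega) h h' hh hh' hph u rfl x hp).1
      have hlen : v.length = n + 1 := by
        have := C.path_rank hx; have := C.path_rank hv; omega
      match w, hw, hx, hx' with
      | [], hw, _, _ => simp at hw
      | i :: w, hw, ⟨y, hxy, hy⟩, ⟨y', hxy', hy'⟩ =>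
      match v, hlen, hv with
      | [], hv, _ => simp at hv
      | j :: v, hlen, ⟨z, hxz, hz⟩ =>
      have hwl : w.length = n := by simpa using hw
      have hvl : v.length = n := by simpa using hlen
      by_cases hij : i = j
      · subst hij
        obtain rfl := C.st_fun hxy hxz
        exact ⟨y', hxy', trv w y y' hwl.le hy hy' v hz⟩
      · rcases C.ax1 hij hxy hxz with ⟨t, a1, a2, a3⟩ |
          ⟨p, q, r, s, t, a1, a2, a3, a4, a5, a6, a7, a8⟩
        · obtain ⟨u, hu⟩ := C.reach_up hh ⟨w, hy⟩ a1
          have hul : u.length + 1 = n := by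
            have := C.path_rank hu; have := C.path_rank hy; have := C.rank_st a1; omega
          obtain ⟨t', b1, hu'⟩ := trv w y y' hwl.le hy hy' (j :: u) ⟨t, a1, hu⟩
          obtain ⟨z', hz'⟩ := tre (i :: u) z (by simp; omega) ⟨t, a2, hu⟩
          obtain ⟨t'', b2, hu''⟩ := hz'
          obtain rfl := C.path_inj hu' hu''
          have e1 := tr (i :: u) z z' (by simp; omega) ⟨t, a2, hu⟩ ⟨t', b2, hu'⟩ j
          have e2 := tr w y y' hwl.le hy hy' i
          have e3 := tr u t t' (by omega) hu hu'
          rw [e1, e2, e3 i, e3 j] at a3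
          obtain ⟨x'', c1, c2⟩ := C.ax2 hij b1 b2 a3
          obtain rfl := C.st_inj c1 hxy'
          exact ⟨z', c2, trv (i :: u) z z' (by simp; omega) ⟨t, a2, hu⟩ ⟨t', b2, hu'⟩ v hz⟩
        · obtain ⟨u, hu⟩ := C.reach_up hh (C.reach_up hh (C.reach_up hh ⟨w, hy⟩ a1) a2) a3
          have hul : u.length + 3 = n := by
            have := C.path_rank hu; have := C.path_rank hy; have := C.rank_st a1
            have := C.rank_st a2; have := C.rank_st a3; omega
          obtain ⟨p', b1, q', b2, t', b3, hu'⟩ := trv w y y' hwl.le hy hy' (j :: j :: i :: u)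
            ⟨p, a1, q, a2, t, a3, hu⟩
          obtain ⟨z', r', b4, s', b5, t'', b6, hu''⟩ := tre (i :: i :: j :: u) z
            (by simp; omega) ⟨r, a4, s, a5, t, a6, hu⟩
          obtain rfl := C.path_inj hu' hu''
          have e1 := tr (i :: u) q q' (by simp; omega) ⟨t, a3, hu⟩ ⟨t', b3, hu'⟩ j
          have e2 := tr (j :: u) s s' (by simp; omega) ⟨t, a6, hu⟩ ⟨t', b6, hu'⟩ i
          have e3 := tr u t t' (by omega) hu hu'
          rw [e1, e3 j] at a7
          rw [e2, e3 i] at a8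
          obtain ⟨x'', y'', z'', p'', r'', c1, c2, c3, c4, c5, c6⟩ := C.ax3 hij b3 b6 a7 a8
          obtain rfl := C.st_inj c3 b2
          obtain rfl := C.st_inj c2 b1
          obtain rfl := C.st_inj c1 hxy'
          obtain rfl := C.st_inj c6 b5
          obtain rfl := C.st_inj c5 b4
          exact ⟨z'', c4, trv (i :: i :: j :: u) z z'' (by simp; omega)
            ⟨r, a4, s, a5, t, a6, hu⟩ ⟨r'', b4, s', b5, t', b6, hu'⟩ v hz⟩
    have A : ∀ h h', C.HW h → C.HW h' → (∀ i, C.phi i h = C.phi i h') →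
        ∀ w, w.length = n + 1 → ∀ x, C.path w x h → ∀ x', C.path w x' h' →
          ∀ k, 0 < C.eps k x → C.eps k x = C.eps k x' := by
      intro h h' hh hh' hph w hw x hx x' hx' k hk
      obtain ⟨z, hz⟩ := C.ex_e hk
      obtain ⟨v, hv⟩ := C.reach_up hh ⟨w, hx⟩ hz
      have hvl : v.length = n := by
        have := C.path_rank hv; have := C.path_rank hx; have := C.rank_st hz; omega
      obtain ⟨z', hz', hv'⟩ := B h h' hh hh' hph w hw x hx x' hx' (k :: v) ⟨z, hz, hv⟩
      rw [C.eps_st hz, C.eps_st hz',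
        ((IH n (by omega) h h' hh hh' hph v hvl z hv).2 z' hv').2 k]
    intro h h' hh hh' hph w hw x hx
    refine ⟨?_, fun x' hx' => ⟨B h h' hh hh' hph w hw x hx x' hx', fun k => ?_⟩⟩
    · match w, hw, hx with
      | [], hw, _ => simp at hw
      | i :: w, hw, ⟨y, hxy, hy⟩ =>
        have hwl : w.length = n := by simpa using hw
        obtain ⟨⟨y', hy'⟩, h2⟩ := IH n (by omega) h h' hh hh' hph w hwl y hy
        have e1 := (h2 y' hy').2 i
        have e2 := C.path_wt hy hy' (fun i => by rw [hh i, hh' i, hph i]) i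
        have e3 := C.phi_pos hxy
        obtain ⟨x', hx'⟩ := C.ex_f (i := i) (x := y') (by omega)
        exact ⟨x', y', hx', hy'⟩
    · rcases (C.eps_nonneg k x).lt_or_eq with hk | hk
      · exact A h h' hh hh' hph w hw x hx x' hx' k hk
      · rcases (C.eps_nonneg k x').lt_or_eq with hk' | hk'
        · exact (A h' h hh' hh (fun i => (hph i).symm) w hw x' hx' x hx k hk').symm
        · omega

/-- Main conclusion: sums of a weight function over two components agree. -/
theorem sum_eq {R : Type} [AddCommMonoid R] {W : Type} [AddGroup W] (wt : V → W) (rt : ι → W)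
    (hwt : ∀ i x y, C.st i x y → wt x = wt y + rt i) (F : W → R)
    {h h' : V} (hh : C.HW h) (hh' : C.HW h') (hph : ∀ i, C.phi i h = C.phi i h')
    (hw : wt h = wt h') (A A' : Finset V) (hA : ∀ x, x ∈ A ↔ C.Reach x h)
    (hA' : ∀ x, x ∈ A' ↔ C.Reach x h') : ∑ x ∈ A, F (wt x) = ∑ x ∈ A', F (wt x) := by
  classical
  have ex : ∀ x ∈ A, ∃ x', ∃ w, C.path w x h ∧ C.path w x' h' := by
    intro x hx
    obtain ⟨w, hw⟩ := (hA x).1 hx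
    obtain ⟨x', hx'⟩ := (C.S_all w.length h h' hh hh' hph w rfl x hw).1
    exact ⟨x', w, hw, hx'⟩
  choose g hg using ex
  refine Finset.sum_bij g ?_ ?_ ?_ ?_
  · intro x hx
    obtain ⟨w, h1, h2⟩ := hg x hx
    exact (hA' _).2 ⟨w, h2⟩
  · intro x hx y hy hxy
    obtain ⟨w, h1, h2⟩ := hg x hx
    obtain ⟨v, h3, h4⟩ := hg y hy
    rw [← hxy] at h4
    have := ((C.S_all w.length h' h hh' hh (fun i => (hph i).symm) w rfl _ h2).2 x h1).1 v h4
    exact C.path_inj this h3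
  · intro x' hx'
    obtain ⟨w, hw'⟩ := (hA' x').1 hx'
    obtain ⟨x, hx⟩ := (C.S_all w.length h' h hh' hh (fun i => (hph i).symm) w rfl x' hw').1
    have hxA : x ∈ A := (hA x).2 ⟨w, hx⟩
    refine ⟨x, hxA, ?_⟩
    obtain ⟨v, h3, h4⟩ := hg x hxA
    have := ((C.S_all w.length h h' hh hh' hph w rfl x hx).2 x' hw').1 v h3
    exact C.path_inj h4 this
  · intro x hx
    obtain ⟨w, h1, h2⟩ := hg x hx
    congr 1
    generalize g x hx = x' at h2
    clear hx
    induction w generalizing x x' with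
    | nil => simp only [path] at h1 h2; rw [h1, h2, hw]
    | cons i w ih =>
      obtain ⟨y, a1, a2⟩ := h1
      obtain ⟨y', b1, b2⟩ := h2
      rw [hwt i x y a1, hwt i x' y' b1, ih y a2 y' b2]

end Crys

/-- indicator of `j ≤ R` -/
def dl (j R : ℤ) : ℤ := if j ≤ R then 1 else 0

theorem dl_spec (j R : ℤ) : (j ≤ R ∧ dl j R = 1) ∨ (R < j ∧ dl j R = 0) := by
  unfold dl; split_ifs with h
  · exact Or.inl ⟨h, rfl⟩
  · exact Or.inr ⟨by omega, rfl⟩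

/-- `R` is the largest argmax of `f` -/
def LA (f : ℤ → ℤ) (R : ℤ) : Prop := (∀ j, f j ≤ f R) ∧ ∀ j, R < j → f j < f R

theorem LA.uniq {f : ℤ → ℤ} {R S : ℤ} (h : LA f R) (h' : LA f S) : R = S := by
  rcases lt_trichotomy R S with hl | hl | hl
  · have := h.2 S hl; have := h'.1 R; omega
  · exact hl
  · have := h'.2 R hl; have := h.1 S; omega

/-- `R` is the smallest argmax of `f` -/
def SA (f : ℤ → ℤ) (R : ℤ) : Prop := (∀ j, f j ≤ f R) ∧ ∀ j, j < R → f j < f R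

theorem SA.uniq {f : ℤ → ℤ} {R S : ℤ} (h : SA f R) (h' : SA f S) : R = S := by
  rcases lt_trichotomy R S with hl | hl | hl
  · have := h'.2 R hl; have := h.1 S; omega
  · exact hl
  · have := h.2 S hl; have := h'.1 R; omega

noncomputable def mxv (f : ℤ → ℤ) : ℤ := sSup (Set.range f)

theorem mxv_eq {f : ℤ → ℤ} (R : ℤ) {μ : ℤ} (h : ∀ j, f j ≤ μ) (h2 : f R = μ) : mxv f = μ := by
  refine IsGreatest.csSup_eq ⟨⟨R, h2⟩, ?_⟩
  rintro _ ⟨j, rfl⟩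
  exact h j

structure TwoOp (W : Type) where
  rX : ℤ → W → W
  rY : ℤ → W → W
  EX : W → ℤ → ℤ
  EY : W → ℤ → ℤ
  thX : W → ℤ → ℤ
  thY : W → ℤ → ℤ
  XX : ∀ P R j, EX (rX R P) j = EX P j - dl j R - dl j (R - 1)
  YY : ∀ P R j, EY (rY R P) j = EY P j - dl j R - dl j (R - 1)
  XY : ∀ P R j, EY (rX R P) j = EY P j + dl j (thX P R)
  YX : ∀ P R j, EX (rY R P) j = EX P j + dl j (thY P R)
  tXY : ∀ P S R, thX (rY S P) R = thX P R
  tYX : ∀ P S R, thY (rX S P) R = thY P R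
  tXX : ∀ P S R, S ≠ R → thX (rX S P) R = thX P R
  tYY : ∀ P S R, S ≠ R → thY (rY S P) R = thY P R
  cXX : ∀ P R S, rX R (rX S P) = rX S (rX R P)
  cYY : ∀ P R S, rY R (rY S P) = rY S (rY R P)
  cXY : ∀ P R S, rX R (rY S P) = rY S (rX R P)

namespace TwoOp

variable {W : Type} (T : TwoOp W)

def swap : TwoOp W where
  rX := T.rY
  rY := T.rX
  EX := T.EY
  EY := T.EX
  thX := T.thY
  thY := T.thX
  XX := T.YY
  YY := T.XX
  XY := T.YX
  YX := T.XY
  tXY := T.tYX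
  tYX := T.tXY
  tXX := T.tYY
  tYY := T.tXX
  cXX := T.cYY
  cYY := T.cXX
  cXY := fun P R S => (T.cXY P S R).symm

def stX (P Q : W) : Prop := ∃ R, LA (T.EX P) R ∧ 0 < T.EX P R ∧ Q = T.rX R P
def stY (P Q : W) : Prop := ∃ R, LA (T.EY P) R ∧ 0 < T.EY P R ∧ Q = T.rY R P

def Qd (P : W) (R S : ℤ) : Prop :=
  (mxv (T.EY (T.rX R P)) = mxv (T.EY P) ∨ mxv (T.EX (T.rY S P)) = mxv (T.EX P)) ∧
  ∃ w, T.stY (T.rX R P) w ∧ T.stX (T.rY S P) w ∧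
    (mxv (T.EY w) = mxv (T.EY (T.rY S P)) + 1 ∨ mxv (T.EX w) = mxv (T.EX (T.rX R P)) + 1)

def Oc (P : W) (R S : ℤ) : Prop :=
  (mxv (T.EY (T.rX R P)) = mxv (T.EY P) + 1 ∧ mxv (T.EX (T.rY S P)) = mxv (T.EX P) + 1) ∧
  ∃ p q r s w, T.stY (T.rX R P) p ∧ T.stY p q ∧ T.stX q w ∧
    T.stX (T.rY S P) r ∧ T.stX r s ∧ T.stY s w ∧
    mxv (T.EY w) = mxv (T.EY q) ∧ mxv (T.EX w) = mxv (T.EX s)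

theorem Qd_swap {P : W} {R S : ℤ} (h : T.swap.Qd P S R) : T.Qd P R S := by
  obtain ⟨h1, w, h2, h3, h4⟩ := h
  exact ⟨h1.symm, w, h3, h2, h4.symm⟩

theorem Oc_swap {P : W} {R S : ℤ} (h : T.swap.Oc P S R) : T.Oc P R S := by
  obtain ⟨⟨h1, h1'⟩, p, q, r, s, w, h2, h3, h4, h5, h6, h7, h8, h9⟩ := h
  exact ⟨⟨h1', h1⟩, r, s, p, q, w, h5, h6, h7, h2, h3, h4, h9, h8⟩

theorem quad {P : W} {R S : ℤ} (hR : LA (T.EX P) R) (hR0 : 0 < T.EX P R)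
    (hS : LA (T.EY P) S) (hS0 : 0 < T.EY P S) (h1 : T.thX P R < S) (h2 : R ≤ T.thY P S)
    (h3 : ∀ j, j ≤ T.thX P R → T.EY P j < T.EY P S) : T.Qd P R S := by
  generalize hth : T.thX P R = th at *
  generalize hth' : T.thY P S = th' at *
  have eY : mxv (T.EY P) = T.EY P S := mxv_eq S hS.1 rfl
  refine ⟨Or.inl ?_, T.rY S (T.rX R P), ⟨S, ⟨?_, ?_⟩, ?_, rfl⟩, ⟨R, ⟨?_, ?_⟩, ?_, ?_⟩, Or.inr ?_⟩
  · rw [eY]; refine mxv_eq S ?_ ?_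
    · intro j; rw [T.XY, hth]
      have := h3 j; have := hS.1 j; rcases dl_spec j th with h | h <;> omega
    · rw [T.XY, hth]; rcases dl_spec S th with h | h <;> omega
  · intro j; rw [T.XY, T.XY, hth]
    have := h3 j; have := hS.1 j; have := dl_spec j th; have := dl_spec S th; omega
  · intro j hj; rw [T.XY, T.XY, hth]
    have := hS.2 j hj; have := dl_spec j th; have := dl_spec S th; omega
  · rw [T.XY, hth]; have := dl_spec S th; omega
  · intro j; rw [T.YX, T.YX, hth']
    have := hR.1 j; have := dl_spec j th'; have := dl_spec R th'; omega
  · intro j hj; rw [T.YX, T.YX, hth']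
    have := hR.2 j hj; have := dl_spec j th'; have := dl_spec R th'; omega
  · rw [T.YX, hth']; have := dl_spec R th'; omega
  · rw [T.cXY]
  · have e1 : mxv (T.EX (T.rX R P)) = T.EX P R - 1 := by
      refine mxv_eq R ?_ ?_
      · intro j; rw [T.XX]
        have := hR.1 j; have := hR.2 j; have := dl_spec j R; have := dl_spec j (R - 1); omega
      · rw [T.XX]
        have := dl_spec R R; have := dl_spec R (R - 1); omega
    rw [e1]
    refine mxv_eq R ?_ ?_
    · intro j; rw [T.YX, T.XX, T.tYX, hth']
      have := hR.1 j; have := hR.2 j; have := dl_spec j R; have := dl_spec j (R - 1)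
      have := dl_spec j th'; omega
    · rw [T.YX, T.XX, T.tYX, hth']
      have := dl_spec R R; have := dl_spec R (R - 1); have := dl_spec R th'; omega

theorem oct {P : W} {R S S1 R2 : ℤ} (hR : LA (T.EX P) R) (hR0 : 0 < T.EX P R)
    (hS : LA (T.EY P) S) (hS0 : 0 < T.EY P S) (h1 : T.thX P R < S) (h2 : R ≤ T.thY P S)
    (hS1 : T.EY P S1 = T.EY P S) (hS1' : S1 ≤ T.thX P R)
    (hS1'' : ∀ j, S1 < j → j ≤ T.thX P R → T.EY P j < T.EY P S)
    (hR2 : R ≤ R2) (hR2' : R2 ≤ T.thY P S) (hR2e : R2 = R ∨ (R < R2 ∧ T.EX P R2 = T.EX P R - 1))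
    (hR2'' : ∀ j, R2 < j → j ≤ T.thY P S → T.EX P j < T.EX P R - 1)
    (h3 : T.thY P S1 < R) (h4 : T.thX P R ≤ T.thX (T.rX R P) R2)
    (h5 : T.thX (T.rX R P) R2 < S) : T.Oc P R S := by
  have hne : S1 ≠ S := by omega
  generalize hth : T.thX P R = th at *
  generalize hth' : T.thY P S = th' at *
  generalize hth1 : T.thY P S1 = th1 at *
  generalize hth2 : T.thX (T.rX R P) R2 = th2 at *
  have eY : mxv (T.EY P) = T.EY P S := mxv_eq S hS.1 rfl
  have eX : mxv (T.EX P) = T.EX P R := mxv_eq R hR.1 rfl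
  have t1 : T.thY (T.rX R P) S1 = th1 := by rw [T.tYX, hth1]
  have t2 : T.thY (T.rY S1 (T.rX R P)) S = th' := by rw [T.tYY _ _ _ hne, T.tYX, hth']
  have t3 : T.thX (T.rY S (T.rY S1 (T.rX R P))) R2 = th2 := by rw [T.tXY, T.tXY, hth2]
  have t4 : T.thX (T.rY S P) R = th := by rw [T.tXY, hth]
  have t5 : T.thX (T.rX R (T.rY S P)) R2 = th2 := by rw [T.cXY, T.tXY, hth2]
  have t6 : T.thY (T.rX R2 (T.rX R (T.rY S P))) S1 = th1 := by
    rw [T.tYX, T.tYX, T.tYY _ _ _ hne.symm, hth1]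
  have f : T.rY S1 (T.rX R2 (T.rX R (T.rY S P))) = T.rX R2 (T.rY S (T.rY S1 (T.rX R P))) := by
    rw [← T.cXY, ← T.cXY, T.cYY, T.cXY _ R, T.cXY _ R]
  refine ⟨⟨?_, ?_⟩, T.rY S1 (T.rX R P), T.rY S (T.rY S1 (T.rX R P)), T.rX R (T.rY S P),
    T.rX R2 (T.rX R (T.rY S P)), T.rX R2 (T.rY S (T.rY S1 (T.rX R P))),
    ⟨S1, ⟨?_, ?_⟩, ?_, rfl⟩, ⟨S, ⟨?_, ?_⟩, ?_, rfl⟩, ⟨R2, ⟨?_, ?_⟩, ?_, rfl⟩,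
    ⟨R, ⟨?_, ?_⟩, ?_, rfl⟩, ⟨R2, ⟨?_, ?_⟩, ?_, rfl⟩, ⟨S1, ⟨?_, ?_⟩, ?_, f.symm⟩, ?_, ?_⟩
  · rw [eY]; refine mxv_eq S1 ?_ ?_
    · intro j; rw [T.XY, hth]
      have := hS.1 j; have := dl_spec j th; omega
    · rw [T.XY, hth]; have := dl_spec S1 th; omega
  · rw [eX]; refine mxv_eq R ?_ ?_
    · intro j; rw [T.YX, hth']
      have := hR.1 j; have := dl_spec j th'; omega
    · rw [T.YX, hth']; have := dl_spec R th'; omega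
  -- S1 at P1
  · intro j; rw [T.XY, T.XY, hth]
    have := hS.1 j; have := dl_spec j th; have := dl_spec S1 th; omega
  · intro j hj; rw [T.XY, T.XY, hth]
    have := hS1'' j hj; have := hS.1 j; have := dl_spec j th; have := dl_spec S1 th; omega
  · rw [T.XY, hth]; have := dl_spec S1 th; omega
  -- S at P2
  · intro j; rw [T.YY, T.YY, T.XY, T.XY, hth]
    have := hS1'' j; have := hS.1 j; have := dl_spec j th; have := dl_spec S th
    have := dl_spec j S1; have := dl_spec j (S1 - 1)
    have := dl_spec S S1; have := dl_spec S (S1 - 1); omega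
  · intro j hj; rw [T.YY, T.YY, T.XY, T.XY, hth]
    have := hS.2 j hj; have := dl_spec j th; have := dl_spec S th
    have := dl_spec j S1; have := dl_spec j (S1 - 1)
    have := dl_spec S S1; have := dl_spec S (S1 - 1); omega
  · rw [T.YY, T.XY, hth]
    have := dl_spec S th
    have := dl_spec S S1; have := dl_spec S (S1 - 1); omega
  -- R2 at P3
  · intro j; rw [T.YX, T.YX, T.YX, T.YX, T.XX, T.XX, t1, t2]
    have := hR.1 j; have := hR.2 j; have := hR2'' j
    have := dl_spec j th1; have := dl_spec R2 th1
    have := dl_spec j th'; have := dl_spec R2 th'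
    have := dl_spec j R; have := dl_spec j (R - 1)
    have := dl_spec R2 R; have := dl_spec R2 (R - 1)
    rcases hR2e with rfl | hR2e <;> omega
  · intro j hj; rw [T.YX, T.YX, T.YX, T.YX, T.XX, T.XX, t1, t2]
    have := hR.2 j; have := hR2'' j
    have := dl_spec j th1; have := dl_spec R2 th1
    have := dl_spec j th'; have := dl_spec R2 th'
    have := dl_spec j R; have := dl_spec j (R - 1)
    have := dl_spec R2 R; have := dl_spec R2 (R - 1)
    rcases hR2e with rfl | hR2e <;> omega
  · rw [T.YX, T.YX, T.XX, t1, t2]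
    have := dl_spec R2 th1
    have := dl_spec R2 th'
    have := dl_spec R2 R; have := dl_spec R2 (R - 1)
    rcases hR2e with rfl | hR2e <;> omega
  -- R at Q1
  · intro j; rw [T.YX, T.YX, hth']
    have := hR.1 j; have := dl_spec j th'; have := dl_spec R th'; omega
  · intro j hj; rw [T.YX, T.YX, hth']
    have := hR.2 j hj; have := dl_spec j th'; have := dl_spec R th'; omega
  · rw [T.YX, hth']; have := dl_spec R th'; omega
  -- R2 at Q2
  · intro j; rw [T.XX, T.XX, T.YX, T.YX, hth']
    have := hR.1 j; have := hR.2 j; have := hR2'' j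
    have := dl_spec j th'; have := dl_spec R2 th'
    have := dl_spec j R; have := dl_spec j (R - 1)
    have := dl_spec R2 R; have := dl_spec R2 (R - 1)
    rcases hR2e with rfl | hR2e <;> omega
  · intro j hj; rw [T.XX, T.XX, T.YX, T.YX, hth']
    have := hR.2 j; have := hR2'' j
    have := dl_spec j th'; have := dl_spec R2 th'
    have := dl_spec j R; have := dl_spec j (R - 1)
    have := dl_spec R2 R; have := dl_spec R2 (R - 1)
    rcases hR2e with rfl | hR2e <;> omega
  · rw [T.XX, T.YX, hth']
    have := dl_spec R2 th'
    have := dl_spec R2 R; have := dl_spec R2 (R - 1)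
    rcases hR2e with rfl | hR2e <;> omega
  -- S1 at Q3
  · intro j; rw [T.XY, T.XY, T.XY, T.XY, T.YY, T.YY, t4, t5]
    have := hS.1 j; have := hS.2 j; have := hS1'' j
    have := dl_spec j th; have := dl_spec S1 th
    have := dl_spec j th2; have := dl_spec S1 th2
    have := dl_spec j S; have := dl_spec j (S - 1)
    have := dl_spec S1 S; have := dl_spec S1 (S - 1)
    omega
  · intro j hj; rw [T.XY, T.XY, T.XY, T.XY, T.YY, T.YY, t4, t5]
    have := hS.1 j; have := hS.2 j; have := hS1'' j
    have := dl_spec j th; have := dl_spec S1 th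
    have := dl_spec j th2; have := dl_spec S1 th2
    have := dl_spec j S; have := dl_spec j (S - 1)
    have := dl_spec S1 S; have := dl_spec S1 (S - 1)
    omega
  · rw [T.XY, T.XY, T.YY, t4, t5]
    have := dl_spec S1 th
    have := dl_spec S1 th2
    have := dl_spec S1 S; have := dl_spec S1 (S - 1)
    omega
  -- final EY
  · have key : ∀ j, T.EY (T.rY S (T.rY S1 (T.rX R P))) j =
        T.EY P j + dl j th - dl j S1 - dl j (S1 - 1) - dl j S - dl j (S - 1) := by
      intro j; rw [T.YY, T.YY, T.XY, hth]
    have e1 : mxv (T.EY (T.rY S (T.rY S1 (T.rX R P)))) = T.EY P S - 1 := by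
      refine mxv_eq S ?_ ?_
      · intro j; rw [key]
        have := hS.1 j; have := hS.2 j; have := hS1'' j
        have := dl_spec j th
        have := dl_spec j S1; have := dl_spec j (S1 - 1)
        have := dl_spec j S; have := dl_spec j (S - 1); omega
      · rw [key]
        have := dl_spec S th
        have := dl_spec S S1; have := dl_spec S (S1 - 1)
        have := dl_spec S S; have := dl_spec S (S - 1); omega
    rw [e1]
    refine mxv_eq S ?_ ?_
    · intro j; rw [T.XY, key, t3]
      have := hS.1 j; have := hS.2 j; have := hS1'' j
      have := dl_spec j th; have := dl_spec j th2
      have := dl_spec j S1; have := dl_spec j (S1 - 1)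
      have := dl_spec j S; have := dl_spec j (S - 1); omega
    · rw [T.XY, key, t3]
      have := dl_spec S th; have := dl_spec S th2
      have := dl_spec S S1; have := dl_spec S (S1 - 1)
      have := dl_spec S S; have := dl_spec S (S - 1); omega
  · rw [← f]
    have key : ∀ j, T.EX (T.rX R2 (T.rX R (T.rY S P))) j =
        T.EX P j + dl j th' - dl j R - dl j (R - 1) - dl j R2 - dl j (R2 - 1) := by
      intro j; rw [T.XX, T.XX, T.YX, hth']
    have e1 : mxv (T.EX (T.rX R2 (T.rX R (T.rY S P)))) = T.EX P R - 1 := by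
      refine mxv_eq R2 ?_ ?_
      · intro j; rw [key]
        have := hR.1 j; have := hR.2 j; have := hR2'' j
        have := dl_spec j th'
        have := dl_spec j R2; have := dl_spec j (R2 - 1)
        have := dl_spec j R; have := dl_spec j (R - 1); omega
      · rw [key]
        have := dl_spec R2 th'
        have := dl_spec R2 R2; have := dl_spec R2 (R2 - 1)
        have := dl_spec R2 R; have := dl_spec R2 (R - 1)
        rcases hR2e with rfl | hR2e <;> omega
    rw [e1]
    refine mxv_eq R2 ?_ ?_
    · intro j; rw [T.YX, key, t6]
      have := hR.1 j; have := hR.2 j; have := hR2'' j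
      have := dl_spec j th'; have := dl_spec j th1
      have := dl_spec j R2; have := dl_spec j (R2 - 1)
      have := dl_spec j R; have := dl_spec j (R - 1); omega
    · rw [T.YX, key, t6]
      have := dl_spec R2 th'; have := dl_spec R2 th1
      have := dl_spec R2 R2; have := dl_spec R2 (R2 - 1)
      have := dl_spec R2 R; have := dl_spec R2 (R - 1)
      rcases hR2e with rfl | hR2e <;> omega

set_option maxHeartbeats 1000000 in
theorem oct4 {P : W} {R : ℤ} (hR : LA (T.EX P) R) (hR0 : 0 < T.EX P R)
    (hS : LA (T.EY P) (R - 1)) (hS0 : 0 < T.EY P (R - 1))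
    (hth : T.thX P R = R - 2) (hth' : T.thY P (R - 1) = R - 1)
    (hu : T.EX P (R - 1) = T.EX P R) (hv : T.EY P (R - 2) = T.EY P (R - 1))
    (hth2 : T.thX P (R - 1) = R - 2) (hth1 : T.thY P (R - 2) = R - 1) :
    T.Oc P R (R - 1) := by
  have hne : R - 2 ≠ R - 1 := by omega
  have hne' : R ≠ R - 1 := by omega
  have eY : mxv (T.EY P) = T.EY P (R - 1) := mxv_eq (R - 1) hS.1 rfl
  have eX : mxv (T.EX P) = T.EX P R := mxv_eq R hR.1 rfl
  have t1 : T.thY (T.rX R P) (R - 2) = R - 1 := by rw [T.tYX, hth1]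
  have t2 : T.thY (T.rY (R - 2) (T.rX R P)) (R - 1) = R - 1 := by
    rw [T.tYY _ _ _ hne, T.tYX, hth']
  have t3 : T.thX (T.rY (R - 1) (T.rY (R - 2) (T.rX R P))) (R - 1) = R - 2 := by
    rw [T.tXY, T.tXY, T.tXX _ _ _ hne', hth2]
  have t4 : T.thX (T.rY (R - 1) P) (R - 1) = R - 2 := by rw [T.tXY, hth2]
  have t5 : T.thX (T.rX (R - 1) (T.rY (R - 1) P)) R = R - 2 := by
    rw [T.tXX _ _ _ hne'.symm, T.tXY, hth]
  have t6 : T.thY (T.rX R (T.rX (R - 1) (T.rY (R - 1) P))) (R - 2) = R - 1 := by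
    rw [T.tYX, T.tYX, T.tYY _ _ _ hne.symm, hth1]
  have f : T.rY (R - 2) (T.rX R (T.rX (R - 1) (T.rY (R - 1) P))) =
      T.rX (R - 1) (T.rY (R - 1) (T.rY (R - 2) (T.rX R P))) := by
    rw [T.cXX, ← T.cXY, ← T.cXY, T.cYY, T.cXY _ R, T.cXY _ R]
  have z0 := dl_spec R (R - 1)
  have z1 := dl_spec R R
  have z2 := dl_spec R (R - 2)
  have z3 := dl_spec (R - 1) (R - 1)
  have z4 := dl_spec (R - 1) R
  have z5 := dl_spec (R - 1) (R - 2)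
  have z6 := dl_spec (R - 2) (R - 1)
  have z7 := dl_spec (R - 2) R
  have z8 := dl_spec (R - 2) (R - 2)
  have z9 := dl_spec (R - 1) (R - 3)
  have z10 := dl_spec (R - 2) (R - 3)
  have r1 : R - 1 - 1 = R - 2 := by ring
  have r2 : R - 2 - 1 = R - 3 := by ring
  refine ⟨⟨?_, ?_⟩, T.rY (R - 2) (T.rX R P), T.rY (R - 1) (T.rY (R - 2) (T.rX R P)),
    T.rX (R - 1) (T.rY (R - 1) P),
    T.rX R (T.rX (R - 1) (T.rY (R - 1) P)), T.rX (R - 1) (T.rY (R - 1) (T.rY (R - 2) (T.rX R P))),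
    ⟨R - 2, ⟨?_, ?_⟩, ?_, rfl⟩, ⟨R - 1, ⟨?_, ?_⟩, ?_, rfl⟩, ⟨R - 1, ⟨?_, ?_⟩, ?_, rfl⟩,
    ⟨R - 1, ⟨?_, ?_⟩, ?_, rfl⟩, ⟨R, ⟨?_, ?_⟩, ?_, rfl⟩, ⟨R - 2, ⟨?_, ?_⟩, ?_, f.symm⟩, ?_, ?_⟩
  · rw [eY]; refine mxv_eq (R - 2) ?_ ?_
    · intro j; rw [T.XY, hth]
      have := hS.1 j; have := dl_spec j (R - 2); omega
    · rw [T.XY, hth]; omega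
  · rw [eX]; refine mxv_eq (R - 1) ?_ ?_
    · intro j; rw [T.YX, hth']
      have := hR.1 j; have := dl_spec j (R - 1); omega
    · rw [T.YX, hth']; omega
  -- R - 2 at P1
  · intro j; rw [T.XY, T.XY, hth]
    have := hS.1 j; have := dl_spec j (R - 2); omega
  · intro j hj; rw [T.XY, T.XY, hth]
    have := hS.1 j; have := dl_spec j (R - 2); omega
  · rw [T.XY, hth]; omega
  -- R - 1 at P2
  · intro j; rw [T.YY, T.YY, T.XY, T.XY, hth, r2]
    have := hS.1 j; have := dl_spec j (R - 2); have := dl_spec j (R - 3); omega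
  · intro j hj; rw [T.YY, T.YY, T.XY, T.XY, hth, r2]
    have := hS.2 j hj; have := dl_spec j (R - 2); have := dl_spec j (R - 3); omega
  · rw [T.YY, T.XY, hth, r2]; omega
  -- R - 1 at P3
  · intro j; rw [T.YX, T.YX, T.YX, T.YX, T.XX, T.XX, t1, t2]
    have := hR.1 j; have := hR.2 j
    have := dl_spec j R; have := dl_spec j (R - 1)
    omega
  · intro j hj; rw [T.YX, T.YX, T.YX, T.YX, T.XX, T.XX, t1, t2]
    have := hR.1 j; have := hR.2 j
    have := dl_spec j R; have := dl_spec j (R - 1)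
    omega
  · rw [T.YX, T.YX, T.XX, t1, t2]; omega
  -- R - 1 at Q1
  · intro j; rw [T.YX, T.YX, hth']
    have := hR.1 j; have := dl_spec j (R - 1); omega
  · intro j hj; rw [T.YX, T.YX, hth']
    have := hR.1 j; have := dl_spec j (R - 1); omega
  · rw [T.YX, hth']; omega
  -- R at Q2
  · intro j; rw [T.XX, T.XX, T.YX, T.YX, hth', r1]
    have := hR.1 j
    have := dl_spec j (R - 1); have := dl_spec j (R - 2); omega
  · intro j hj; rw [T.XX, T.XX, T.YX, T.YX, hth', r1]
    have := hR.2 j hj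
    have := dl_spec j (R - 1); have := dl_spec j (R - 2); omega
  · rw [T.XX, T.YX, hth', r1]; omega
  -- R - 2 at Q3
  · intro j; rw [T.XY, T.XY, T.XY, T.XY, T.YY, T.YY, t4, t5, r1]
    have := hS.1 j; have := hS.2 j
    have := dl_spec j (R - 1); have := dl_spec j (R - 2); omega
  · intro j hj; rw [T.XY, T.XY, T.XY, T.XY, T.YY, T.YY, t4, t5, r1]
    have := hS.1 j; have := hS.2 j
    have := dl_spec j (R - 1); have := dl_spec j (R - 2); omega
  · rw [T.XY, T.XY, T.YY, t4, t5, r1]; omega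
  · have key : ∀ j, T.EY (T.rY (R - 1) (T.rY (R - 2) (T.rX R P))) j =
        T.EY P j - dl j (R - 3) - dl j (R - 1) - dl j (R - 2) := by
      intro j; rw [T.YY, T.YY, T.XY, hth, r1, r2]; ring
    have e1 : mxv (T.EY (T.rY (R - 1) (T.rY (R - 2) (T.rX R P)))) = T.EY P (R - 1) - 1 := by
      refine mxv_eq (R - 1) ?_ ?_
      · intro j; rw [key]
        have := hS.1 j; have := hS.2 j
        have := dl_spec j (R - 1); have := dl_spec j (R - 2); have := dl_spec j (R - 3); omega
      · rw [key]; omega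
    rw [e1]
    refine mxv_eq (R - 1) ?_ ?_
    · intro j; rw [T.XY, key, t3]
      have := hS.1 j; have := hS.2 j
      have := dl_spec j (R - 1); have := dl_spec j (R - 2); have := dl_spec j (R - 3); omega
    · rw [T.XY, key, t3]; omega
  · rw [← f]
    have key : ∀ j, T.EX (T.rX R (T.rX (R - 1) (T.rY (R - 1) P))) j =
        T.EX P j - dl j (R - 2) - dl j R - dl j (R - 1) := by
      intro j; rw [T.XX, T.XX, T.YX, hth', r1]; ring
    have e1 : mxv (T.EX (T.rX R (T.rX (R - 1) (T.rY (R - 1) P)))) = T.EX P R - 1 := by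
      refine mxv_eq R ?_ ?_
      · intro j; rw [key]
        have := hR.1 j; have := hR.2 j
        have := dl_spec j (R - 1); have := dl_spec j (R - 2); have := dl_spec j R; omega
      · rw [key]; omega
    rw [e1]
    refine mxv_eq R ?_ ?_
    · intro j; rw [T.YX, key, t6]
      have := hR.1 j; have := hR.2 j
      have := dl_spec j (R - 1); have := dl_spec j (R - 2); have := dl_spec j R; omega
    · rw [T.YX, key, t6]; omega

end TwoOp

/-- raise level `t` at row `R` -/
def rse (t : ℕ) (R : ℤ) (P : ℕ → ℤ → ℤ) : ℕ → ℤ → ℤ :=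
  fun t' j => if t' = t ∧ j = R then P t' j + 1 else P t' j

theorem rse_apply (t : ℕ) (R : ℤ) (P : ℕ → ℤ → ℤ) (t' : ℕ) (j : ℤ) :
    rse t R P t' j = if t' = t ∧ j = R then P t' j + 1 else P t' j := rfl

theorem rse_same (t : ℕ) (R : ℤ) (P : ℕ → ℤ → ℤ) : rse t R P t R = P t R + 1 := by
  simp [rse_apply]

theorem rse_lvl {t t' : ℕ} (h : t' ≠ t) (R : ℤ) (P : ℕ → ℤ → ℤ) : rse t R P t' = P t' := by
  funext j; simp [rse_apply, h]

theorem rse_row (t t' : ℕ) {R j : ℤ} (h : j ≠ R) (P : ℕ → ℤ → ℤ) : rse t R P t' j = P t' j := by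
  simp [rse_apply, h]

theorem rse_comm (t t' : ℕ) (R S : ℤ) (P : ℕ → ℤ → ℤ) :
    rse t R (rse t' S P) = rse t' S (rse t R P) := by
  funext a j
  simp only [rse_apply]
  split_ifs <;> ring

theorem rse_inj {t : ℕ} {R : ℤ} {P Q : ℕ → ℤ → ℤ} (h : rse t R P = rse t R Q) : P = Q := by
  funext a j
  have := congrFun (congrFun h a) j
  simp only [rse_apply] at this
  split_ifs at this <;> omega

def FS (P : ℕ → ℤ → ℤ) : Prop := ∃ B : ℤ, ∀ t j, B < |j| → P t j = P 0 j

theorem FS.rse {P : ℕ → ℤ → ℤ} (h : FS P) (t : ℕ) (R : ℤ) : FS (rse t R P) := by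
  obtain ⟨B, hB⟩ := h
  refine ⟨max B |R|, fun t' j hj => ?_⟩
  have hne : j ≠ R := by rintro rfl; exact absurd hj (not_lt.2 (le_max_right _ _))
  rw [rse_row _ _ hne, rse_row _ _ hne]
  exact hB t' j (lt_of_le_of_lt (le_max_left _ _) hj)

theorem FS.fin {P : ℕ → ℤ → ℤ} (h : FS P) (t : ℕ) (j : ℤ) :
    (Function.support fun m => if j ≤ m then P t m - P 0 m else 0).Finite := by
  obtain ⟨B, hB⟩ := h
  refine (Set.finite_Icc (-B) B).subset ?_
  intro m hm
  by_contra hc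
  apply hm
  have : B < |m| := by
    rw [Set.mem_Icc, ← abs_le] at hc
    exact not_le.1 hc
  simp [hB t m this]

theorem FS.fin' {P : ℕ → ℤ → ℤ} (h : FS P) (t : ℕ) :
    (Function.support fun m => P t m - P 0 m).Finite := by
  obtain ⟨B, hB⟩ := h
  refine (Set.finite_Icc (-B) B).subset ?_
  intro m hm
  by_contra hc
  apply hm
  have : B < |m| := by
    rw [Set.mem_Icc, ← abs_le] at hc
    exact not_le.1 hc
  simp [hB t m this]

noncomputable def GG (P : ℕ → ℤ → ℤ) (t : ℕ) (j : ℤ) : ℤ :=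
  ∑ᶠ m, if j ≤ m then P t m - P 0 m else 0

/-- total displacement of level `t` -/
noncomputable def tot (P : ℕ → ℤ → ℤ) (t : ℕ) : ℤ := ∑ᶠ m, (P t m - P 0 m)

theorem GG_succ {P : ℕ → ℤ → ℤ} (h : FS P) (t : ℕ) (j : ℤ) :
    GG P t j = GG P t (j + 1) + (P t j - P 0 j) := by
  have : (P t j - P 0 j) = ∑ᶠ m, if m = j then P t j - P 0 j else 0 := by
    rw [finsum_eq_single _ j (fun m hm => by simp [hm])]; simp
  rw [this, GG, GG, ← finsum_add_distrib (h.fin t (j + 1))]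
  · congr 1; funext m
    by_cases h1 : m = j
    · subst h1; simp
    · by_cases h2 : j ≤ m
      · simp [h1, h2, show j + 1 ≤ m by omega]
      · simp [h1, h2, show ¬ j + 1 ≤ m by omega]
  · refine (Set.finite_singleton j).subset ?_
    intro m hm; by_contra hc; apply hm; simp at hc; simp [hc]

theorem GG_big {P : ℕ → ℤ → ℤ} {B : ℤ} (hB : ∀ t j, B < |j| → P t j = P 0 j) (t : ℕ) {j : ℤ}
    (hj : B < j) : GG P t j = 0 := by
  rw [GG]
  refine finsum_eq_zero_of_forall_eq_zero fun m => ?_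
  split_ifs with h
  · rw [hB t m (lt_of_lt_of_le (by omega) (le_abs_self m))]; ring
  · rfl

theorem GG_low {P : ℕ → ℤ → ℤ} {B : ℤ} (hB : ∀ t j, B < |j| → P t j = P 0 j) (t : ℕ) {j : ℤ}
    (hj : j ≤ - B) : GG P t j = tot P t := by
  rw [GG, tot]
  congr 1; funext m
  split_ifs with h
  · rfl
  · rw [hB t m (lt_of_lt_of_le (by omega) (neg_le_abs m))]; ring

theorem GG_rse {P : ℕ → ℤ → ℤ} (h : FS P) {t₀ : ℕ} (ht : t₀ ≠ 0) (R : ℤ) (t : ℕ) (j : ℤ) :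
    GG (rse t₀ R P) t j = GG P t j + if t = t₀ then dl j R else 0 := by
  have h0 : rse t₀ R P 0 = P 0 := rse_lvl (Ne.symm ht) R P
  by_cases htt : t = t₀
  · subst htt
    have : dl j R = ∑ᶠ m, if m = R then dl j R else 0 := by
      rw [finsum_eq_single _ R (fun m hm => by simp [hm])]; simp
    simp only [if_true]
    rw [this, GG, GG, ← finsum_add_distrib (h.fin t j)]
    · congr 1; funext m
      rw [h0]
      by_cases h1 : m = R
      · subst h1; rw [rse_same]; unfold dl; by_cases h2 : j ≤ m <;> simp [h2]; ring
      · rw [rse_row _ _ h1]; simp [h1]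
    · refine (Set.finite_singleton R).subset ?_
      intro m hm; by_contra hc; apply hm; simp at hc; simp [hc]
  · simp [GG, h0, rse_lvl htt, htt]

theorem tot_rse {P : ℕ → ℤ → ℤ} (h : FS P) {t₀ : ℕ} (ht : t₀ ≠ 0) (R : ℤ) (t : ℕ) :
    tot (rse t₀ R P) t = tot P t + if t = t₀ then 1 else 0 := by
  obtain ⟨B, hB⟩ := h.rse t₀ R
  obtain ⟨B', hB'⟩ := id h
  set j := min (min (-B) (-B')) R
  rw [← GG_low hB t (j := j) (by omega), ← GG_low hB' t (j := j) (by omega), GG_rse h ht]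
  have := dl_spec j R
  split_ifs <;> omega

noncomputable def EE (i : ℕ) (P : ℕ → ℤ → ℤ) (j : ℤ) : ℤ :=
  GG P (i + 2) (j - 1) + GG P i (j + 1) - GG P (i + 1) j - GG P (i + 1) (j + 1)
    + P 0 (j - 1) - min (P (i + 2) (j - 1)) (P i (j + 1) - 1)

theorem EE_self {P : ℕ → ℤ → ℤ} (h : FS P) (i : ℕ) (R j : ℤ) :
    EE i (rse (i + 1) R P) j = EE i P j - dl j R - dl j (R - 1) := by
  simp only [EE, GG_rse h (Nat.succ_ne_zero i), rse_lvl (show i + 2 ≠ i + 1 by omega),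
    rse_lvl (show i ≠ i + 1 by omega), rse_lvl (show 0 ≠ i + 1 by omega)]
  simp
  have := dl_spec j (R - 1); have := dl_spec (j + 1) R
  omega

theorem EE_far {P : ℕ → ℤ → ℤ} (h : FS P) (i k : ℕ) (h1 : k + 1 ≠ i) (h2 : k + 1 ≠ i + 1)
    (h3 : k + 1 ≠ i + 2) (R j : ℤ) :
    EE i (rse (k + 1) R P) j = EE i P j := by
  simp only [EE, GG_rse h (show k + 1 ≠ 0 by omega), rse_lvl (show i + 2 ≠ k + 1 by omega),
    rse_lvl (show i ≠ k + 1 by omega), rse_lvl (show 0 ≠ k + 1 by omega)]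
  simp only [if_neg (show ¬ i + 2 = k + 1 by omega), if_neg (show ¬ i = k + 1 by omega),
    if_neg (show ¬ i + 1 = k + 1 by omega)]
  ring

/-- threshold for raising level `i+1` -/
def thA (i : ℕ) (P : ℕ → ℤ → ℤ) (R : ℤ) : ℤ :=
  if P (i + 3) (R - 2) < P (i + 1) R then R - 1 else R - 2

/-- threshold for raising level `i+2` -/
def thB (i : ℕ) (P : ℕ → ℤ → ℤ) (S : ℤ) : ℤ :=
  if P (i + 2) S + 1 < P i (S + 2) then S else S + 1

theorem EE_up {P : ℕ → ℤ → ℤ} (h : FS P) (i : ℕ) (R j : ℤ) :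
    EE (i + 1) (rse (i + 1) R P) j = EE (i + 1) P j + dl j (thA i P R) := by
  have e1 := dl_spec j (thA i P R); have e2 := dl_spec (j + 1) R
  unfold thA at e1 ⊢
  simp only [EE, GG_rse h (Nat.succ_ne_zero i), rse_lvl (show i + 1 + 2 ≠ i + 1 by omega),
    rse_lvl (show 0 ≠ i + 1 by omega)]
  simp only [rse_apply]
  rw [if_neg (show ¬ i + 1 + 2 = i + 1 by omega), if_neg (show ¬ i + 1 + 1 = i + 1 by omega)]
  simp only [true_and, if_true, show i + 1 + 2 = i + 3 by rfl] at *
  by_cases hj : j + 1 = R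
  · rw [if_pos hj]
    have : j - 1 = R - 2 := by omega
    rw [this, hj]
    rw [hj] at e2
    split_ifs at e1 ⊢ <;> omega
  · rw [if_neg hj]; split_ifs at e1 ⊢ <;> omega

theorem EE_down {P : ℕ → ℤ → ℤ} (h : FS P) (i : ℕ) (S j : ℤ) :
    EE i (rse (i + 2) S P) j = EE i P j + dl j (thB i P S) := by
  have e1 := dl_spec j (thB i P S); have e2 := dl_spec (j - 1) S
  unfold thB at e1 ⊢
  simp only [EE, GG_rse h (show i + 2 ≠ 0 by omega), rse_lvl (show i ≠ i + 2 by omega),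
    rse_lvl (show 0 ≠ i + 2 by omega)]
  simp only [rse_apply]
  rw [if_neg (show ¬ i = i + 2 by omega), if_neg (show ¬ i + 1 = i + 2 by omega)]
  simp only [true_and, if_true] at *
  by_cases hj : j - 1 = S
  · rw [if_pos hj]
    have : j + 1 = S + 2 := by omega
    rw [this, hj]
    rw [hj] at e2
    split_ifs at e1 ⊢ <;> omega
  · rw [if_neg hj]; split_ifs at e1 ⊢ <;> omega

/-- validity of a configuration -/
structure Val (N : ℕ) (P : ℕ → ℤ → ℤ) : Prop where
  mono : ∀ t j, P t j ≤ P (t + 1) j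
  inter : ∀ t j, P (t + 1) j < P t (j + 2)
  stab : ∀ t, N ≤ t → P t = P N
  fs : FS P

def la (i : ℕ) (P : ℕ → ℤ → ℤ) (j : ℤ) : ℤ := P (i + 1) j - max (P i j) (P (i + 2) (j - 2) + 1)
def lb (i : ℕ) (P : ℕ → ℤ → ℤ) (j : ℤ) : ℤ := min (P (i + 2) j) (P i (j + 2) - 1) - P (i + 1) j

theorem Val.la_nonneg {N : ℕ} {P : ℕ → ℤ → ℤ} (h : Val N P) (i : ℕ) (j : ℤ) : 0 ≤ la i P j := by
  unfold la
  have := h.mono i j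
  have := h.inter (i + 1) (j - 2)
  simp only [sub_add_cancel] at this
  change P (i + 2) (j - 2) < _ at this
  omega

theorem Val.lb_nonneg {N : ℕ} {P : ℕ → ℤ → ℤ} (h : Val N P) (i : ℕ) (j : ℤ) : 0 ≤ lb i P j := by
  unfold lb
  have := h.inter i j
  have := h.mono (i + 1) j
  change _ ≤ P (i + 2) j at this
  omega

theorem EE_diff {P : ℕ → ℤ → ℤ} (h : FS P) (i : ℕ) (j : ℤ) :
    EE i P j - EE i P (j + 1) = lb i P j - la i P (j + 1) := by
  unfold EE lb la
  have h1 := GG_succ h (i + 2) (j - 1)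
  have h2 := GG_succ h i (j + 1)
  have h3 := GG_succ h (i + 1) j
  have h4 := GG_succ h (i + 1) (j + 1)
  have h5 := GG_succ h (i + 2) j
  have h6 := GG_succ h i (j + 1 + 1)
  simp only [sub_add_cancel, add_sub_cancel_right, show j + 1 + 1 = j + 2 by ring,
    show j + 1 - 2 = j - 1 by ring] at *
  omega

noncomputable def cwt (i : ℕ) (P : ℕ → ℤ → ℤ) : ℤ :=
  2 * tot P (i + 1) - tot P i - tot P (i + 2)

theorem EE_big {N : ℕ} {P : ℕ → ℤ → ℤ} (h : Val N P) :
    ∃ B : ℤ, (∀ i j, B < j → EE i P j = 0) ∧ (∀ i j, j < -B → EE i P j = - cwt i P) := by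
  obtain ⟨B, hB⟩ := h.fs
  have key : ∀ i j, B < |j - 1| → B < |j + 1| →
      min (P (i + 2) (j - 1)) (P i (j + 1) - 1) = P 0 (j - 1) := by
    intro i j h1 h2
    rw [hB _ _ h1, hB _ _ h2]
    have a1 := h.mono 0 (j - 1)
    have a2 := h.inter 0 (j - 1)
    rw [show j - 1 + 2 = j + 1 by ring] at a2
    omega
  refine ⟨|B| + 1, fun i j hj => ?_, fun i j hj => ?_⟩
  · have := le_abs_self B
    have b1 : B < |j - 1| := lt_of_lt_of_le (by omega) (le_abs_self _)
    have b2 : B < |j + 1| := lt_of_lt_of_le (by omega) (le_abs_self _)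
    unfold EE
    rw [key i j b1 b2, GG_big hB _ (by omega), GG_big hB _ (by omega), GG_big hB _ (by omega),
      GG_big hB _ (by omega)]
    ring
  · have := le_abs_self B
    have b1 : B < |j - 1| := lt_of_lt_of_le (by omega) (neg_le_abs _)
    have b2 : B < |j + 1| := lt_of_lt_of_le (by omega) (neg_le_abs _)
    unfold EE cwt
    rw [key i j b1 b2, GG_low hB _ (by omega), GG_low hB _ (by omega), GG_low hB _ (by omega),
      GG_low hB _ (by omega)]
    ring

theorem exists_max {f : ℤ → ℤ} {B c d : ℤ} (h1 : ∀ j, B < j → f j = c) (h2 : ∀ j, j < -B → f j = d) :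
    ∃ R, ∀ j, f j ≤ f R := by
  obtain ⟨R, -, hR⟩ := Finset.exists_max_image (Finset.Icc (-|B| - 1) (|B| + 1)) f
    ⟨0, by simp; constructor <;> [have := abs_nonneg B; have := abs_nonneg B] <;> omega⟩
  have := le_abs_self B
  have := abs_nonneg B
  refine ⟨R, fun j => ?_⟩
  by_cases ha : |B| + 1 < j
  · rw [h1 j (by omega), ← h1 (|B| + 1) (by omega)]
    exact hR _ (by simp; omega)
  · by_cases hb : j < -|B| - 1
    · rw [h2 j (by omega), ← h2 (-|B| - 1) (by omega)]
      exact hR _ (by simp; omega)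
    · exact hR _ (by simp; omega)

theorem exists_LA {f : ℤ → ℤ} {B c d : ℤ} (h1 : ∀ j, B < j → f j = c) (h2 : ∀ j, j < -B → f j = d)
    (h3 : c < mxv f) : ∃ R, LA f R ∧ f R = mxv f := by
  obtain ⟨R, hR⟩ := exists_max h1 h2
  have e := mxv_eq R hR rfl
  obtain ⟨S, hS, hS'⟩ := Int.exists_greatest_of_bdd (P := fun j => f j = mxv f)
    ⟨B, fun z hz => by by_contra hc; have := h1 z (by omega); omega⟩ ⟨R, e.symm⟩
  refine ⟨S, ⟨fun j => by rw [hS, e]; exact hR j, fun j hj => ?_⟩, hS⟩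
  have := hR j
  rw [← e] at this
  rw [hS]
  rcases this.lt_or_eq with h | h
  · exact h
  · have := hS' j h; omega

theorem exists_SA {f : ℤ → ℤ} {B c d : ℤ} (h1 : ∀ j, B < j → f j = c) (h2 : ∀ j, j < -B → f j = d)
    (h3 : d < mxv f) : ∃ R, SA f R ∧ f R = mxv f := by
  obtain ⟨R, hR⟩ := exists_max h1 h2
  have e := mxv_eq R hR rfl
  obtain ⟨S, hS, hS'⟩ := Int.exists_least_of_bdd (P := fun j => f j = mxv f)
    ⟨-B, fun z hz => by by_contra hc; have := h2 z (by omega); omega⟩ ⟨R, e.symm⟩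
  refine ⟨S, ⟨fun j => by rw [hS, e]; exact hR j, fun j hj => ?_⟩, hS⟩
  have := hR j
  rw [← e] at this
  rw [hS]
  rcases this.lt_or_eq with h | h
  · exact h
  · have := hS' j h; omega

/-- raw step relation -/
def rst (i : ℕ) (P Q : ℕ → ℤ → ℤ) : Prop :=
  ∃ R, LA (EE i P) R ∧ 0 < EE i P R ∧ Q = rse (i + 1) R P

/-- the same step seen from the target -/
def rstF (i : ℕ) (P Q : ℕ → ℤ → ℤ) : Prop :=
  ∃ R, SA (EE i Q) R ∧ 0 < EE i Q R + cwt i Q ∧ Q = rse (i + 1) R P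

theorem cwt_rse {P : ℕ → ℤ → ℤ} (h : FS P) (i k : ℕ) (R : ℤ) :
    cwt k (rse (i + 1) R P) = cwt k P + (if k = i then 2 else if k = i + 1 then -1 else
      if k + 1 = i then -1 else 0) := by
  unfold cwt
  simp only [tot_rse h (Nat.succ_ne_zero i)]
  split_ifs <;> omega

theorem EE_le_lims {N : ℕ} {P : ℕ → ℤ → ℤ} (h : Val N P) (i : ℕ) {μ : ℤ} (hm : ∀ j, EE i P j ≤ μ) :
    0 ≤ μ ∧ - cwt i P ≤ μ := by
  obtain ⟨B, h1, h2⟩ := EE_big h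
  constructor
  · rw [← h1 i (B + 1) (by omega)]; exact hm _
  · rw [← h2 i (-B - 1) (by omega)]; exact hm _

theorem rst_imp {N i : ℕ} {P Q : ℕ → ℤ → ℤ} (hP : Val N P) (h : rst i P Q) : rstF i P Q := by
  obtain ⟨R, hR, h0, rfl⟩ := h
  have := dl_spec R R; have := dl_spec R (R - 1)
  refine ⟨R, ⟨fun j => ?_, fun j hj => ?_⟩, ?_, rfl⟩
  · rw [EE_self hP.fs, EE_self hP.fs]
    have := hR.1 j; have := hR.2 j; have := dl_spec j R; have := dl_spec j (R - 1)
    omega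
  · rw [EE_self hP.fs, EE_self hP.fs]
    have := hR.1 j; have := hR.2 j; have := dl_spec j R; have := dl_spec j (R - 1)
    omega
  · rw [EE_self hP.fs, cwt_rse hP.fs]
    have := (EE_le_lims hP i hR.1).2
    simp; omega

theorem rst_of {N i : ℕ} {P Q : ℕ → ℤ → ℤ} (hP : FS P) (hQ : Val N Q) (h : rstF i P Q) :
    rst i P Q := by
  obtain ⟨R, hR, h0, rfl⟩ := h
  have := dl_spec R R; have := dl_spec R (R - 1)
  have key := EE_self hP i R
  refine ⟨R, ⟨fun j => ?_, fun j hj => ?_⟩, ?_, rfl⟩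
  · have := hR.1 j; have := hR.2 j; have := dl_spec j R; have := dl_spec j (R - 1)
    have := key j; have := key R
    omega
  · have := hR.1 j; have := hR.2 j; have := dl_spec j R; have := dl_spec j (R - 1)
    have := key j; have := key R
    omega
  · have := (EE_le_lims hQ i hR.1).1
    have := key R
    omega

theorem Val.rse {N i : ℕ} {P : ℕ → ℤ → ℤ} (hP : Val N P) (hi : i + 2 ≤ N) {R : ℤ}
    (h : 0 < lb i P R) : Val N (rse (i + 1) R P) := by
  unfold lb at h
  refine ⟨fun t j => ?_, fun t j => ?_, fun t ht => ?_, hP.fs.rse _ _⟩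
  · simp only [rse_apply]
    have h1 := hP.mono t j
    split_ifs with h2 h3 h3
    · omega
    · obtain ⟨rfl, rfl⟩ := h2
      change _ ≤ P (i + 2) j
      omega
    · omega
    · omega
  · simp only [rse_apply]
    have h1 := hP.inter t j
    split_ifs with h2 h3 h3
    · omega
    · obtain ⟨h4, rfl⟩ := h2
      obtain rfl : t = i := by omega
      omega
    · omega
    · omega
  · rw [rse_lvl (by omega), rse_lvl (by omega)]; exact hP.stab t ht

theorem rst_val {N i : ℕ} {P Q : ℕ → ℤ → ℤ} (hP : Val N P) (hi : i + 2 ≤ N) (h : rst i P Q) :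
    Val N Q := by
  obtain ⟨R, hR, h0, rfl⟩ := h
  refine hP.rse hi ?_
  have h1 := EE_diff hP.fs i R
  have h2 := hR.2 (R + 1) (by omega)
  have h3 := hP.la_nonneg i (R + 1)
  omega

/-- lowering -/
def lwr (t : ℕ) (R : ℤ) (P : ℕ → ℤ → ℤ) : ℕ → ℤ → ℤ :=
  fun t' j => if t' = t ∧ j = R then P t' j - 1 else P t' j

theorem rse_lwr (t : ℕ) (R : ℤ) (P : ℕ → ℤ → ℤ) : rse t R (lwr t R P) = P := by
  funext a j; simp only [rse_apply, lwr]; split_ifs <;> ring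

theorem Val.lwr {N i : ℕ} {P : ℕ → ℤ → ℤ} (hP : Val N P) (hi : i + 2 ≤ N) {R : ℤ}
    (h : 0 < la i P R) : Val N (lwr (i + 1) R P) := by
  unfold la at h
  refine ⟨fun t j => ?_, fun t j => ?_, fun t ht => ?_, ?_⟩
  · simp only [_root_.lwr]
    have h1 := hP.mono t j
    split_ifs with h2 h3 h3
    · omega
    · omega
    · obtain ⟨h4, rfl⟩ := h3
      obtain rfl : t = i := by omega
      omega
    · omega
  · simp only [_root_.lwr]
    have h1 := hP.inter t j
    split_ifs with h2 h3 h3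
    · omega
    · omega
    · obtain ⟨rfl, h4⟩ := h3
      obtain rfl : j = R - 2 := by omega
      rw [h4]
      change P (i + 2) _ < _
      omega
    · omega
  · funext j; simp only [_root_.lwr]
    rw [if_neg (by omega), if_neg (by omega), hP.stab t ht]
  · obtain ⟨B, hB⟩ := hP.fs
    refine ⟨max B |R|, fun t' j hj => ?_⟩
    have hne : j ≠ R := by rintro rfl; exact absurd hj (not_lt.2 (le_max_right _ _))
    simp only [_root_.lwr, hne, and_false, if_false]
    exact hB t' j (lt_of_le_of_lt (le_max_left _ _) hj)

theorem rst_ex_f {N i : ℕ} {Q : ℕ → ℤ → ℤ} (hQ : Val N Q) (hi : i + 2 ≤ N)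
    (h : 0 < mxv (EE i Q) + cwt i Q) : ∃ P, Val N P ∧ rst i P Q := by
  obtain ⟨B, h1, h2⟩ := EE_big hQ
  obtain ⟨R, hR, hR'⟩ := exists_SA (h1 i) (h2 i) (by omega)
  have h3 := EE_diff hQ.fs i (R - 1)
  rw [sub_add_cancel] at h3
  have h4 := hR.2 (R - 1) (by omega)
  have h5 := hQ.lb_nonneg i (R - 1)
  have hv := hQ.lwr hi (R := R) (by omega)
  exact ⟨_, hv, rst_of hv.fs hQ ⟨R, hR, by omega, (rse_lwr _ _ _).symm⟩⟩

theorem rst_ex_e {N i : ℕ} {P : ℕ → ℤ → ℤ} (hP : Val N P)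
    (h : 0 < mxv (EE i P)) : ∃ Q, rst i P Q := by
  obtain ⟨B, h1, h2⟩ := EE_big hP
  obtain ⟨R, hR, hR'⟩ := exists_LA (h1 i) (h2 i) h
  exact ⟨_, R, hR, by omega, rfl⟩

/-- the two adjacent operators `i`, `i+1` -/
noncomputable def adjOp (i : ℕ) : TwoOp {P : ℕ → ℤ → ℤ // FS P} where
  rX R P := ⟨rse (i + 1) R P.1, P.2.rse _ _⟩
  rY R P := ⟨rse (i + 2) R P.1, P.2.rse _ _⟩
  EX P := EE i P.1
  EY P := EE (i + 1) P.1
  thX P := thA i P.1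
  thY P := thB i P.1
  XX P R j := EE_self P.2 i R j
  YY P R j := EE_self P.2 (i + 1) R j
  XY P R j := EE_up P.2 i R j
  YX P R j := EE_down P.2 i R j
  tXY P S R := by
    simp only [thA, rse_lvl (show i + 3 ≠ i + 2 by omega), rse_lvl (show i + 1 ≠ i + 2 by omega)]
  tYX P S R := by
    simp only [thB, rse_lvl (show i + 2 ≠ i + 1 by omega), rse_lvl (show i ≠ i + 1 by omega)]
  tXX P S R h := by
    simp only [thA, rse_lvl (show i + 3 ≠ i + 1 by omega), rse_row _ _ h.symm]
  tYY P S R h := by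
    simp only [thB, rse_lvl (show i ≠ i + 2 by omega), rse_row _ _ h.symm]
  cXX P R S := by ext1; exact rse_comm _ _ _ _ _
  cYY P R S := by ext1; exact rse_comm _ _ _ _ _
  cXY P R S := by ext1; exact rse_comm _ _ _ _ _

theorem thA_spec (i : ℕ) (P : ℕ → ℤ → ℤ) (R : ℤ) :
    (P (i + 3) (R - 2) < P (i + 1) R ∧ thA i P R = R - 1) ∨
    (¬ P (i + 3) (R - 2) < P (i + 1) R ∧ thA i P R = R - 2) := by
  unfold thA; split_ifs with h
  · exact Or.inl ⟨h, rfl⟩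
  · exact Or.inr ⟨h, rfl⟩

theorem thB_spec (i : ℕ) (P : ℕ → ℤ → ℤ) (S : ℤ) :
    (P (i + 2) S + 1 < P i (S + 2) ∧ thB i P S = S) ∨
    (¬ P (i + 2) S + 1 < P i (S + 2) ∧ thB i P S = S + 1) := by
  unfold thB; split_ifs with h
  · exact Or.inl ⟨h, rfl⟩
  · exact Or.inr ⟨h, rfl⟩

theorem adj_local {N : ℕ} {P : ℕ → ℤ → ℤ} (hP : Val N P) (i : ℕ) {R S : ℤ}
    (hR : LA (EE i P) R) (hR0 : 0 < EE i P R) (hS : LA (EE (i + 1) P) S)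
    (hS0 : 0 < EE (i + 1) P S) :
    (adjOp i).Qd ⟨P, hP.fs⟩ R S ∨ (adjOp i).Oc ⟨P, hP.fs⟩ R S := by
  have Du : ∀ j k, k = j + 1 → EE i P j - EE i P k = lb i P j - la i P k := by
    rintro j k rfl; exact EE_diff hP.fs i j
  have Dv : ∀ j k, k = j + 1 → EE (i + 1) P j - EE (i + 1) P k
      = lb (i + 1) P j - la (i + 1) P k := by
    rintro j k rfl; exact EE_diff hP.fs (i + 1) j
  have fc' : ∀ R, P (i + 3) (R - 2) < P (i + 1) R + 1 → lb i P R - 1 ≤ la (i + 1) P R := by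
    intro R h; unfold lb la
    simp only [show i + 1 + 2 = i + 3 by rfl, show i + 1 + 1 = i + 2 by rfl]; omega
  have fc : ∀ R, P (i + 3) (R - 2) < P (i + 1) R → lb i P R ≤ la (i + 1) P R := by
    intro R h; unfold lb la
    simp only [show i + 1 + 2 = i + 3 by rfl, show i + 1 + 1 = i + 2 by rfl]; omega
  have fd : ∀ R k, k = R - 2 → ¬ P (i + 3) (R - 2) < P (i + 1) R →
      la i P R ≤ lb (i + 1) P k := by
    rintro R k rfl h; unfold lb la
    simp only [show i + 1 + 2 = i + 3 by rfl, show i + 1 + 1 = i + 2 by rfl,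
      show R - 2 + 2 = R by ring]; omega
  have fb : ∀ S, P (i + 2) S + 1 < P i (S + 2) → la (i + 1) P S ≤ lb i P S := by
    intro S h; unfold lb la
    simp only [show i + 1 + 2 = i + 3 by rfl, show i + 1 + 1 = i + 2 by rfl]; omega
  have fa : ∀ S k, k = S + 2 → ¬ P (i + 2) S + 1 < P i (S + 2) →
      lb (i + 1) P S ≤ la i P k := by
    rintro S k rfl h; unfold lb la
    simp only [show i + 1 + 2 = i + 3 by rfl, show i + 1 + 1 = i + 2 by rfl,
      show S + 2 - 2 = S by ring]; omega
  have fa' : ∀ S k, k = S + 2 → ¬ P (i + 2) S + 1 + 1 < P i (S + 2) →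
      lb (i + 1) P S ≤ la i P k + 1 := by
    rintro S k rfl h; unfold lb la
    simp only [show i + 1 + 2 = i + 3 by rfl, show i + 1 + 1 = i + 2 by rfl,
      show S + 2 - 2 = S by ring]; omega
  have tA := thA_spec i P R
  have tB := thB_spec i P S
  by_cases c1 : S ≤ thA i P R
  · by_cases c2 : R ≤ thB i P S
    · -- case III
      exfalso
      obtain rfl : S = R - 1 := by omega
      have h1 := fc R (by omega)
      have h2 := fa (R - 1) (R + 1) (by ring) (by omega)
      have h3 := Du R (R + 1) rfl
      have h4 := Dv (R - 1) R (by ring)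
      have h5 := hR.2 (R + 1) (by omega)
      have h6 := hS.2 R (by omega)
      omega
    · -- case II
      push Not at c2
      by_cases hβ : ∀ j, j ≤ thB i P S → EE i P j < EE i P R
      · left
        exact (adjOp i).Qd_swap ((adjOp i).swap.quad (P := ⟨P, hP.fs⟩) hS hS0 hR hR0 c2 c1 hβ)
      · right
        push Not at hβ
        obtain ⟨j0, hj0, hj0'⟩ := hβ
        obtain ⟨R1, ⟨hR1, hR1'⟩, hR1''⟩ := Int.exists_greatest_of_bdd
          (P := fun j => j ≤ thB i P S ∧ EE i P R ≤ EE i P j) ⟨_, fun z hz => hz.1⟩ ⟨j0, hj0, hj0'⟩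
        obtain ⟨S2, ⟨hS2a, hS2b, hS2c⟩, hS2⟩ := Int.exists_greatest_of_bdd
          (P := fun j => S ≤ j ∧ j ≤ thA i P R ∧
            (j = S ∨ (S < j ∧ EE (i + 1) P j = EE (i + 1) P S - 1)))
          ⟨_, fun z hz => hz.2.1⟩ ⟨S, le_rfl, c1, Or.inl rfl⟩
        have tA1 := thA_spec i P R1
        have tB2 := thB_spec i (rse (i + 2) S P) S2
        rw [rse_lvl (show i ≠ i + 2 by omega)] at tB2
        refine (adjOp i).Oc_swap ((adjOp i).swap.oct (P := ⟨P, hP.fs⟩) (S1 := R1) (R2 := S2)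
          hS hS0 hR hR0 c2 c1 (le_antisymm (hR.1 R1) hR1') hR1 ?_ hS2a hS2b hS2c ?_ ?_ ?_ ?_)
        · intro j hj hj'
          by_contra hc
          have := hR1'' j ⟨hj', not_lt.1 hc⟩; omega
        · intro j hj hj'
          change EE (i + 1) P j < EE (i + 1) P S - 1
          have h1 := hS.2 j (by omega)
          rcases (show EE (i + 1) P j ≤ EE (i + 1) P S - 1 by omega).lt_or_eq with h2 | h2
          · exact h2
          · have := hS2 j ⟨by omega, hj', Or.inr ⟨by omega, h2⟩⟩; omega
        · change thA i P R1 < S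
          by_contra hc
          obtain rfl : R1 = S + 1 := by omega
          have h1 := fc (S + 1) (by omega)
          have h2 := fa S (S + 2) rfl (by omega)
          have h3 := Du (S + 1) (S + 2) (by ring)
          have h4 := Dv S (S + 1) rfl
          have h5 := hR.1 (S + 2)
          have h6 := hS.2 (S + 1) (by omega)
          omega
        · change thB i P S ≤ thB i (rse (i + 2) S P) S2
          rcases hS2c with rfl | ⟨hlt, -⟩
          · rw [rse_same] at tB2; omega
          · omega
        · change thB i (rse (i + 2) S P) S2 < R
          by_contra hc
          obtain rfl : S2 = R - 1 := by omega
          have h1 := fc R (by omega)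
          have h3 := Du R (R + 1) (by ring)
          have h4 := Dv (R - 1) R (by ring)
          have h5 := hR.2 (R + 1) (by omega)
          have h6 := hS.2 R (by omega)
          rcases hS2c with rfl | ⟨hlt, hv⟩
          · rw [rse_same] at tB2
            have h2 := fa' (R - 1) (R + 1) (by ring) (by omega)
            omega
          · rw [rse_row _ _ (by omega)] at tB2
            have h2 := fa (R - 1) (R + 1) (by ring) (by omega)
            omega
  · push Not at c1
    by_cases c2 : R ≤ thB i P S
    · -- case I
      by_cases hα : ∀ j, j ≤ thA i P R → EE (i + 1) P j < EE (i + 1) P S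
      · left
        exact (adjOp i).quad (P := ⟨P, hP.fs⟩) hR hR0 hS hS0 c1 c2 hα
      · right
        push Not at hα
        obtain ⟨j0, hj0, hj0'⟩ := hα
        obtain ⟨S1, ⟨hS1, hS1'⟩, hS1''⟩ := Int.exists_greatest_of_bdd
          (P := fun j => j ≤ thA i P R ∧ EE (i + 1) P S ≤ EE (i + 1) P j)
          ⟨_, fun z hz => hz.1⟩ ⟨j0, hj0, hj0'⟩
        obtain ⟨R2, ⟨hR2a, hR2b, hR2c⟩, hR2⟩ := Int.exists_greatest_of_bdd
          (P := fun j => R ≤ j ∧ j ≤ thB i P S ∧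
            (j = R ∨ (R < j ∧ EE i P j = EE i P R - 1)))
          ⟨_, fun z hz => hz.2.1⟩ ⟨R, le_rfl, c2, Or.inl rfl⟩
        have tB1 := thB_spec i P S1
        have tA2 := thA_spec i (rse (i + 1) R P) R2
        rw [rse_lvl (show i + 3 ≠ i + 1 by omega)] at tA2
        refine (adjOp i).oct (P := ⟨P, hP.fs⟩) (S1 := S1) (R2 := R2)
          hR hR0 hS hS0 c1 c2 (le_antisymm (hS.1 S1) hS1') hS1 ?_ hR2a hR2b hR2c ?_ ?_ ?_ ?_
        · intro j hj hj'
          by_contra hc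
          have := hS1'' j ⟨hj', not_lt.1 hc⟩; omega
        · intro j hj hj'
          change EE i P j < EE i P R - 1
          have h1 := hR.2 j (by omega)
          rcases (show EE i P j ≤ EE i P R - 1 by omega).lt_or_eq with h2 | h2
          · exact h2
          · have := hR2 j ⟨by omega, hj', Or.inr ⟨by omega, h2⟩⟩; omega
        · change thB i P S1 < R
          by_contra hc
          obtain rfl : S1 = R - 1 := by omega
          have h1 := fc R (by omega)
          have h2 := fa (R - 1) (R + 1) (by ring) (by omega)
          have h3 := Du R (R + 1) (by ring)
          have h4 := Dv (R - 1) R (by ring)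
          have h5 := hR.2 (R + 1) (by omega)
          have h6 := hS.1 R
          omega
        · change thA i P R ≤ thA i (rse (i + 1) R P) R2
          rcases hR2c with rfl | ⟨hlt, -⟩
          · rw [rse_same] at tA2; omega
          · omega
        · change thA i (rse (i + 1) R P) R2 < S
          by_contra hc
          obtain rfl : R2 = S + 1 := by omega
          have h2 := fa S (S + 2) (by ring) (by omega)
          have h4 := Dv S (S + 1) rfl
          have h3 := Du (S + 1) (S + 2) (by ring)
          have h5 := hR.2 (S + 2) (by omega)
          have h6 := hS.2 (S + 1) (by omega)
          rcases hR2c with rfl | ⟨hlt, hv⟩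
          · rw [rse_same] at tA2
            have h1 := fc' (S + 1) (by omega)
            omega
          · rw [rse_row _ _ (by omega)] at tA2
            have h1 := fc (S + 1) (by omega)
            omega
    · -- case IV
      push Not at c2
      right
      obtain rfl : S = R - 1 := by omega
      have h1 := fd R (R - 2) rfl (by omega)
      have h2 := fb (R - 1) (by omega)
      have h3 := Du (R - 1) R (by ring)
      have h4 := Dv (R - 2) (R - 1) (by ring)
      have h5 := hR.1 (R - 1)
      have h6 := hS.1 (R - 2)
      have e1 : la i P R = lb (i + 1) P (R - 2) := by omega
      have e2 : la (i + 1) P (R - 1) = lb i P (R - 1) := by omega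
      unfold la lb at e1 e2
      have tA1 := thA_spec i P (R - 1)
      have tB1 := thB_spec i P (R - 2)
      simp only [show i + 1 + 2 = i + 3 by rfl, show i + 1 + 1 = i + 2 by rfl,
        show R - 2 + 2 = R by ring, show R - 1 - 2 = R - 3 by ring,
        show R - 1 + 2 = R + 1 by ring] at e1 e2 tA1 tB1 tB
      refine (adjOp i).oct4 (P := ⟨P, hP.fs⟩) hR hR0 hS hS0 ?_ ?_ ?_ ?_ ?_ ?_
      · change thA i P R = _; omega
      · change thB i P (R - 1) = _; omega
      · change EE i P (R - 1) = EE i P R; omega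
      · change EE (i + 1) P (R - 2) = EE (i + 1) P (R - 1); omega
      · change thA i P (R - 1) = _; omega
      · change thB i P (R - 2) = _; omega

def LLc (i j : ℕ) (P y z : ℕ → ℤ → ℤ) : Prop :=
  ((mxv (EE j y) = mxv (EE j P) ∨ mxv (EE i z) = mxv (EE i P)) ∧
    ∃ w, rst j y w ∧ rst i z w ∧ (mxv (EE j z) + cwt j z = mxv (EE j w) + cwt j w ∨
      mxv (EE i y) + cwt i y = mxv (EE i w) + cwt i w)) ∨
  ((mxv (EE j y) ≠ mxv (EE j P) ∧ mxv (EE i z) ≠ mxv (EE i P)) ∧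
    ∃ p q r s w, rst j y p ∧ rst j p q ∧ rst i q w ∧ rst i z r ∧ rst i r s ∧ rst j s w ∧
      mxv (EE j q) + cwt j q ≠ mxv (EE j w) + cwt j w ∧
      mxv (EE i s) + cwt i s ≠ mxv (EE i w) + cwt i w)

theorem LLc.symm {i j : ℕ} {P y z : ℕ → ℤ → ℤ} (h : LLc i j P y z) : LLc j i P z y := by
  rcases h with ⟨h1, w, h2, h3, h4⟩ | ⟨⟨h1, h1'⟩, p, q, r, s, w, h2, h3, h4, h5, h6, h7, h8, h9⟩
  · exact Or.inl ⟨h1.symm, w, h3, h2, h4.symm⟩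
  · exact Or.inr ⟨⟨h1', h1⟩, r, s, p, q, w, h5, h6, h7, h2, h3, h4, h9, h8⟩

theorem rst.fs {i : ℕ} {P Q : ℕ → ℤ → ℤ} (hP : FS P) (h : rst i P Q) : FS Q := by
  obtain ⟨R, -, -, rfl⟩ := h
  exact hP.rse _ _

theorem rst.cwt {i : ℕ} {P Q : ℕ → ℤ → ℤ} (hP : FS P) (h : rst i P Q) (k : ℕ) :
    cwt k Q = cwt k P + (if k = i then 2 else if k = i + 1 then -1 else
      if k + 1 = i then -1 else 0) := by
  obtain ⟨R, -, -, rfl⟩ := h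
  exact cwt_rse hP _ _ _

theorem LL_adj {N i : ℕ} {P y z : ℕ → ℤ → ℤ} (hP : Val N P) (h1 : rst i P y)
    (h2 : rst (i + 1) P z) : LLc i (i + 1) P y z := by
  obtain ⟨R, hR, hR0, rfl⟩ := h1
  obtain ⟨S, hS, hS0, rfl⟩ := h2
  have toX : ∀ a b, (adjOp i).stX a b → rst i a.1 b.1 := by
    rintro a b ⟨R, h1, h2, h3⟩; exact ⟨R, h1, h2, congrArg Subtype.val h3⟩
  have toY : ∀ a b, (adjOp i).stY a b → rst (i + 1) a.1 b.1 := by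
    rintro a b ⟨R, h1, h2, h3⟩; exact ⟨R, h1, h2, congrArg Subtype.val h3⟩
  rcases adj_local hP i hR hR0 hS hS0 with ⟨h1, w, h2, h3, h4⟩ |
    ⟨⟨h1, h1'⟩, p, q, r, s, w, h2, h3, h4, h5, h6, h7, h8, h9⟩
  · left
    have h2' := toY _ _ h2
    have h3' := toX _ _ h3
    have c2 := rst.cwt (hP.fs.rse _ _) h2' i
    have c3 := rst.cwt (hP.fs.rse _ _) h3' (i + 1)
    simp at c2 c3
    refine ⟨h1, w.1, h2', h3', ?_⟩
    rcases h4 with h4 | h4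
    · left
      change mxv (EE (i + 1) w.1) = mxv (EE (i + 1) (rse (i + 1 + 1) S P)) + 1 at h4
      change cwt (i + 1) w.1 = cwt (i + 1) (rse (i + 1 + 1) S P) + -1 at c3
      omega
    · right
      change mxv (EE i w.1) = mxv (EE i (rse (i + 1) R P)) + 1 at h4
      change cwt i w.1 = cwt i (rse (i + 1) R P) + -1 at c2
      omega
  · right
    change mxv (EE (i + 1) (rse (i + 1) R P)) = mxv (EE (i + 1) P) + 1 at h1
    change mxv (EE i (rse (i + 1 + 1) S P)) = mxv (EE i P) + 1 at h1'
    have n1 : mxv (EE (i + 1) (rse (i + 1) R P)) ≠ mxv (EE (i + 1) P) := by rw [h1]; simp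
    have n2 : mxv (EE i (rse (i + 1 + 1) S P)) ≠ mxv (EE i P) := by rw [h1']; simp
    have g2 := toY _ _ h2
    have g3 := toY _ _ h3
    have g4 := toX _ _ h4
    have g5 := toX _ _ h5
    have g6 := toX _ _ h6
    have g7 := toY _ _ h7
    refine ⟨⟨n1, n2⟩, p.1, q.1, r.1, s.1, w.1, g2, g3, g4, g5, g6, g7, ?_, ?_⟩
    · have c := rst.cwt q.2 g4 (i + 1)
      simp at c
      change mxv (EE (i + 1) w.1) = mxv (EE (i + 1) q.1) at h8
      omega
    · have c := rst.cwt s.2 g7 i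
      simp at c
      change mxv (EE i w.1) = mxv (EE i s.1) at h9
      omega

theorem LL_far {N i j : ℕ} {P y z : ℕ → ℤ → ℤ} (hP : Val N P) (h0 : i ≠ j) (h01 : i ≠ j + 1)
    (h02 : j ≠ i + 1) (h1 : rst i P y)
    (h2 : rst j P z) : LLc i j P y z := by
  obtain ⟨R, hR, hR0, rfl⟩ := h1
  obtain ⟨S, hS, hS0, rfl⟩ := h2
  have e1 : ∀ Q, FS Q → ∀ R, EE j (rse (i + 1) R Q) = EE j Q := by
    intro Q hQ R; funext k; exact EE_far hQ j i (by omega) (by omega) (by omega) R k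
  have e2 : ∀ Q, FS Q → ∀ R, EE i (rse (j + 1) R Q) = EE i Q := by
    intro Q hQ R; funext k; exact EE_far hQ i j (by omega) (by omega) (by omega) R k
  left
  refine ⟨Or.inl ?_, rse (j + 1) S (rse (i + 1) R P), ⟨S, ?_, ?_, rfl⟩, ⟨R, ?_, ?_, ?_⟩, Or.inl ?_⟩
  · rw [e1 P hP.fs]
  · rw [e1 P hP.fs]; exact hS
  · rw [e1 P hP.fs]; exact hS0
  · rw [e2 P hP.fs]; exact hR
  · rw [e2 P hP.fs]; exact hR0
  · rw [rse_comm]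
  · rw [rse_comm (j + 1) (i + 1), e1 _ (hP.fs.rse _ _), cwt_rse (hP.fs.rse _ _)]
    rw [if_neg (Ne.symm h0), if_neg h02, if_neg (by omega)]; ring

theorem LL {N i j : ℕ} {P y z : ℕ → ℤ → ℤ} (hP : Val N P) (h0 : i ≠ j) (h1 : rst i P y)
    (h2 : rst j P z) : LLc i j P y z := by
  by_cases h01 : i = j + 1
  · subst h01; exact (LL_adj hP h2 h1).symm
  · by_cases h02 : j = i + 1
    · subst h02; exact LL_adj hP h1 h2
    · exact LL_far hP h0 h01 h02 h1 h2

/-- duality -/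
def dual (N : ℕ) (P : ℕ → ℤ → ℤ) : ℕ → ℤ → ℤ := fun t j => - P (N - t) (- j)

theorem Val.mono' {N : ℕ} {P : ℕ → ℤ → ℤ} (h : Val N P) {s t : ℕ} (hst : s ≤ t) (j : ℤ) :
    P s j ≤ P t j := by
  induction t, hst using Nat.le_induction with
  | base => exact le_rfl
  | succ t _ ih => exact ih.trans (h.mono t j)

theorem Val.step2 {N : ℕ} {P : ℕ → ℤ → ℤ} (h : Val N P) (t : ℕ) (j : ℤ) : P t j < P t (j + 2) :=
  (h.mono t j).trans_lt (h.inter t j)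

theorem Val.dual {N : ℕ} {P : ℕ → ℤ → ℤ} (h : Val N P) : Val N (dual N P) := by
  refine ⟨fun t j => ?_, fun t j => ?_, fun t ht => ?_, ?_⟩
  · simp only [_root_.dual]
    have := h.mono' (show N - (t + 1) ≤ N - t by omega) (-j)
    omega
  · simp only [_root_.dual]
    by_cases ht : t < N
    · have := h.inter (N - (t + 1)) (-(j + 2))
      rw [show N - (t + 1) + 1 = N - t by omega, show -(j + 2) + 2 = -j by ring] at this
      omega
    · rw [show N - (t + 1) = 0 by omega, show N - t = 0 by omega]
      have := h.step2 0 (-(j + 2))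
      rw [show -(j + 2) + 2 = -j by ring] at this
      omega
  · funext j; simp only [_root_.dual]
    rw [show N - t = 0 by omega, show N - N = 0 by omega]
  · obtain ⟨B, hB⟩ := h.fs
    refine ⟨B, fun t j hj => ?_⟩
    simp only [_root_.dual]
    rw [hB _ _ (by rwa [abs_neg]), hB (N - 0) _ (by rwa [abs_neg])]

theorem dual_dual {N : ℕ} {P : ℕ → ℤ → ℤ} (h : Val N P) : dual N (dual N P) = P := by
  funext t j
  simp only [dual, neg_neg]
  by_cases ht : t ≤ N
  · rw [show N - (N - t) = t by omega]
  · rw [show N - (N - t) = N by omega, h.stab t (by omega)]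

theorem tot_dual {N : ℕ} {P : ℕ → ℤ → ℤ} (h : Val N P) (t : ℕ) :
    tot (dual N P) t = tot P N - tot P (N - t) := by
  unfold tot
  rw [← finsum_sub_distrib (h.fs.fin' N) (h.fs.fin' (N - t))]
  rw [← finsum_comp_equiv (Equiv.neg ℤ)]
  congr 1; funext m
  simp [dual]; ring

theorem cwt_dual {N i : ℕ} {P : ℕ → ℤ → ℤ} (h : Val N P) (hi : i + 2 ≤ N) :
    cwt (N - 2 - i) (dual N P) = - cwt i P := by
  unfold cwt
  rw [tot_dual h, tot_dual h, tot_dual h, show N - (N - 2 - i + 1) = i + 1 by omega,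
    show N - (N - 2 - i) = i + 2 by omega, show N - (N - 2 - i + 2) = i by omega]
  ring

theorem fun_eq_of_diff {f g : ℤ → ℤ} (h : ∀ j, f j - f (j + 1) = g j - g (j + 1)) {j0 : ℤ}
    (h0 : f j0 = g j0) (j : ℤ) : f j = g j := by
  have h1 : ∀ n : ℕ, f (j0 + n) = g (j0 + n) := by
    intro n
    induction n with
    | zero => simpa using h0
    | succ n ih => have := h (j0 + n); rw [Nat.cast_succ, ← add_assoc]; omega
  have h2 : ∀ n : ℕ, f (j0 - n) = g (j0 - n) := by
    intro n
    induction n with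
    | zero => simpa using h0
    | succ n ih =>
      have := h (j0 - (n + 1 : ℕ))
      rw [Nat.cast_succ, show j0 - ((n : ℤ) + 1) + 1 = j0 - n by ring] at this
      rw [Nat.cast_succ]; omega
  rcases le_total j0 j with hj | hj
  · have := h1 (j - j0).toNat
    rwa [Int.toNat_of_nonneg (by omega), show j0 + (j - j0) = j by ring] at this
  · have := h2 (j0 - j).toNat
    rwa [Int.toNat_of_nonneg (by omega), show j0 - (j0 - j) = j by ring] at this

theorem EE_dual {N i : ℕ} {P : ℕ → ℤ → ℤ} (h : Val N P) (hi : i + 2 ≤ N) (j : ℤ) :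
    EE (N - 2 - i) (dual N P) j = EE i P (- j) + cwt i P := by
  obtain ⟨B, h1, -⟩ := EE_big h.dual
  obtain ⟨B', -, h2⟩ := EE_big h
  refine fun_eq_of_diff (f := EE (N - 2 - i) (dual N P)) (g := fun j => EE i P (- j) + cwt i P)
    (j0 := max B B' + 1) ?_ ?_ j
  · intro j
    rw [EE_diff h.dual.fs]
    have := EE_diff h.fs i (-(j + 1))
    rw [show -(j + 1) + 1 = -j by ring] at this
    unfold la lb dual at *
    rw [show N - (N - 2 - i + 1) = i + 1 by omega,
    show N - (N - 2 - i) = i + 2 by omega, show N - (N - 2 - i + 2) = i by omega]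
    simp only [show j + 1 - 2 = j - 1 by ring, show -(j + 1) + 2 = -(j - 1) by ring,
      show -j - 2 = -(j + 2) by ring] at *
    omega
  · change EE _ _ _ = EE i P _ + cwt i P
    rw [h1 _ _ (by omega), h2 _ _ (by omega)]; ring

theorem dual_rse {N i : ℕ} {P : ℕ → ℤ → ℤ} (hi : i + 2 ≤ N) (R : ℤ) :
    dual N P = rse (N - 2 - i + 1) (-R) (dual N (rse (i + 1) R P)) := by
  funext t j
  simp only [rse_apply, dual]
  by_cases h1 : t = N - 2 - i + 1 ∧ j = -R
  · rw [if_pos h1, if_pos (by omega)]; ring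
  · rw [if_neg h1, if_neg (by omega)]

theorem rst_dual {N i : ℕ} {P Q : ℕ → ℤ → ℤ} (hP : Val N P) (hQ : Val N Q) (hi : i + 2 ≤ N)
    (h : rst i P Q) : rst (N - 2 - i) (dual N Q) (dual N P) := by
  obtain ⟨R, hR, h0, rfl⟩ := rst_imp hP h
  refine ⟨-R, ⟨fun j => ?_, fun j hj => ?_⟩, ?_, dual_rse hi R⟩
  · rw [EE_dual hQ hi, EE_dual hQ hi, neg_neg]; have := hR.1 (-j); omega
  · rw [EE_dual hQ hi, EE_dual hQ hi, neg_neg]; have := hR.2 (-j) (by omega); omega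
  · rw [EE_dual hQ hi, neg_neg]; exact h0

theorem Val.exmax {N : ℕ} {P : ℕ → ℤ → ℤ} (h : Val N P) (i : ℕ) :
    ∃ R, (∀ j, EE i P j ≤ EE i P R) ∧ mxv (EE i P) = EE i P R := by
  obtain ⟨B, h1, h2⟩ := EE_big h
  obtain ⟨R, hR⟩ := exists_max (h1 i) (h2 i)
  exact ⟨R, hR, mxv_eq R hR rfl⟩

theorem mxv_dual {N i : ℕ} {P : ℕ → ℤ → ℤ} (h : Val N P) (hi : i + 2 ≤ N) :
    mxv (EE (N - 2 - i) (dual N P)) = mxv (EE i P) + cwt i P := by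
  obtain ⟨R, hR, e⟩ := h.exmax i
  rw [e]
  refine mxv_eq (-R) (fun j => ?_) ?_
  · rw [EE_dual h hi]; have := hR (-j); omega
  · rw [EE_dual h hi, neg_neg]

theorem rst_fun {i : ℕ} {P Q Q' : ℕ → ℤ → ℤ} (h : rst i P Q) (h' : rst i P Q') : Q = Q' := by
  obtain ⟨R, hR, -, rfl⟩ := h
  obtain ⟨R', hR', -, rfl⟩ := h'
  rw [hR.uniq hR']

theorem rst_inj {N i : ℕ} {P P' Q : ℕ → ℤ → ℤ} (hP : Val N P) (hP' : Val N P') (h : rst i P Q)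
    (h' : rst i P' Q) : P = P' := by
  obtain ⟨R, hR, -, e⟩ := rst_imp hP h
  obtain ⟨R', hR', -, e'⟩ := rst_imp hP' h'
  obtain rfl := hR.uniq hR'
  exact rse_inj (e.symm.trans e')

theorem rst_mxv {i : ℕ} {P Q : ℕ → ℤ → ℤ} (hP : FS P) (h : rst i P Q) :
    mxv (EE i P) = mxv (EE i Q) + 1 := by
  obtain ⟨R, hR, -, rfl⟩ := h
  rw [mxv_eq R hR.1 rfl, mxv_eq (f := EE i (rse (i + 1) R P)) R (μ := EE i P R - 1)]
  · ring
  · intro j; rw [EE_self hP]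
    have := hR.1 j; have := hR.2 j; have := dl_spec j R; have := dl_spec j (R - 1); omega
  · rw [EE_self hP]
    have := dl_spec R R; have := dl_spec R (R - 1); omega

theorem Val.tot_le {N : ℕ} {P : ℕ → ℤ → ℤ} (h : Val N P) {s t : ℕ} (hst : s ≤ t) :
    tot P s ≤ tot P t := by
  rw [← sub_nonneg]
  unfold tot
  rw [← finsum_sub_distrib (h.fs.fin' t) (h.fs.fin' s)]
  refine finsum_nonneg fun m => ?_
  have := h.mono' hst m
  omega

noncomputable def rkZ (N : ℕ) (P : ℕ → ℤ → ℤ) : ℤ := ∑ t ∈ Finset.range N, (tot P N - tot P t)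

theorem Val.rkZ_nonneg {N : ℕ} {P : ℕ → ℤ → ℤ} (h : Val N P) : 0 ≤ rkZ N P := by
  refine Finset.sum_nonneg fun t ht => ?_
  have := h.tot_le (show t ≤ N by simp at ht; omega)
  omega

theorem rst_rkZ {N i : ℕ} {P Q : ℕ → ℤ → ℤ} (hP : FS P) (hi : i + 2 ≤ N) (h : rst i P Q) :
    rkZ N P = rkZ N Q + 1 := by
  obtain ⟨R, hR, -, rfl⟩ := h
  unfold rkZ
  simp only [tot_rse hP (Nat.succ_ne_zero i)]
  rw [if_neg (show ¬ N = i + 1 by omega)]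
  have : ∀ t, (tot P N + 0 - (tot P t + if t = i + 1 then 1 else 0)) =
    (tot P N - tot P t) - (if t = i + 1 then 1 else 0) := by intro t; ring
  simp only [Nat.succ_eq_add_one, this, Finset.sum_sub_distrib]
  rw [Finset.sum_ite_eq' (Finset.range N) (i + 1), if_pos (by simp; omega)]
  ring

abbrev VV (N : ℕ) : Type := {P : ℕ → ℤ → ℤ // Val N P}
abbrev II (N : ℕ) : Type := {i : ℕ // i + 2 ≤ N}

noncomputable def theC (N : ℕ) : Crys (VV N) (II N) where
  st i x y := rst i.1 x.1 y.1
  eps i x := mxv (EE i.1 x.1)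
  phi i x := mxv (EE i.1 x.1) + cwt i.1 x.1
  rank x := (rkZ N x.1).toNat
  cc i k := if k.1 = i.1 then 2 else if k.1 = i.1 + 1 then -1 else if k.1 + 1 = i.1 then -1 else 0
  st_fun h h' := Subtype.ext (rst_fun h h')
  st_inj {i x x' y} h h' := Subtype.ext (rst_inj x.2 x'.2 h h')
  eps_nonneg i x := by
    obtain ⟨R, hR, e⟩ := x.2.exmax i.1
    rw [e]; exact (EE_le_lims x.2 i.1 hR).1
  ex_e {i x} h := by
    obtain ⟨Q, hQ⟩ := rst_ex_e x.2 h
    exact ⟨⟨Q, rst_val x.2 i.2 hQ⟩, hQ⟩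
  eps_pos {i x y} h := by
    obtain ⟨R, hR, h0, -⟩ := h
    rw [mxv_eq R hR.1 rfl]; exact h0
  ex_f {i x} h := by
    obtain ⟨P, hP, hPQ⟩ := rst_ex_f x.2 i.2 h
    exact ⟨⟨P, hP⟩, hPQ⟩
  phi_pos {i x y} h := by
    obtain ⟨R, hR, h0, -⟩ := rst_imp x.2 h
    rw [mxv_eq R hR.1 rfl]; exact h0
  eps_st {i x y} h := rst_mxv x.2.fs h
  wt_st {i x y} j h := by
    have := rst.cwt x.2.fs h j.1
    linarith
  rank_st {i x y} h := by
    have h1 := rst_rkZ x.2.fs i.2 h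
    have h2 := y.2.rkZ_nonneg
    change (rkZ N x.1).toNat = (rkZ N y.1).toNat + 1
    omega
  ax1 {i j x y z} h0 h1 h2 := by
    have h0' : i.1 ≠ j.1 := fun h => h0 (Subtype.ext h)
    rcases LL x.2 h0' h1 h2 with ⟨-, w, a, b, c⟩ | ⟨-, p, q, r, s, w, a1, a2, a3, a4, a5, a6, a7, a8⟩
    · exact Or.inl ⟨⟨w, rst_val y.2 j.2 a⟩, a, b, c⟩
    · have vp := rst_val y.2 j.2 a1
      have vq := rst_val vp j.2 a2
      have vw := rst_val vq i.2 a3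
      have vr := rst_val z.2 i.2 a4
      have vs := rst_val vr i.2 a5
      exact Or.inr ⟨⟨p, vp⟩, ⟨q, vq⟩, ⟨r, vr⟩, ⟨s, vs⟩, ⟨w, vw⟩, a1, a2, a3, a4, a5, a6, a7, a8⟩
  ax2 {i j w y z} h0 h1 h2 h3 := by
    have hi := i.2
    have hj := j.2
    have h0' : N - 2 - i.1 ≠ N - 2 - j.1 := fun h => h0 (Subtype.ext (by omega))
    have e : ∀ k : II N, N - 2 - (N - 2 - k.1) = k.1 := fun k => by have := k.2; omega
    rcases LL w.2.dual h0' (rst_dual z.2 w.2 hi h2) (rst_dual y.2 w.2 hj h1) with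
      ⟨-, x, a, b, c⟩ | ⟨⟨b1, b2⟩, -⟩
    · have vx := rst_val z.2.dual (by omega) a
      have a' := rst_dual z.2.dual vx (by omega) a
      have b' := rst_dual y.2.dual vx (by omega) b
      rw [e, dual_dual z.2] at a'
      rw [e, dual_dual y.2] at b'
      exact ⟨⟨dual N x, vx.dual⟩, b', a'⟩
    · rw [mxv_dual z.2 hj, mxv_dual w.2 hj] at b1
      rw [mxv_dual y.2 hi, mxv_dual w.2 hi] at b2
      rcases h3 with h3 | h3
      · exact absurd h3 b1
      · exact absurd h3 b2
  ax3 {i j w q s} h0 h1 h2 h3 h4 := by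
    have hi := i.2
    have hj := j.2
    have h0' : N - 2 - i.1 ≠ N - 2 - j.1 := fun h => h0 (Subtype.ext (by omega))
    have e : ∀ k : II N, N - 2 - (N - 2 - k.1) = k.1 := fun k => by have := k.2; omega
    rcases LL w.2.dual h0' (rst_dual q.2 w.2 hi h1) (rst_dual s.2 w.2 hj h2) with
      ⟨b, -⟩ | ⟨-, p, y, r, z, x, a1, a2, a3, a4, a5, a6, -⟩
    · rw [mxv_dual q.2 hj, mxv_dual w.2 hj, mxv_dual s.2 hi, mxv_dual w.2 hi] at b
      exact absurd b (not_or.2 ⟨h3, h4⟩)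
    · have vp := rst_val q.2.dual (by omega) a1
      have vy := rst_val vp (by omega) a2
      have vx := rst_val vy (by omega) a3
      have vr := rst_val s.2.dual (by omega) a4
      have vz := rst_val vr (by omega) a5
      have b1 := rst_dual q.2.dual vp (by omega) a1
      have b2 := rst_dual vp vy (by omega) a2
      have b3 := rst_dual vy vx (by omega) a3
      have b4 := rst_dual s.2.dual vr (by omega) a4
      have b5 := rst_dual vr vz (by omega) a5
      have b6 := rst_dual vz vx (by omega) a6
      rw [e] at b1 b2 b3 b4 b5 b6
      rw [dual_dual q.2] at b1
      rw [dual_dual s.2] at b4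
      exact ⟨⟨_, vx.dual⟩, ⟨_, vy.dual⟩, ⟨_, vz.dual⟩, ⟨_, vp.dual⟩, ⟨_, vr.dual⟩,
        b3, b2, b1, b6, b5, b4⟩

/-- upward plus-edges of the connectivity graph -/
def upE (N : ℕ) (P : ℕ → ℤ → ℤ) (x y : ℤ × ℕ) : Prop :=
  y.2 = x.2 + 1 ∧ y.2 ≤ N ∧
    ((y.1 = x.1 ∧ P (x.2 + 1) (2 * x.1) < P x.2 (2 * x.1 + 1)) ∨
     (y.1 = x.1 - 1 ∧ P x.2 (2 * x.1) ≤ P (x.2 + 1) (2 * x.1 - 1)))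

def adE (N : ℕ) (P : ℕ → ℤ → ℤ) (x y : ℤ × ℕ) : Prop := upE N P x y ∨ upE N P y x

def cnE (N : ℕ) (P : ℕ → ℤ → ℤ) : ℤ × ℕ → ℤ × ℕ → Prop := Relation.ReflTransGen (adE N P)

theorem adE.symm {N : ℕ} {P : ℕ → ℤ → ℤ} {x y : ℤ × ℕ} (h : adE N P x y) : adE N P y x := Or.symm h

theorem cnE.symm {N : ℕ} {P : ℕ → ℤ → ℤ} {x y : ℤ × ℕ} (h : cnE N P x y) : cnE N P y x := by
  induction h with
  | refl => exact .refl
  | tail _ h2 ih => exact Relation.ReflTransGen.head h2.symm ih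

theorem cnE.trans {N : ℕ} {P : ℕ → ℤ → ℤ} {x y z : ℤ × ℕ} (h : cnE N P x y) (h' : cnE N P y z) :
    cnE N P x z := Relation.ReflTransGen.trans h h'

def NN (i : ℕ) (P : ℕ → ℤ → ℤ) (j : ℤ) : Prop :=
  P (i + 1) j < max (P i (j + 1)) (P (i + 2) (j - 1) + 1) ∧
    min (P (i + 2) j) (P i (j + 2) - 1) < P (i + 1) (j + 1)

theorem NN_rst {N i : ℕ} {P Q : ℕ → ℤ → ℤ} (hP : Val N P) (hi : i + 2 ≤ N) (h : rst i P Q) (j : ℤ) :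
    NN i P j ↔ NN i Q j := by
  have hQ := rst_val hP hi h
  obtain ⟨R, hR, h0, rfl⟩ := h
  have a1 := EE_diff hP.fs i j
  have a2 := hP.la_nonneg i (j + 1)
  have a3 := hP.lb_nonneg i j
  have a4 := hQ.la_nonneg i (j + 1)
  have a5 := hQ.lb_nonneg i j
  have a6 := hR.1 j
  have a7 := hR.1 (j + 1)
  have a8 := hR.2 (j + 1)
  unfold la lb at *
  unfold NN
  rw [show j + 1 - 2 = j - 1 by ring] at *
  simp only [rse_lvl (show i ≠ i + 1 by omega), rse_lvl (show i + 2 ≠ i + 1 by omega)] at *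
  by_cases h1 : R = j
  · subst h1
    rw [rse_same, rse_row _ _ (show R + 1 ≠ R by omega)] at *
    omega
  · by_cases h2 : R = j + 1
    · subst h2
      rw [rse_same, rse_row _ _ (show j ≠ j + 1 by omega)] at *
      omega
    · rw [rse_row _ _ (Ne.symm h1), rse_row _ _ (Ne.symm h2)]

section K
variable {N i : ℕ} {P Q : ℕ → ℤ → ℤ}

theorem Kbase (hi : i + 2 ≤ N) {l : ℤ} (h : ¬ NN i Q (2 * l - 1)) :
    cnE N Q (l, i) (l - 1, i + 2) := by
  unfold NN at h
  rw [not_and_or, not_lt, not_lt, show 2 * l - 1 + 1 = 2 * l by ring,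
    show 2 * l - 1 - 1 = 2 * (l - 1) by ring, show 2 * l - 1 + 2 = 2 * l + 1 by ring] at h
  rcases h with h | h
  · refine (Relation.ReflTransGen.single (b := (l - 1, i + 1)) ?_).tail ?_
    · left; refine ⟨rfl, by simp; omega, Or.inr ⟨rfl, ?_⟩⟩
      simp only; omega
    · left; refine ⟨rfl, hi, Or.inl ⟨rfl, ?_⟩⟩
      simp only [show i + 1 + 1 = i + 2 by rfl, show 2 * (l - 1) + 1 = 2 * l - 1 by ring]; omega
  · refine (Relation.ReflTransGen.single (b := (l, i + 1)) ?_).tail ?_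
    · left; refine ⟨rfl, by simp; omega, Or.inl ⟨rfl, ?_⟩⟩
      simp only; omega
    · left; refine ⟨rfl, hi, Or.inr ⟨rfl, ?_⟩⟩
      simp only [show i + 1 + 1 = i + 2 by rfl]; omega

/-- neighbours of `(l,i+1)` -/
theorem nbr_cases {l : ℤ} {z : ℤ × ℕ} (h : adE N P (l, i + 1) z) :
    (z = (l, i) ∧ P (i + 1) (2 * l) < P i (2 * l + 1)) ∨
    (z = (l - 1, i + 2) ∧ P (i + 1) (2 * l) ≤ P (i + 2) (2 * l - 1)) ∨
    (z = (l, i + 2) ∧ P (i + 2) (2 * l) < P (i + 1) (2 * l + 1)) ∨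
    (z = (l + 1, i) ∧ P i (2 * l + 2) ≤ P (i + 1) (2 * l + 1)) := by
  obtain ⟨a, s⟩ := z
  rcases h with ⟨h1, h2, ⟨h3, h4⟩ | ⟨h3, h4⟩⟩ | ⟨h1, h2, ⟨h3, h4⟩ | ⟨h3, h4⟩⟩
  · simp only at h1 h3 h4; subst h1 h3
    exact Or.inr (Or.inr (Or.inl ⟨rfl, h4⟩))
  · simp only at h1 h3 h4; subst h1 h3
    exact Or.inr (Or.inl ⟨rfl, h4⟩)
  · simp only at h1 h3 h4
    obtain rfl : s = i := by omega
    subst h3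
    exact Or.inl ⟨rfl, h4⟩
  · simp only at h1 h3 h4
    obtain rfl : s = i := by omega
    obtain rfl : a = l + 1 := by omega
    refine Or.inr (Or.inr (Or.inr ⟨rfl, ?_⟩))
    rwa [show 2 * (l + 1) = 2 * l + 2 by ring, show 2 * l + 2 - 1 = 2 * l + 1 by ring] at h4

theorem nbrA (hi : i + 2 ≤ N) {l : ℤ} (h : Q (i + 1) (2 * l) < Q i (2 * l + 1)) :
    cnE N Q (l, i) (l, i + 1) :=
  Relation.ReflTransGen.single (Or.inl ⟨rfl, by simp; omega, Or.inl ⟨rfl, h⟩⟩)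
theorem nbrB (hi : i + 2 ≤ N) {l : ℤ} (h : Q (i + 1) (2 * l) ≤ Q (i + 2) (2 * l - 1)) :
    cnE N Q (l - 1, i + 2) (l, i + 1) :=
  Relation.ReflTransGen.single (Or.inr ⟨rfl, hi, Or.inr ⟨rfl, h⟩⟩)
theorem nbrC (hi : i + 2 ≤ N) {l : ℤ} (h : Q (i + 2) (2 * l) < Q (i + 1) (2 * l + 1)) :
    cnE N Q (l, i + 2) (l, i + 1) :=
  Relation.ReflTransGen.single (Or.inr ⟨rfl, hi, Or.inl ⟨rfl, h⟩⟩)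
theorem nbrD (hi : i + 2 ≤ N) {l : ℤ} (h : Q i (2 * l + 2) ≤ Q (i + 1) (2 * l + 1)) :
    cnE N Q (l + 1, i) (l, i + 1) :=
  Relation.ReflTransGen.single (Or.inl ⟨rfl, by simp; omega, Or.inr ⟨by simp, by
    simp only
    rwa [show 2 * (l + 1) = 2 * l + 2 by ring, show 2 * l + 2 - 1 = 2 * l + 1 by ring]⟩⟩)

variable (hi : i + 2 ≤ N) (e0 : Q i = P i) (e2 : Q (i + 2) = P (i + 2))
  (hN : ∀ j, NN i P j ↔ NN i Q j)

theorem K_AB (hi : i + 2 ≤ N)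
  (hN : ∀ j, NN i P j ↔ NN i Q j) {l : ℤ} (h1 : P (i + 1) (2 * l) < P i (2 * l + 1))
    (h2 : P (i + 1) (2 * l) ≤ P (i + 2) (2 * l - 1)) : cnE N Q (l, i) (l - 1, i + 2) := by
  refine Kbase hi fun h => ?_
  have := ((hN _).2 h).2
  rw [show 2 * l - 1 + 1 = 2 * l by ring, show 2 * l - 1 + 2 = 2 * l + 1 by ring] at this
  omega

theorem K_DC (hi : i + 2 ≤ N)
  (hN : ∀ j, NN i P j ↔ NN i Q j) {l : ℤ} (h1 : P i (2 * l + 2) ≤ P (i + 1) (2 * l + 1))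
    (h2 : P (i + 2) (2 * l) < P (i + 1) (2 * l + 1)) : cnE N Q (l + 1, i) (l, i + 2) := by
  have := Kbase (N := N) (Q := Q) hi (l := l + 1) (fun h => by
    have := ((hN _).2 h).1
    rw [show 2 * (l + 1) - 1 + 1 = 2 * l + 2 by ring, show 2 * (l + 1) - 1 = 2 * l + 1 by ring,
      show 2 * l + 1 - 1 = 2 * l by ring] at this
    omega)
  rwa [add_sub_cancel_right] at this

/-- lower neighbours get connected to an actual neighbour -/
theorem K_lo (hi : i + 2 ≤ N) (e0 : Q i = P i) (e2 : Q (i + 2) = P (i + 2))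
    (hN : ∀ j, NN i P j ↔ NN i Q j) {l : ℤ} {z : ℤ × ℕ} (hQ : NN i Q (2 * l))
    (h : (z = (l, i) ∧ P (i + 1) (2 * l) < P i (2 * l + 1)) ∨
    (z = (l - 1, i + 2) ∧ P (i + 1) (2 * l) ≤ P (i + 2) (2 * l - 1))) :
    cnE N Q z (l, i + 1) := by
  have h1 := hQ.1
  rw [e0, e2] at h1
  rcases h with ⟨rfl, h⟩ | ⟨rfl, h⟩
  · by_cases c : Q (i + 1) (2 * l) < P i (2 * l + 1)
    · exact nbrA hi (by rwa [e0])
    · exact (K_AB hi hN h (by omega)).trans (nbrB hi (by rw [e2]; omega))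
  · by_cases c : Q (i + 1) (2 * l) ≤ P (i + 2) (2 * l - 1)
    · exact nbrB hi (by rwa [e2])
    · exact (K_AB hi hN (by omega) h).symm.trans (nbrA hi (by rw [e0]; omega))

theorem K_hi (hi : i + 2 ≤ N) (e0 : Q i = P i) (e2 : Q (i + 2) = P (i + 2))
    (hN : ∀ j, NN i P j ↔ NN i Q j) {l : ℤ} {z : ℤ × ℕ} (hQ : NN i Q (2 * l))
    (h : (z = (l, i + 2) ∧ P (i + 2) (2 * l) < P (i + 1) (2 * l + 1)) ∨
    (z = (l + 1, i) ∧ P i (2 * l + 2) ≤ P (i + 1) (2 * l + 1))) :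
    cnE N Q z (l, i + 1) := by
  have h1 := hQ.2
  rw [e0, e2] at h1
  rcases h with ⟨rfl, h⟩ | ⟨rfl, h⟩
  · by_cases c : P (i + 2) (2 * l) < Q (i + 1) (2 * l + 1)
    · exact nbrC hi (by rwa [e2])
    · exact (K_DC hi hN (by omega) h).symm.trans (nbrD hi (by rw [e0]; omega))
  · by_cases c : P i (2 * l + 2) ≤ Q (i + 1) (2 * l + 1)
    · exact nbrD hi (by rwa [e0])
    · exact (K_DC hi hN h (by omega)).trans (nbrC hi (by rw [e2]; omega))

theorem K_all (hi : i + 2 ≤ N) (e0 : Q i = P i) (e2 : Q (i + 2) = P (i + 2))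
    (hN : ∀ j, NN i P j ↔ NN i Q j) {l : ℤ} {y z : ℤ × ℕ} (hy : adE N P (l, i + 1) y)
    (hz : adE N P (l, i + 1) z) : cnE N Q y z := by
  have main : ∀ y z : ℤ × ℕ, ((y = (l, i) ∧ P (i + 1) (2 * l) < P i (2 * l + 1)) ∨
      (y = (l - 1, i + 2) ∧ P (i + 1) (2 * l) ≤ P (i + 2) (2 * l - 1))) →
      ((z = (l, i + 2) ∧ P (i + 2) (2 * l) < P (i + 1) (2 * l + 1)) ∨
      (z = (l + 1, i) ∧ P i (2 * l + 2) ≤ P (i + 1) (2 * l + 1))) → cnE N Q y z := by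
    intro y z h1 h2
    have hQ : NN i Q (2 * l) := by
      rw [← hN]
      refine ⟨?_, ?_⟩
      · rcases h1 with h1 | h1 <;> have := h1.2 <;> omega
      · rcases h2 with h1 | h1 <;> have := h1.2 <;> omega
    exact (K_lo hi e0 e2 hN hQ h1).trans (K_hi hi e0 e2 hN hQ h2).symm
  have hy' := nbr_cases hy
  have hz' := nbr_cases hz
  rw [← or_assoc] at hy' hz'
  rcases hy' with hy' | hy' <;> rcases hz' with hz' | hz'
  · rcases hy' with ⟨rfl, a⟩ | ⟨rfl, a⟩ <;> rcases hz' with ⟨rfl, b⟩ | ⟨rfl, b⟩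
    · exact .refl
    · exact K_AB hi hN a b
    · exact (K_AB hi hN b a).symm
    · exact .refl
  · exact main _ _ hy' hz'
  · exact (main _ _ hz' hy').symm
  · rcases hy' with ⟨rfl, a⟩ | ⟨rfl, a⟩ <;> rcases hz' with ⟨rfl, b⟩ | ⟨rfl, b⟩
    · exact .refl
    · exact (K_DC hi hN b a).symm
    · exact K_DC hi hN a b
    · exact .refl

theorem cn_transfer (hi : i + 2 ≤ N) (e : ∀ s, s ≠ i + 1 → Q s = P s)
    (hN : ∀ j, NN i P j ↔ NN i Q j) {x y : ℤ × ℕ} (hx : x.2 ≠ i + 1) (hy : y.2 ≠ i + 1)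
    (h : cnE N P x y) : cnE N Q x y := by
  have up : ∀ a b : ℤ × ℕ, a.2 ≠ i + 1 → b.2 ≠ i + 1 → upE N P a b → upE N Q a b := by
    rintro a b ha hb ⟨h1, h2, h3⟩
    refine ⟨h1, h2, ?_⟩
    rw [← h1] at h3 ⊢
    rwa [e _ ha, e _ hb]
  have key : ∀ y, cnE N P x y → (y.2 ≠ i + 1 → cnE N Q x y) ∧
      (y.2 = i + 1 → ∀ z, adE N P y z → cnE N Q x z) := by
    intro y h
    induction h with
    | refl => exact ⟨fun _ => .refl, fun h => absurd h hx⟩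
    | @tail y z _ hyz ih =>
      refine ⟨fun hz => ?_, fun hz w hw => ?_⟩
      · by_cases hy : y.2 = i + 1
        · exact ih.2 hy z hyz
        · exact (ih.1 hy).tail (hyz.imp (up _ _ hy hz) (up _ _ hz hy))
      · have hy : y.2 ≠ i + 1 := by
          rcases hyz with h | h <;> have := h.1 <;> omega
        obtain ⟨l, s⟩ := z
        simp only at hz
        subst hz
        exact (ih.1 hy).trans (K_all hi (e _ (by omega)) (e _ (by omega)) hN hyz.symm hw)
  exact (key y h).1 hy
end K

theorem cn_rst {N i : ℕ} {P Q : ℕ → ℤ → ℤ} (hP : Val N P) (hi : i + 2 ≤ N) (h : rst i P Q)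
    {x y : ℤ × ℕ} (hx : x.2 = 0 ∨ x.2 = N) (hy : y.2 = 0 ∨ y.2 = N) :
    cnE N P x y ↔ cnE N Q x y := by
  have e : ∀ s, s ≠ i + 1 → Q s = P s := by
    obtain ⟨R, -, -, rfl⟩ := h
    intro s hs; exact rse_lvl hs _ _
  have n := NN_rst hP hi h
  exact ⟨cn_transfer hi e n (by omega) (by omega),
    cn_transfer hi (fun s hs => (e s hs).symm) (fun j => (n j).symm) (by omega) (by omega)⟩

def loP (P : ℕ → ℤ → ℤ) (t : ℕ) (l : ℤ) : ℤ := min (P t (2 * l)) (P t (2 * l + 1))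
def hiP (P : ℕ → ℤ → ℤ) (t : ℕ) (l : ℤ) : ℤ := max (P t (2 * l)) (P t (2 * l + 1))

def gup (N : ℕ) (P : ℕ → ℤ → ℤ) (x y : ℤ × ℕ) : Prop :=
  y.2 = x.2 + 1 ∧ y.2 ≤ N ∧
    ((y.1 = x.1 ∧ loP P (x.2 + 1) x.1 < hiP P x.2 x.1) ∨
     (y.1 = x.1 - 1 ∧ loP P x.2 x.1 ≤ hiP P (x.2 + 1) (x.1 - 1)))

def gad (N : ℕ) (P : ℕ → ℤ → ℤ) (x y : ℤ × ℕ) : Prop := gup N P x y ∨ gup N P y x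

def cnG (N : ℕ) (P : ℕ → ℤ → ℤ) : ℤ × ℕ → ℤ × ℕ → Prop := Relation.ReflTransGen (gad N P)

def posP (P : ℕ → ℤ → ℤ) (x : ℤ × ℕ) : Prop := P x.2 (2 * x.1) < P x.2 (2 * x.1 + 1)
def negP (P : ℕ → ℤ → ℤ) (x : ℤ × ℕ) : Prop := P x.2 (2 * x.1 + 1) < P x.2 (2 * x.1)

theorem gup_sign {N : ℕ} {P : ℕ → ℤ → ℤ} (hP : Val N P) {x y : ℤ × ℕ} (h : gup N P x y) :
    (posP P x ∧ posP P y ∧ upE N P x y) ∨ (negP P x ∧ negP P y) := by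
  obtain ⟨l, t⟩ := x
  obtain ⟨l', t'⟩ := y
  obtain ⟨h1, h2, h3⟩ := h
  unfold posP negP upE
  simp only at *
  subst h1
  rcases h3 with ⟨rfl, h3⟩ | ⟨rfl, h3⟩
  · unfold loP hiP at h3
    have a1 := hP.mono t (2 * l')
    have a2 := hP.mono t (2 * l' + 1)
    simp only [true_and, h2]
    omega
  · unfold loP hiP at h3
    have a1 := hP.inter t (2 * (l - 1))
    have a2 := hP.inter t (2 * (l - 1) + 1)
    rw [show 2 * (l - 1) + 2 = 2 * l by ring] at a1
    rw [show 2 * (l - 1) + 1 + 2 = 2 * l + 1 by ring] at a2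
    rw [show 2 * (l - 1) + 1 = 2 * l - 1 by ring] at *
    simp only [true_and, h2]
    omega

theorem upE_gup {N : ℕ} {P : ℕ → ℤ → ℤ} {x y : ℤ × ℕ} (h : upE N P x y) : gup N P x y := by
  obtain ⟨h1, h2, h3⟩ := h
  refine ⟨h1, h2, ?_⟩
  unfold loP hiP
  rcases h3 with ⟨h4, h3⟩ | ⟨h4, h3⟩
  · exact Or.inl ⟨h4, by omega⟩
  · refine Or.inr ⟨h4, ?_⟩
    rw [show 2 * (x.1 - 1) + 1 = 2 * x.1 - 1 by ring]; omega

theorem cnG_of_cnE {N : ℕ} {P : ℕ → ℤ → ℤ} {x y : ℤ × ℕ} (h : cnE N P x y) : cnG N P x y := by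
  induction h with
  | refl => exact .refl
  | tail _ h2 ih => exact Relation.ReflTransGen.tail ih (Or.imp upE_gup upE_gup h2)

theorem cnE_of_cnG {N : ℕ} {P : ℕ → ℤ → ℤ} (hP : Val N P) {x y : ℤ × ℕ} (h : cnG N P x y)
    (hx : posP P x) : cnE N P x y := by
  have : posP P y ∧ cnE N P x y := by
    induction h with
    | refl => exact ⟨hx, .refl⟩
    | tail _ h2 ih =>
      obtain ⟨p, c⟩ := ih
      rcases h2 with h2 | h2 <;> rcases gup_sign hP h2 with ⟨a1, a2, a3⟩ | ⟨a1, a2⟩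
      · exact ⟨a2, c.tail (Or.inl a3)⟩
      · unfold posP negP at *; omega
      · exact ⟨a1, c.tail (Or.inr a3)⟩
      · unfold posP negP at *; omega
  exact this.2

theorem cnG_neg {N : ℕ} {P : ℕ → ℤ → ℤ} (hP : Val N P) {x y : ℤ × ℕ} (h : cnG N P x y)
    (hx : negP P x) : negP P y := by
  induction h with
  | refl => exact hx
  | tail _ h2 ih =>
    rcases h2 with h2 | h2 <;> rcases gup_sign hP h2 with ⟨a1, a2, a3⟩ | ⟨a1, a2⟩
    · unfold posP negP at *; omega
    · exact a2
    · unfold posP negP at *; omega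
    · exact a1

open Classical in
noncomputable def swp (N : ℕ) (A : ℤ × ℕ → Prop) (P : ℕ → ℤ → ℤ) : ℕ → ℤ → ℤ := fun t j =>
  if A (j / 2, min t N) then P t (4 * (j / 2) + 1 - j) else P t j

theorem swp_yes {N : ℕ} {A : ℤ × ℕ → Prop} {t : ℕ} {l : ℤ} (h : A (l, min t N)) (P : ℕ → ℤ → ℤ) :
    swp N A P t (2 * l) = P t (2 * l + 1) ∧ swp N A P t (2 * l + 1) = P t (2 * l) := by
  unfold swp
  rw [show 2 * l / 2 = l by omega, show (2 * l + 1) / 2 = l by omega, if_pos h, if_pos h,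
    show 4 * l + 1 - 2 * l = 2 * l + 1 by ring, show 4 * l + 1 - (2 * l + 1) = 2 * l by ring]
  exact ⟨rfl, rfl⟩

theorem swp_no {N : ℕ} {A : ℤ × ℕ → Prop} {t : ℕ} {l : ℤ} (h : ¬ A (l, min t N)) (P : ℕ → ℤ → ℤ) :
    swp N A P t (2 * l) = P t (2 * l) ∧ swp N A P t (2 * l + 1) = P t (2 * l + 1) := by
  unfold swp
  rw [show 2 * l / 2 = l by omega, show (2 * l + 1) / 2 = l by omega, if_neg h, if_neg h]
  exact ⟨rfl, rfl⟩

theorem loP_swp (N : ℕ) (A : ℤ × ℕ → Prop) (P : ℕ → ℤ → ℤ) : loP (swp N A P) = loP P := by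
  funext t l
  unfold loP
  by_cases h : A (l, min t N)
  · rw [(swp_yes h P).1, (swp_yes h P).2, min_comm]
  · rw [(swp_no h P).1, (swp_no h P).2]

theorem hiP_swp (N : ℕ) (A : ℤ × ℕ → Prop) (P : ℕ → ℤ → ℤ) : hiP (swp N A P) = hiP P := by
  funext t l
  unfold hiP
  by_cases h : A (l, min t N)
  · rw [(swp_yes h P).1, (swp_yes h P).2, max_comm]
  · rw [(swp_no h P).1, (swp_no h P).2]

theorem cnG_swp (N : ℕ) (A : ℤ × ℕ → Prop) (P : ℕ → ℤ → ℤ) : cnG N (swp N A P) = cnG N P := by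
  unfold cnG gad gup
  rw [loP_swp, hiP_swp]

theorem even_odd_ind {p : ℤ → Prop} (h : ∀ l, p (2 * l) ∧ p (2 * l + 1)) (j : ℤ) : p j := by
  rcases Int.even_or_odd' j with ⟨l, rfl | rfl⟩
  · exact (h l).1
  · exact (h l).2

theorem swp_swp (N : ℕ) (A : ℤ × ℕ → Prop) (P : ℕ → ℤ → ℤ) : swp N A (swp N A P) = P := by
  funext t j
  refine even_odd_ind (p := fun j => swp N A (swp N A P) t j = P t j) (fun l => ?_) j
  by_cases h : A (l, min t N)
  · exact ⟨(swp_yes h _).1.trans (swp_yes h P).2, (swp_yes h _).2.trans (swp_yes h P).1⟩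
  · exact ⟨(swp_no h _).1.trans (swp_no h P).1, (swp_no h _).2.trans (swp_no h P).2⟩

theorem tot_pair {P : ℕ → ℤ → ℤ} (h : FS P) (t : ℕ) :
    tot P t = ∑ᶠ l, ((loP P t l + hiP P t l) - (loP P 0 l + hiP P 0 l)) := by
  have e : ∀ t l, loP P t l + hiP P t l = P t (2 * l) + P t (2 * l + 1) := fun t l =>
    min_add_max _ _
  simp only [e]
  unfold tot
  have fs := h.fin' t
  have hs1 : (Function.support fun l : ℤ => P t (2 * l) - P 0 (2 * l)).Finite :=
    Set.Finite.preimage (f := fun l : ℤ => 2 * l) (fun a _ b _ h => by simpa using h) fs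
  have hs2 : (Function.support fun l : ℤ => P t (2 * l + 1) - P 0 (2 * l + 1)).Finite :=
    Set.Finite.preimage (f := fun l : ℤ => 2 * l + 1) (fun a _ b _ h => by simpa using h) fs
  have e2 : ∀ l, P t (2 * l) + P t (2 * l + 1) - (P 0 (2 * l) + P 0 (2 * l + 1)) =
      (P t (2 * l) - P 0 (2 * l)) + (P t (2 * l + 1) - P 0 (2 * l + 1)) := fun l => by ring
  simp only [e2]
  rw [finsum_add_distrib hs1 hs2]
  rw [← finsum_mem_range (f := fun j => P t j - P 0 j) (g := fun l : ℤ => 2 * l)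
      (fun a b h => by simpa using h),
    ← finsum_mem_range (f := fun j => P t j - P 0 j) (g := fun l : ℤ => 2 * l + 1)
      (fun a b h => by simpa using h)]
  rw [← finsum_mem_union' ?_ (fs.subset Set.inter_subset_right) (fs.subset Set.inter_subset_right)]
  · rw [← finsum_mem_univ]
    congr 1
    funext j
    have : j ∈ (Set.range (fun l : ℤ => 2 * l)) ∪ (Set.range fun l : ℤ => 2 * l + 1) := by
      rcases Int.even_or_odd' j with ⟨l, rfl | rfl⟩
      · left; exact ⟨l, rfl⟩
      · right; exact ⟨l, rfl⟩
    classical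
    rw [finsum_eq_if, finsum_eq_if, if_pos (Set.mem_univ j), if_pos this]
  · rw [Set.disjoint_left]
    rintro _ ⟨a, rfl⟩ ⟨b, hb⟩
    simp only at hb; omega

theorem Val_swp {N : ℕ} {A : ℤ × ℕ → Prop} {P : ℕ → ℤ → ℤ} (hP : Val N P)
    (hA : ∀ x y, gup N P x y → (A x ↔ A y))
    (hB : ∃ B : ℤ, ∀ t l, B < |l| → P t (2 * l) = P t (2 * l + 1))
    (hN : ∀ j, swp N A P N j < swp N A P N (j + 2)) : Val N (swp N A P) := by
  have stab : ∀ t, N ≤ t → swp N A P t = swp N A P N := by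
    intro t ht
    funext j
    unfold swp
    rw [min_eq_right ht, min_self, hP.stab t ht]
  refine ⟨fun t j => ?_, fun t j => ?_, stab, ?_⟩
  · by_cases ht : N ≤ t
    · rw [stab t ht, stab (t + 1) (by omega)]
    · refine even_odd_ind (p := fun j => swp N A P t j ≤ swp N A P (t + 1) j) (fun l => ?_) j
      have m1 := hP.mono t (2 * l)
      have m2 := hP.mono t (2 * l + 1)
      have key : (A (l, t) ↔ A (l, t + 1)) ∨ hiP P t l ≤ loP P (t + 1) l := by
        by_cases h : loP P (t + 1) l < hiP P t l
        · exact Or.inl (hA _ _ ⟨rfl, by simp; omega, Or.inl ⟨rfl, h⟩⟩)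
        · exact Or.inr (not_lt.1 h)
      unfold loP hiP at key
      have e1 : min t N = t := by omega
      have e2 : min (t + 1) N = t + 1 := by omega
      by_cases h1 : A (l, min t N) <;> by_cases h2 : A (l, min (t + 1) N)
      · rw [(swp_yes h1 P).1, (swp_yes h1 P).2, (swp_yes h2 P).1, (swp_yes h2 P).2]; omega
      · rw [(swp_yes h1 P).1, (swp_yes h1 P).2, (swp_no h2 P).1, (swp_no h2 P).2]
        rw [e1] at h1; rw [e2] at h2
        rcases key with key | key
        · exact absurd (key.1 h1) h2
        · omega
      · rw [(swp_no h1 P).1, (swp_no h1 P).2, (swp_yes h2 P).1, (swp_yes h2 P).2]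
        rw [e1] at h1; rw [e2] at h2
        rcases key with key | key
        · exact absurd (key.2 h2) h1
        · omega
      · rw [(swp_no h1 P).1, (swp_no h1 P).2, (swp_no h2 P).1, (swp_no h2 P).2]; omega
  · by_cases ht : N ≤ t
    · rw [stab t ht, stab (t + 1) (by omega)]; exact hN j
    · refine even_odd_ind (p := fun j => swp N A P (t + 1) j < swp N A P t (j + 2))
        (fun l => ?_) j
      have m1 := hP.inter t (2 * l)
      have m2 := hP.inter t (2 * l + 1)
      rw [show 2 * l + 2 = 2 * (l + 1) by ring] at *
      rw [show 2 * l + 1 + 2 = 2 * (l + 1) + 1 by ring] at *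
      have key : (A (l + 1, t) ↔ A (l, t + 1)) ∨ hiP P (t + 1) l < loP P t (l + 1) := by
        by_cases h : loP P t (l + 1) ≤ hiP P (t + 1) l
        · exact Or.inl (hA _ _ ⟨rfl, by simp; omega, Or.inr ⟨by simp, by simpa using h⟩⟩)
        · exact Or.inr (not_le.1 h)
      unfold loP hiP at key
      have e1 : min t N = t := by omega
      have e2 : min (t + 1) N = t + 1 := by omega
      by_cases h1 : A (l + 1, min t N) <;> by_cases h2 : A (l, min (t + 1) N)
      · rw [(swp_yes h1 P).1, (swp_yes h1 P).2, (swp_yes h2 P).1, (swp_yes h2 P).2]; omega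
      · rw [(swp_yes h1 P).1, (swp_yes h1 P).2, (swp_no h2 P).1, (swp_no h2 P).2]
        rw [e1] at h1; rw [e2] at h2
        rcases key with key | key
        · exact absurd (key.1 h1) h2
        · omega
      · rw [(swp_no h1 P).1, (swp_no h1 P).2, (swp_yes h2 P).1, (swp_yes h2 P).2]
        rw [e1] at h1; rw [e2] at h2
        rcases key with key | key
        · exact absurd (key.2 h2) h1
        · omega
      · rw [(swp_no h1 P).1, (swp_no h1 P).2, (swp_no h2 P).1, (swp_no h2 P).2]; omega
  · obtain ⟨B, hB⟩ := hB
    obtain ⟨B', hB'⟩ := hP.fs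
    have same : ∀ t l, B < |l| → swp N A P t (2 * l) = P t (2 * l) ∧
        swp N A P t (2 * l + 1) = P t (2 * l + 1) := by
      intro t l hl
      by_cases h : A (l, min t N)
      · rw [(swp_yes h P).1, (swp_yes h P).2, hB t l hl]; exact ⟨rfl, rfl⟩
      · exact swp_no h P
    refine ⟨max |B'| (2 * |B| + 1), fun t j hj => ?_⟩
    have hj2 : B' < |j| := by have := le_abs_self B'; omega
    have hj3 : B < |j / 2| := by
      rcases abs_cases B with h | h <;> rcases abs_cases j with h' | h' <;>
        rcases abs_cases (j / 2) with h'' | h'' <;> omega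
    rcases Int.even_or_odd' j with ⟨l, rfl | rfl⟩
    · rw [show 2 * l / 2 = l by omega] at hj3
      rw [(same t l hj3).1, (same 0 l hj3).1]; exact hB' _ _ hj2
    · rw [show (2 * l + 1) / 2 = l by omega] at hj3
      rw [(same t l hj3).2, (same 0 l hj3).2]; exact hB' _ _ hj2

/-- interleave -/
def ilv (u v : ℤ → ℤ) : ℤ → ℤ := fun j => if j % 2 = 0 then u (j / 2) else v (j / 2)

theorem ilv_even (u v : ℤ → ℤ) (l : ℤ) : ilv u v (2 * l) = u l := by
  unfold ilv; rw [if_pos (by omega), show 2 * l / 2 = l by omega]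

theorem ilv_odd (u v : ℤ → ℤ) (l : ℤ) : ilv u v (2 * l + 1) = v l := by
  unfold ilv; rw [if_neg (by omega), show (2 * l + 1) / 2 = l by omega]

theorem ilv_step {u v : ℤ → ℤ} (hu : StrictMono u) (hv : StrictMono v) (j : ℤ) :
    ilv u v j < ilv u v (j + 2) := by
  refine even_odd_ind (p := fun j => ilv u v j < ilv u v (j + 2)) (fun l => ?_) j
  rw [show 2 * l + 2 = 2 * (l + 1) by ring, show 2 * l + 1 + 2 = 2 * (l + 1) + 1 by ring]
  simp only [ilv_even, ilv_odd]
  exact ⟨hu (by omega), hv (by omega)⟩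

theorem eq_ilv {u v f : ℤ → ℤ} (h : ∀ l, f (2 * l) = u l ∧ f (2 * l + 1) = v l) : f = ilv u v := by
  funext j
  refine even_odd_ind (p := fun j => f j = ilv u v j) (fun l => ?_) j
  simp only [ilv_even, ilv_odd]
  exact h l

def Conf (N : ℕ) (p q : ℤ → ℤ) : Set (ℕ → ℤ → ℤ) := {P | Val N P ∧ P 0 = q ∧ P N = p}

section
variable (N : ℕ) (a b c d : ℤ → ℤ)

/-- nodes which have to be swapped -/
def S0 (x : ℤ × ℕ) : Prop := (x.2 = 0 ∧ b x.1 < d x.1) ∨ (x.2 = N ∧ a x.1 < c x.1)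
/-- nodes which have to be kept -/
def K0 (x : ℤ × ℕ) : Prop := (x.2 = 0 ∧ d x.1 ≤ b x.1) ∨ (x.2 = N ∧ c x.1 ≤ a x.1)

def sA (P : ℕ → ℤ → ℤ) (x : ℤ × ℕ) : Prop := ∃ s, S0 N a b c d s ∧ cnG N P s x

def XX : Set (ℕ → ℤ → ℤ) := Conf N (ilv (fun l => min (a l) (c l)) (fun l => max (a l) (c l)))
  (ilv (fun l => min (b l) (d l)) (fun l => max (b l) (d l)))
def YY : Set (ℕ → ℤ → ℤ) := Conf N (ilv c a) (ilv d b)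
def ZZ : Set (ℕ → ℤ → ℤ) := {P | P ∈ XX N a b c d ∧
  ∃ s y, S0 N a b c d s ∧ K0 N a b c d y ∧ cnG N P s y}

noncomputable def swA (P : ℕ → ℤ → ℤ) : ℕ → ℤ → ℤ := swp N (sA N a b c d P) P

theorem sA_swA (P : ℕ → ℤ → ℤ) : sA N a b c d (swA N a b c d P) = sA N a b c d P := by
  unfold sA swA; rw [cnG_swp]

theorem swA_swA (P : ℕ → ℤ → ℤ) : swA N a b c d (swA N a b c d P) = P := by
  have h : swA N a b c d (swA N a b c d P) =
    swp N (sA N a b c d (swA N a b c d P)) (swA N a b c d P) := rfl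
  rw [h, sA_swA, swA, swp_swp]

variable {N a b c d}

theorem sA_closed {P : ℕ → ℤ → ℤ} (x y : ℤ × ℕ) (h : gup N P x y) :
    sA N a b c d P x ↔ sA N a b c d P y := by
  constructor
  · rintro ⟨s, h1, h2⟩; exact ⟨s, h1, h2.tail (Or.inl h)⟩
  · rintro ⟨s, h1, h2⟩; exact ⟨s, h1, h2.tail (Or.inr h)⟩

theorem sA_of_S0 {P : ℕ → ℤ → ℤ} {x : ℤ × ℕ} (h : S0 N a b c d x) : sA N a b c d P x :=
  ⟨x, h, .refl⟩

theorem strict_min {u v : ℤ → ℤ} (hu : StrictMono u) (hv : StrictMono v) :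
    StrictMono (fun l => min (u l) (v l)) := by
  intro x y h; have := hu h; have := hv h; simp only; omega
theorem strict_max {u v : ℤ → ℤ} (hu : StrictMono u) (hv : StrictMono v) :
    StrictMono (fun l => max (u l) (v l)) := by
  intro x y h; have := hu h; have := hv h; simp only; omega

theorem Val.squeeze {P : ℕ → ℤ → ℤ} (h : Val N P) {j : ℤ} (h0 : P 0 j = P N j) (t : ℕ) :
    P t j = P 0 j := by
  by_cases ht : t ≤ N
  · have := h.mono' (Nat.zero_le t) j
    have := h.mono' ht j
    omega
  · rw [h.stab t (by omega), h0]

theorem XtoY (ha : StrictMono a) (hc : StrictMono c)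
    (hB : ∃ B : ℤ, ∀ l, B < |l| → b l = a l ∧ c l = a l ∧ d l = a l)
    {P : ℕ → ℤ → ℤ} (hP : P ∈ XX N a b c d) (hZ : P ∉ ZZ N a b c d) :
    swA N a b c d P ∈ YY N a b c d := by
  obtain ⟨hV, h0, hN⟩ := id hP
  have nk : ∀ x, K0 N a b c d x → ¬ sA N a b c d P x := by
    rintro x hx ⟨s, hs, h⟩
    exact hZ ⟨hP, s, x, hs, hx, h⟩
  have e0 : swA N a b c d P 0 = ilv d b := by
    refine eq_ilv fun l => ?_
    unfold swA
    by_cases h : b l < d l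
    · have hA : sA N a b c d P (l, min 0 N) := by
        rw [Nat.zero_min]; exact sA_of_S0 (Or.inl ⟨rfl, h⟩)
      rw [(swp_yes hA P).1, (swp_yes hA P).2, h0, ilv_even, ilv_odd]; omega
    · have hA : ¬ sA N a b c d P (l, min 0 N) := by
        rw [Nat.zero_min]; exact nk _ (Or.inl ⟨rfl, not_lt.1 h⟩)
      rw [(swp_no hA P).1, (swp_no hA P).2, h0, ilv_even, ilv_odd]; omega
  have eN : swA N a b c d P N = ilv c a := by
    refine eq_ilv fun l => ?_
    unfold swA
    by_cases h : a l < c l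
    · have hA : sA N a b c d P (l, min N N) := by
        rw [min_self]; exact sA_of_S0 (Or.inr ⟨rfl, h⟩)
      rw [(swp_yes hA P).1, (swp_yes hA P).2, hN, ilv_even, ilv_odd]; omega
    · have hA : ¬ sA N a b c d P (l, min N N) := by
        rw [min_self]; exact nk _ (Or.inr ⟨rfl, not_lt.1 h⟩)
      rw [(swp_no hA P).1, (swp_no hA P).2, hN, ilv_even, ilv_odd]; omega
  refine ⟨Val_swp hV sA_closed ?_ ?_, e0, eN⟩
  · obtain ⟨B, hB⟩ := hB
    refine ⟨B, fun t l hl => ?_⟩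
    obtain ⟨g1, g2, g3⟩ := hB l hl
    rw [hV.squeeze (j := 2 * l), hV.squeeze (j := 2 * l + 1)]
    all_goals simp only [h0, hN, ilv_even, ilv_odd]
    all_goals omega
  · change ∀ j, swA N a b c d P N j < swA N a b c d P N (j + 2)
    rw [eN]; exact ilv_step hc ha

theorem YtoX (ha : StrictMono a) (hc : StrictMono c)
    (hB : ∃ B : ℤ, ∀ l, B < |l| → b l = a l ∧ c l = a l ∧ d l = a l)
    {P : ℕ → ℤ → ℤ} (hP : P ∈ YY N a b c d) :
    swA N a b c d P ∈ XX N a b c d ∧ swA N a b c d P ∉ ZZ N a b c d := by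
  obtain ⟨hV, h0, hN⟩ := id hP
  have ng : ∀ x, sA N a b c d P x → negP P x := by
    rintro ⟨l, t⟩ ⟨⟨l', t'⟩, hs, h⟩
    refine cnG_neg hV h ?_
    rcases hs with ⟨h1, h2⟩ | ⟨h1, h2⟩
    · simp only at h1 h2; subst h1; unfold negP; simp only [h0, ilv_even, ilv_odd]; exact h2
    · simp only at h1 h2; subst h1; unfold negP; simp only [hN, ilv_even, ilv_odd]; exact h2
  have nk : ∀ x, K0 N a b c d x → ¬ sA N a b c d P x := by
    rintro ⟨l, t⟩ hx h
    have := ng _ h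
    unfold negP at this
    rcases hx with ⟨h1, h2⟩ | ⟨h1, h2⟩
    · simp only at h1 h2 this; subst h1; simp only [h0, ilv_even, ilv_odd] at this; omega
    · simp only at h1 h2 this; subst h1; simp only [hN, ilv_even, ilv_odd] at this; omega
  have e0 : swA N a b c d P 0 = (ilv (fun l => min (b l) (d l)) (fun l => max (b l) (d l))) := by
    refine eq_ilv fun l => ?_
    unfold swA
    by_cases h : b l < d l
    · have hA : sA N a b c d P (l, min 0 N) := by
        rw [Nat.zero_min]; exact sA_of_S0 (Or.inl ⟨rfl, h⟩)
      rw [(swp_yes hA P).1, (swp_yes hA P).2, h0, ilv_even, ilv_odd]; omega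
    · have hA : ¬ sA N a b c d P (l, min 0 N) := by
        rw [Nat.zero_min]; exact nk _ (Or.inl ⟨rfl, not_lt.1 h⟩)
      rw [(swp_no hA P).1, (swp_no hA P).2, h0, ilv_even, ilv_odd]; omega
  have eN : swA N a b c d P N = (ilv (fun l => min (a l) (c l)) (fun l => max (a l) (c l))) := by
    refine eq_ilv fun l => ?_
    unfold swA
    by_cases h : a l < c l
    · have hA : sA N a b c d P (l, min N N) := by
        rw [min_self]; exact sA_of_S0 (Or.inr ⟨rfl, h⟩)
      rw [(swp_yes hA P).1, (swp_yes hA P).2, hN, ilv_even, ilv_odd]; omega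
    · have hA : ¬ sA N a b c d P (l, min N N) := by
        rw [min_self]; exact nk _ (Or.inr ⟨rfl, not_lt.1 h⟩)
      rw [(swp_no hA P).1, (swp_no hA P).2, hN, ilv_even, ilv_odd]; omega
  refine ⟨⟨Val_swp hV sA_closed ?_ ?_, e0, eN⟩, ?_⟩
  · obtain ⟨B, hB⟩ := hB
    refine ⟨B, fun t l hl => ?_⟩
    obtain ⟨g1, g2, g3⟩ := hB l hl
    rw [hV.squeeze (j := 2 * l), hV.squeeze (j := 2 * l + 1)]
    all_goals simp only [h0, hN, ilv_even, ilv_odd]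
    all_goals omega
  · change ∀ j, swA N a b c d P N j < swA N a b c d P N (j + 2)
    rw [eN]; exact ilv_step (strict_min ha hc) (strict_max ha hc)
  · rintro ⟨-, s, y, hs, hy, h⟩
    refine nk y hy ?_
    rw [← sA_swA]
    exact ⟨s, hs, h⟩

theorem tot_swA {P : ℕ → ℤ → ℤ} (h : FS P) (h' : FS (swA N a b c d P)) :
    tot (swA N a b c d P) = tot P := by
  funext t
  rw [tot_pair h, tot_pair h']
  unfold swA
  rw [loP_swp, hiP_swp]

theorem char_XYZ {R : Type*} [AddCommMonoid R] (F : (ℕ → ℤ) → R)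
    (ha : StrictMono a) (hc : StrictMono c)
    (hB : ∃ B : ℤ, ∀ l, B < |l| → b l = a l ∧ c l = a l ∧ d l = a l)
    (hfin : (XX N a b c d).Finite) :
    ∑ᶠ P ∈ XX N a b c d, F (tot P) =
      ∑ᶠ P ∈ YY N a b c d, F (tot P) + ∑ᶠ P ∈ ZZ N a b c d, F (tot P) := by
  have hsub : ZZ N a b c d ⊆ XX N a b c d := fun P hP => hP.1
  rw [← finsum_mem_inter_add_sdiff (ZZ N a b c d) hfin, Set.inter_eq_self_of_subset_right hsub,
    add_comm]
  congr 1
  symm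
  refine finsum_mem_eq_of_bijOn (swA N a b c d) ?_ ?_
  · refine Set.InvOn.bijOn (f' := swA N a b c d)
      ⟨fun P _ => swA_swA N a b c d P, fun P _ => swA_swA N a b c d P⟩ ?_ ?_
    · intro P hP; exact YtoX ha hc hB hP
    · intro P hP; exact XtoY ha hc hB hP.1 hP.2
  · intro P hP
    rw [tot_swA hP.1.fs (YtoX ha hc hB hP).1.1.fs]

theorem Conf_rst {N i : ℕ} {p q : ℤ → ℤ} {P Q : ℕ → ℤ → ℤ} (hP : Val N P) (hQ : Val N Q)
    (hi : i + 2 ≤ N) (h : rst i P Q) : P ∈ Conf N p q ↔ Q ∈ Conf N p q := by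
  obtain ⟨R, -, -, rfl⟩ := h
  unfold Conf
  simp only [Set.mem_ofPred_eq, hP, hQ, true_and]
  rw [rse_lvl (by omega), rse_lvl (by omega)]

theorem ZZ_rst {i : ℕ} {P Q : ℕ → ℤ → ℤ} (hP : Val N P) (hQ : Val N Q)
    (hi : i + 2 ≤ N) (h : rst i P Q) : P ∈ ZZ N a b c d ↔ Q ∈ ZZ N a b c d := by
  unfold ZZ
  simp only [Set.mem_ofPred_eq]
  have hX : P ∈ XX N a b c d ↔ Q ∈ XX N a b c d := Conf_rst hP hQ hi h
  have pos : ∀ P ∈ XX N a b c d, ∀ s, S0 N a b c d s → posP P s := by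
    rintro P ⟨-, h0, hN⟩ ⟨l, t⟩ (⟨h1, h2⟩ | ⟨h1, h2⟩)
    · simp only at h1 h2; subst h1; unfold posP; simp only [h0, ilv_even, ilv_odd]; omega
    · simp only at h1 h2; subst h1; unfold posP; simp only [hN, ilv_even, ilv_odd]; omega
  have lv : ∀ s, S0 N a b c d s → s.2 = 0 ∨ s.2 = N := fun s h => h.imp And.left And.left
  have lk : ∀ s, K0 N a b c d s → s.2 = 0 ∨ s.2 = N := fun s h => h.imp And.left And.left
  constructor
  · rintro ⟨h1, s, y, hs, hy, h2⟩
    refine ⟨hX.1 h1, s, y, hs, hy, cnG_of_cnE ?_⟩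
    rw [← cn_rst hP hi h (lv s hs) (lk y hy)]
    exact cnE_of_cnG hP h2 (pos _ h1 _ hs)
  · rintro ⟨h1, s, y, hs, hy, h2⟩
    refine ⟨hX.2 h1, s, y, hs, hy, cnG_of_cnE ?_⟩
    rw [cn_rst hP hi h (lv s hs) (lk y hy)]
    exact cnE_of_cnG hQ h2 (pos _ h1 _ hs)
end

/-- complete homogeneous function evaluated at `y` -/
def hsv {σ R : Type*} [Fintype σ] [DecidableEq σ] [CommRing R] (y : σ → R) (n : ℕ) : R :=
  ∑ s : Sym σ n, ((s : Multiset σ).map y).prod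

theorem hsv_zero {σ R : Type*} [Fintype σ] [DecidableEq σ] [CommRing R] (y : σ → R) :
    hsv y 0 = 1 := by
  simp [hsv, Sym.eq_nil_of_card_zero]

theorem hsv_option {σ R : Type*} [Fintype σ] [DecidableEq σ] [CommRing R] (y : Option σ → R)
    (n : ℕ) : hsv y (n + 1) = y none * hsv y n + hsv (y ∘ some) (n + 1) := by
  unfold hsv
  rw [← (symOptionSuccEquiv (α := σ) (n := n)).symm.sum_comp, Fintype.sum_sum_type, Finset.mul_sum]
  congr 1
  · refine Finset.sum_congr rfl fun s _ => ?_
    change (Multiset.map y ((SymOptionSuccEquiv.decode (Sum.inl s) : Sym (Option σ) n.succ) : Multiset _)).prod = _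
    rw [SymOptionSuccEquiv.decode_inl]
    change (Multiset.map y (none ::ₘ (s : Multiset _))).prod = _
    rw [Multiset.map_cons, Multiset.prod_cons]
  · refine Finset.sum_congr rfl fun s _ => ?_
    change (Multiset.map y ((SymOptionSuccEquiv.decode (Sum.inr s) : Sym (Option σ) n.succ) : Multiset _)).prod = _
    rw [SymOptionSuccEquiv.decode_inr]
    simp

theorem hsv_equiv {σ τ R : Type*} [Fintype σ] [DecidableEq σ] [Fintype τ] [DecidableEq τ]
    [CommRing R] (e : σ ≃ τ) (y : τ → R) (n : ℕ) : hsv (y ∘ e) n = hsv y n := by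
  unfold hsv
  rw [← (Sym.equivCongr e : Sym σ n ≃ Sym τ n).sum_comp]
  refine Finset.sum_congr rfl fun s _ => ?_
  simp [Sym.equivCongr]

theorem hsv_fin {R : Type*} [CommRing R] (N : ℕ) (y : Fin (N + 1) → R)
    (n : ℕ) : hsv y (n + 1) = y (Fin.last N) * hsv y n + hsv (y ∘ Fin.castSucc) (n + 1) := by
  have := hsv_option (y ∘ (finSuccEquivLast (n := N)).symm) n
  rw [hsv_equiv, hsv_equiv] at this
  have e1 : (y ∘ (finSuccEquivLast (n := N)).symm) none = y (Fin.last N) := by simp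
  have e2 : (y ∘ (finSuccEquivLast (n := N)).symm) ∘ some = y ∘ Fin.castSucc := by funext i; simp
  rw [this, e1, e2]

section
variable {R : Type*} [CommRing R] (x : ℕ → R)

def HH (N : ℕ) (m : ℤ) : R := if 0 ≤ m then hsv (fun i : Fin N => x i) m.toNat else 0

theorem HH_neg (N : ℕ) {m : ℤ} (h : m < 0) : HH x N m = 0 := if_neg (not_le.2 h)

theorem HH_zero (m : ℤ) : HH x 0 m = if m = 0 then 1 else 0 := by
  unfold HH
  rcases lt_trichotomy m 0 with h | rfl | h
  · rw [if_neg (not_le.2 h), if_neg h.ne]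
  · simp [hsv_zero]
  · rw [if_pos h.le, if_neg h.ne']
    obtain ⟨n, hn⟩ : ∃ n, m.toNat = n + 1 := ⟨m.toNat - 1, by omega⟩
    rw [hn]
    unfold hsv
    exact Finset.sum_eq_zero fun s _ => by
      have : IsEmpty (Sym (Fin 0) (n + 1)) := inferInstance
      exact this.elim s

theorem HH_succ (N : ℕ) (m : ℤ) : HH x (N + 1) m = HH x N m + x N * HH x (N + 1) (m - 1) := by
  rcases lt_trichotomy m 0 with h | rfl | h
  · rw [HH_neg x _ h, HH_neg x _ h, HH_neg x _ (by omega)]; ring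
  · rw [HH_neg x _ (by omega : (0 : ℤ) - 1 < 0)]; simp [HH, hsv_zero]
  · unfold HH
    rw [if_pos h.le, if_pos h.le, if_pos (by omega)]
    obtain ⟨n, rfl⟩ : ∃ n : ℕ, m = n + 1 := ⟨m.toNat - 1, by omega⟩
    rw [show ((n : ℤ) + 1).toNat = n + 1 by omega, show ((n : ℤ) + 1 - 1).toNat = n by omega,
      hsv_fin, add_comm]
    congr 1

theorem HH_exp (N : ℕ) (c a b : ℤ) (h : a ≤ b) : HH x (N + 1) (b - c) =
    ∑ m ∈ Finset.Ioc a b, x N ^ (b - m).toNat * HH x N (m - c)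
      + x N ^ (b - a).toNat * HH x (N + 1) (a - c) := by
  induction b, h using Int.leInduction with
  | base => simp
  | succ b hb ih =>
    rw [HH_succ, show b + 1 - c - 1 = b - c by ring, ih]
    have e : Finset.Ioc a (b + 1) = insert (b + 1) (Finset.Ioc a b) := by
      ext z; simp only [Finset.mem_insert, Finset.mem_Ioc]; omega
    rw [e, Finset.sum_insert (by simp), mul_add, Finset.mul_sum]
    have e2 : ∀ m ∈ Finset.Ioc a b, x N * (x N ^ (b - m).toNat * HH x N (m - c)) =
        x N ^ (b + 1 - m).toNat * HH x N (m - c) := by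
      intro m hm
      simp only [Finset.mem_Ioc] at hm
      rw [show (b + 1 - m).toNat = (b - m).toNat + 1 by omega]; ring
    rw [Finset.sum_congr rfl e2, show (b + 1 - a).toNat = (b - a).toNat + 1 by omega]
    simp; ring

/-- determinant -/
def DH (N k : ℕ) (p q : ℤ → ℤ) : R :=
  Matrix.det (Matrix.of fun i j : Fin k => HH x N (p (i : ℕ) - q (j : ℕ)))

theorem DH_congr {N k : ℕ} {p p' q : ℤ → ℤ} (h : ∀ i : Fin k, p (i : ℕ) = p' (i : ℕ)) :
    DH x N k p q = DH x N k p' q := by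
  unfold DH; simp only [h]

theorem DH_step (N k : ℕ) {p q : ℤ → ℤ} (hp : StrictMono p) (h : ∀ j : ℕ, p (-1) < q j) :
    DH x (N + 1) k p q =
      ∑ κ ∈ Fintype.piFinset (fun i : Fin k => Finset.Ioc (p ((i : ℕ) - 1)) (p (i : ℕ))),
        (∏ i : Fin k, x N ^ (p (i : ℕ) - κ i).toNat) *
          Matrix.det (Matrix.of fun i j : Fin k => HH x N (κ i - q (j : ℕ))) := by
  have key : DH x (N + 1) k p q = Matrix.det (Matrix.of fun i j : Fin k =>
      ∑ m ∈ Finset.Ioc (p ((i : ℕ) - 1)) (p (i : ℕ)), x N ^ (p (i : ℕ) - m).toNat *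
        HH x N (m - q (j : ℕ))) := by
    cases k with
    | zero => unfold DH; simp
    | succ k =>
      refine Matrix.det_eq_of_forall_row_eq_smul_add_pred
        (fun i => x N ^ (p ((i : ℕ) + 1) - p (i : ℕ)).toNat) (fun j => ?_) (fun i j => ?_)
      · simp only [Matrix.of_apply]
        rw [HH_exp x N _ _ _ (hp.monotone (show (((0 : Fin (k + 1)) : ℕ) : ℤ) - 1 ≤ _ by omega)),
          HH_neg x _ (m := _ - _), mul_zero, add_zero]
        have := h j
        simp
        omega
      · simp only [Matrix.of_apply]
        rw [HH_exp x N _ _ _ (hp.monotone (show ((i.succ : ℕ) : ℤ) - 1 ≤ _ by omega))]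
        simp
  rw [key]
  have e : (Matrix.of fun i j : Fin k =>
      ∑ m ∈ Finset.Ioc (p ((i : ℕ) - 1)) (p (i : ℕ)), x N ^ (p (i : ℕ) - m).toNat *
        HH x N (m - q (j : ℕ))) = fun i : Fin k =>
      ∑ m ∈ Finset.Ioc (p ((i : ℕ) - 1)) (p (i : ℕ)), x N ^ (p (i : ℕ) - m).toNat •
        (fun j : Fin k => HH x N (m - q (j : ℕ))) := by
    funext i j
    simp [Finset.sum_apply]
  rw [e]
  change (Matrix.detRowAlternating (R := R)).toMultilinearMap (fun i : Fin k =>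
      ∑ m ∈ Finset.Ioc (p ((i : ℕ) - 1)) (p (i : ℕ)), x N ^ (p (i : ℕ) - m).toNat •
        (fun j : Fin k => HH x N (m - q (j : ℕ)))) = _
  rw [MultilinearMap.map_sum_finset]
  refine Finset.sum_congr rfl fun κ _ => ?_
  rw [MultilinearMap.map_smul_univ]
  rfl

theorem DH_zero (k : ℕ) {p q : ℤ → ℤ} (hp : StrictMono p) (hq : StrictMono q) :
    DH x 0 k p q = if ∀ i : Fin k, p (i : ℕ) = q (i : ℕ) then 1 else 0 := by
  unfold DH
  simp only [HH_zero]
  have mp : StrictMono (fun i : Fin k => p (i : ℕ)) := fun i j h => hp (by exact_mod_cast h)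
  have mq : StrictMono (fun i : Fin k => q (i : ℕ)) := fun i j h => hq (by exact_mod_cast h)
  split_ifs with h
  · have : (Matrix.of fun i j : Fin k => if p (i : ℕ) - q (j : ℕ) = 0 then (1 : R) else 0) = 1 := by
      ext i j
      simp only [Matrix.of_apply, Matrix.one_apply]
      refine if_congr ?_ rfl rfl
      rw [h i, sub_eq_zero]
      exact mq.injective.eq_iff
    rw [this, Matrix.det_one]
  · by_contra hne
    apply h
    have hex : ∀ i : Fin k, ∃ j : Fin k, p (i : ℕ) = q (j : ℕ) := by
      intro i
      by_contra hc
      push Not at hc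
      refine hne (Matrix.det_eq_zero_of_row_eq_zero i fun j => ?_)
      simp only [Matrix.of_apply]
      rw [if_neg (sub_ne_zero.2 (hc j))]
    choose σ hσ using hex
    have inj : Function.Injective σ := by
      intro i j hij
      apply mp.injective
      simp only [hσ, hij]
    have sur := Finite.surjective_of_injective inj
    have : Set.range (fun i : Fin k => p (i : ℕ)) = Set.range (fun i : Fin k => q (i : ℕ)) := by
      ext z
      constructor
      · rintro ⟨i, rfl⟩; exact ⟨σ i, (hσ i).symm⟩
      · rintro ⟨j, rfl⟩
        obtain ⟨i, rfl⟩ := sur j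
        exact ⟨i, hσ i⟩
    have := (mp.range_inj mq).1 this
    exact fun i => congrFun this i
end

/-- the variables, as a sequence -/
noncomputable def xv (N : ℕ) : ℕ → MvPolynomial (Fin N) ℤ :=
  fun i => if h : i < N then MvPolynomial.X ⟨i, h⟩ else 0

theorem HH_homog (N : ℕ) (m : ℤ) : HH (xv N) N m = homog N m := by
  unfold HH homog
  split_ifs with h
  · unfold hsv MvPolynomial.hsymm
    refine Finset.sum_congr rfl fun s _ => ?_
    congr 2
    funext i
    simp [xv]
  · rfl

/-- row coordinates -/
def pl (k : ℕ) (M : ℕ) (lam : ℕ → ℕ) (l : ℤ) : ℤ :=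
  (if l < k then ((lam ((k : ℤ) - 1 - l).toNat : ℕ) : ℤ) else M) + l

theorem skew_DH (N k M : ℕ) (lam mu : ℕ → ℕ) :
    skewSchur N k lam mu = DH (xv N) N k (pl k M lam) (pl k M mu) := by
  unfold skewSchur DH
  rw [← Matrix.det_submatrix_equiv_self (Fin.revPerm (n := k))]
  congr 1
  ext i j
  have e : ∀ i : Fin k, ((k : ℤ) - 1 - (i : ℕ)).toNat = k - 1 - i := by intro i; omega
  have e2 : ∀ i : Fin k, ((i : ℕ) : ℤ) < k := by intro i; omega
  simp only [Matrix.submatrix_apply, Matrix.of_apply, HH_homog, pl, e, e2, if_true]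
  congr 2
  simp only [Fin.revPerm_apply, Fin.val_rev]
  have e3 : ∀ i : Fin k, k - (i + 1) = k - 1 - i := by intro i; omega
  rw [e3 i, e3 j]
  have h1 := i.2
  have h2 := j.2
  omega

theorem pl_out {k M : ℕ} {lam mu : ℕ → ℕ} (h1 : ∀ j, k ≤ j → lam j = 0)
    (h2 : ∀ j, k ≤ j → mu j = 0) {l : ℤ} (h : l < 0 ∨ k ≤ l) : pl k M lam l = pl k M mu l := by
  unfold pl
  split_ifs with hk
  · rw [h1 _ (by omega), h2 _ (by omega)]
  · rfl

theorem pl_neg {k M : ℕ} {lam : ℕ → ℕ} (h1 : ∀ j, k ≤ j → lam j = 0) {l : ℤ} (h : l < 0) :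
    pl k M lam l = l := by
  unfold pl
  rw [if_pos (by omega), h1 _ (by omega)]; simp

theorem pl_ge {k M : ℕ} {lam : ℕ → ℕ} (l : ℤ) : l ≤ pl k M lam l := by
  unfold pl; split_ifs <;> omega

theorem pl_strict {k M : ℕ} {lam : ℕ → ℕ} (ha : Antitone lam) (hM : lam 0 ≤ M) :
    StrictMono (pl k M lam) := by
  refine strictMono_int_of_lt_succ fun l => ?_
  unfold pl
  split_ifs with h1 h2
  · have := ha (show ((k : ℤ) - 1 - (l + 1)).toNat ≤ ((k : ℤ) - 1 - l).toNat by omega)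
    omega
  · have := ha (Nat.zero_le (((k : ℤ) - 1 - l).toNat))
    omega
  · omega
  · omega

theorem pl_le {k M : ℕ} {lam mu : ℕ → ℕ} (h : ∀ i, mu i ≤ lam i) (l : ℤ) :
    pl k M mu l ≤ pl k M lam l := by
  unfold pl; split_ifs
  · have := h ((k : ℤ) - 1 - l).toNat; omega
  · omega

theorem pl_max {k M : ℕ} (lam mu : ℕ → ℕ) :
    pl k M (fun i => max (lam i) (mu i)) = fun l => max (pl k M lam l) (pl k M mu l) := by
  funext l; unfold pl; split_ifs <;> (try dsimp only) <;> omega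
theorem pl_min {k M : ℕ} (lam mu : ℕ → ℕ) :
    pl k M (fun i => min (lam i) (mu i)) = fun l => min (pl k M lam l) (pl k M mu l) := by
  funext l; unfold pl; split_ifs <;> (try dsimp only) <;> omega

/-- chains of interlacing row vectors -/
def Ch (N : ℕ) (p q : ℤ → ℤ) : Set (ℕ → ℤ → ℤ) :=
  {C | (∀ t l, C t l ≤ C (t + 1) l) ∧ (∀ t l, C (t + 1) l < C t (l + 1)) ∧
    (∀ t, N ≤ t → C t = C N) ∧ C 0 = q ∧ C N = p}

theorem Ch_mono {N : ℕ} {p q : ℤ → ℤ} {C : ℕ → ℤ → ℤ} (h : C ∈ Ch N p q) {s t : ℕ} (hst : s ≤ t)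
    (l : ℤ) : C s l ≤ C t l := by
  induction t, hst using Nat.le_induction with
  | base => exact le_rfl
  | succ t _ ih => exact ih.trans (h.1 t l)

def sm (k : ℕ) (f : ℤ → ℤ) : ℤ := ∑ i : Fin k, f (i : ℕ)

def wtC {R : Type*} [CommRing R] (x : ℕ → R) (N k : ℕ) (C : ℕ → ℤ → ℤ) : R :=
  ∏ t ∈ Finset.range N, x t ^ (sm k (C (t + 1)) - sm k (C t)).toNat

def extq (k : ℕ) (q : ℤ → ℤ) (κ : Fin k → ℤ) (l : ℤ) : ℤ :=
  if h : 0 ≤ l ∧ l < k then κ ⟨l.toNat, by omega⟩ else q l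

theorem extq_fin {k : ℕ} (q : ℤ → ℤ) (κ : Fin k → ℤ) (i : Fin k) : extq k q κ (i : ℕ) = κ i := by
  unfold extq
  rw [dif_pos (by have := i.2; omega)]
  congr 1

theorem extq_out {k : ℕ} (q : ℤ → ℤ) (κ : Fin k → ℤ) {l : ℤ} (h : l < 0 ∨ k ≤ l) :
    extq k q κ l = q l := by
  unfold extq
  rw [dif_neg (by omega)]

theorem fin_or_out (k : ℕ) (l : ℤ) : (∃ i : Fin k, l = (i : ℕ)) ∨ (l < 0 ∨ k ≤ l) := by
  by_cases h : 0 ≤ l ∧ l < k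
  · exact Or.inl ⟨⟨l.toNat, by omega⟩, by simp; omega⟩
  · right; omega

def insT (N : ℕ) (p : ℤ → ℤ) (C : ℕ → ℤ → ℤ) : ℕ → ℤ → ℤ := fun t => if t ≤ N then C t else p

theorem insT_le {N : ℕ} {p : ℤ → ℤ} {C : ℕ → ℤ → ℤ} {t : ℕ} (h : t ≤ N) : insT N p C t = C t :=
  if_pos h
theorem insT_gt {N : ℕ} {p : ℤ → ℤ} {C : ℕ → ℤ → ℤ} {t : ℕ} (h : N < t) : insT N p C t = p :=
  if_neg (not_le.2 h)

theorem Ch_succ (N k : ℕ) {p q : ℤ → ℤ} (hp : StrictMono p)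
    (ho : ∀ l : ℤ, l < 0 ∨ k ≤ l → p l = q l) :
    Ch (N + 1) p q = ⋃ κ ∈ (↑(Fintype.piFinset (fun i : Fin k =>
      Finset.Ioc (p ((i : ℕ) - 1)) (p (i : ℕ)))) : Set (Fin k → ℤ)),
        insT N p '' Ch N (extq k q κ) q := by
  ext C
  simp only [Set.mem_iUnion, Finset.mem_coe, Fintype.mem_piFinset, Finset.mem_Ioc, exists_prop]
  constructor
  · intro hC
    obtain ⟨h1, h2, h3, h4, h5⟩ := id hC
    refine ⟨fun i => C N (i : ℕ), fun i => ⟨?_, ?_⟩, fun t => C (min t N),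
      ⟨fun t l => Ch_mono hC (by omega) l, fun t l => ?_, fun t ht => ?_, ?_, ?_⟩, ?_⟩
    · have := h2 N ((i : ℕ) - 1)
      rw [h5, sub_add_cancel] at this; exact this
    · have := h1 N (i : ℕ); rw [h5] at this; exact this
    · refine lt_of_le_of_lt ?_ (h2 (min t N) l)
      exact Ch_mono hC (by omega) l
    · simp only; rw [min_eq_right ht, min_self]
    · simpa using h4
    · simp only [min_self]
      funext l
      rcases fin_or_out k l with ⟨i, rfl⟩ | h
      · rw [extq_fin]
      · rw [extq_out _ _ h]
        have a := Ch_mono hC (Nat.zero_le N) l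
        have b := h1 N l
        rw [h4] at a; rw [h5, ho l h] at b
        omega
    · funext t
      by_cases ht : t ≤ N
      · rw [insT_le ht, min_eq_left ht]
      · rw [insT_gt (not_le.1 ht), h3 t (by omega), h5]
  · rintro ⟨κ, hκ, C, ⟨h1, h2, h3, h4, h5⟩, rfl⟩
    have le : ∀ l, extq k q κ l ≤ p l := by
      intro l
      rcases fin_or_out k l with ⟨i, rfl⟩ | h
      · rw [extq_fin]; exact (hκ i).2
      · rw [extq_out _ _ h, ho l h]
    have lt : ∀ l, p l < extq k q κ (l + 1) := by
      intro l
      rcases fin_or_out k (l + 1) with ⟨i, hi⟩ | h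
      · rw [hi, extq_fin]
        have := (hκ i).1
        rwa [← hi, add_sub_cancel_right] at this
      · rw [extq_out _ _ h, ← ho _ h]; exact hp (by omega)
    refine ⟨fun t l => ?_, fun t l => ?_, fun t ht => ?_, ?_, ?_⟩
    · rcases lt_trichotomy t N with h | rfl | h
      · rw [insT_le h.le, insT_le h]; exact h1 t l
      · rw [insT_le le_rfl, insT_gt (by omega), h5]; exact le l
      · rw [insT_gt h, insT_gt (by omega)]
    · rcases lt_trichotomy t N with h | rfl | h
      · rw [insT_le h.le, insT_le h]; exact h2 t l
      · rw [insT_le le_rfl, insT_gt (by omega), h5]; exact lt l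
      · rw [insT_gt h, insT_gt (by omega)]; exact hp (by omega)
    · rw [insT_gt (by omega), insT_gt (by omega)]
    · rw [insT_le (by omega), h4]
    · rw [insT_gt (by omega)]

theorem wtC_insT {R : Type*} [CommRing R] (x : ℕ → R) (N k : ℕ) {p q : ℤ → ℤ} {κ : Fin k → ℤ}
    (hκ : ∀ i, κ i ≤ p (i : ℕ)) {C : ℕ → ℤ → ℤ} (h5 : C N = extq k q κ) :
    wtC x (N + 1) k (insT N p C) = (∏ i : Fin k, x N ^ (p (i : ℕ) - κ i).toNat) * wtC x N k C := by
  unfold wtC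
  rw [Finset.prod_range_succ, mul_comm]
  congr 1
  · rw [insT_le le_rfl, insT_gt (by omega), h5, Finset.prod_pow_eq_pow_sum]
    congr 1
    unfold sm
    zify
    rw [← Finset.sum_sub_distrib, Int.toNat_of_nonneg]
    · refine Finset.sum_congr rfl fun i _ => ?_
      rw [extq_fin, Int.toNat_of_nonneg (by linarith [hκ i])]
    · refine Finset.sum_nonneg fun i _ => ?_
      rw [extq_fin]; linarith [hκ i]
  · refine Finset.prod_congr rfl fun t ht => ?_
    rw [Finset.mem_range] at ht
    rw [insT_le ht.le, insT_le ht]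

theorem DH_chain {R : Type*} [CommRing R] (x : ℕ → R) (N k : ℕ) {p q : ℤ → ℤ} (hp : StrictMono p)
    (hq : StrictMono q) (ho : ∀ l : ℤ, l < 0 ∨ k ≤ l → p l = q l) :
    (Ch N p q).Finite ∧ DH x N k p q = ∑ᶠ C ∈ Ch N p q, wtC x N k C := by
  classical
  induction N generalizing p with
  | zero =>
    rw [DH_zero x k hp hq]
    by_cases h : ∀ i : Fin k, p (i : ℕ) = q (i : ℕ)
    · have e : p = q := by
        funext l
        rcases fin_or_out k l with ⟨i, rfl⟩ | h'
        · exact h i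
        · exact ho l h'
      have e2 : Ch 0 p q = {fun _ => q} := by
        ext C
        simp only [Set.mem_singleton_iff]
        constructor
        · rintro ⟨h1, h2, h3, h4, h5⟩
          funext t
          rw [h3 t (by omega), h4]
        · rintro rfl
          exact ⟨fun _ _ => le_rfl, fun _ l => hq (by omega), fun _ _ => rfl, rfl, e.symm⟩
      rw [if_pos h, e2, finsum_mem_singleton]
      refine ⟨Set.finite_singleton _, ?_⟩
      simp [wtC]
    · have e2 : Ch 0 p q = ∅ := by
        ext C
        simp only [Set.mem_empty_iff_false, iff_false]
        rintro ⟨h1, h2, h3, h4, h5⟩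
        exact h fun i => by rw [← h4, ← h5]
      rw [if_neg h, e2]; simp
  | succ N ih =>
    have hpi : ∀ κ ∈ Fintype.piFinset (fun i : Fin k =>
        Finset.Ioc (p ((i : ℕ) - 1)) (p (i : ℕ))), StrictMono (extq k q κ) := by
      intro κ hκ
      simp only [Fintype.mem_piFinset, Finset.mem_Ioc] at hκ
      refine strictMono_int_of_lt_succ fun l => ?_
      have le : extq k q κ l ≤ p l := by
        rcases fin_or_out k l with ⟨i, rfl⟩ | h
        · rw [extq_fin]; exact (hκ i).2
        · rw [extq_out _ _ h, ho l h]
      refine le.trans_lt ?_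
      rcases fin_or_out k (l + 1) with ⟨i, hi⟩ | h
      · rw [hi, extq_fin]
        have := (hκ i).1
        rwa [← hi, add_sub_cancel_right] at this
      · rw [extq_out _ _ h, ← ho _ h]; exact hp (by omega)
    have IH := fun κ hκ => ih (hpi κ hκ) (fun l h => extq_out q κ h)
    have hf : ∀ κ ∈ (↑(Fintype.piFinset (fun i : Fin k =>
        Finset.Ioc (p ((i : ℕ) - 1)) (p (i : ℕ)))) : Set (Fin k → ℤ)),
        (insT N p '' Ch N (extq k q κ) q).Finite := fun κ hκ => (IH κ hκ).1.image _
    have hI := (Fintype.piFinset (fun i : Fin k =>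
        Finset.Ioc (p ((i : ℕ) - 1)) (p (i : ℕ)))).finite_toSet
    rw [Ch_succ N k hp ho]
    refine ⟨hI.biUnion hf, ?_⟩
    rw [finsum_mem_biUnion _ hI hf, finsum_mem_coe_finset, DH_step x N k hp]
    · refine Finset.sum_congr rfl fun κ hκ => ?_
      rw [finsum_mem_image]
      · have e : Matrix.det (Matrix.of fun i j : Fin k => HH x N (κ i - q (j : ℕ))) =
            DH x N k (extq k q κ) q := by
          unfold DH; simp only [extq_fin]
        rw [e, (IH κ hκ).2, mul_finsum_mem' _ _ (IH κ hκ).1]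
        refine finsum_mem_congr rfl fun C hC => ?_
        simp only [Fintype.mem_piFinset, Finset.mem_Ioc] at hκ
        rw [wtC_insT x N k (fun i => (hκ i).2) hC.2.2.2.2]
      · intro C hC D hD h
        funext t
        have hs : ∀ t ≤ N, C t = D t := by
          intro t ht
          have := congrFun h t
          rwa [insT_le ht, insT_le ht] at this
        by_cases ht : t ≤ N
        · exact hs t ht
        · rw [hC.2.2.1 t (by omega), hD.2.2.1 t (by omega), hs N le_rfl]
    · intro j
      rw [ho (-1) (by omega)]; exact hq (by omega)
    · intro κ _ κ' _ hne
      refine Set.disjoint_left.2 ?_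
      rintro _ ⟨C, hC, rfl⟩ ⟨D, hD, h⟩
      apply hne
      have h1 := congrFun h N
      rw [insT_le le_rfl, insT_le le_rfl, hC.2.2.2.2, hD.2.2.2.2] at h1
      funext i
      have := congrFun h1 (i : ℕ)
      rw [extq_fin, extq_fin] at this
      exact this.symm

theorem Ch_out {N k : ℕ} {p q : ℤ → ℤ} (ho : ∀ l : ℤ, l < 0 ∨ k ≤ l → p l = q l)
    {C : ℕ → ℤ → ℤ} (hC : C ∈ Ch N p q) (t : ℕ) {l : ℤ} (h : l < 0 ∨ k ≤ l) : C t l = q l := by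
  obtain ⟨h1, h2, h3, h4, h5⟩ := id hC
  have a := Ch_mono hC (Nat.zero_le t) l
  have b := Ch_mono hC (show t ≤ max t N by omega) l
  rw [h3 (max t N) (by omega), h5, ho l h] at b
  rw [h4] at a
  omega

theorem Conf_eq (N k : ℕ) {a b c d : ℤ → ℤ} (hab : ∀ l : ℤ, l < 0 ∨ k ≤ l → a l = b l)
    (hcd : ∀ l : ℤ, l < 0 ∨ k ≤ l → c l = d l) :
    Conf N (ilv c a) (ilv d b) =
      (fun z : (ℕ → ℤ → ℤ) × (ℕ → ℤ → ℤ) => fun t => ilv (z.2 t) (z.1 t)) ''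
        (Ch N a b ×ˢ Ch N c d) := by
  ext P
  constructor
  · rintro ⟨hV, h0, hN⟩
    refine ⟨(fun t l => P t (2 * l + 1), fun t l => P t (2 * l)), ⟨⟨fun t l => hV.mono t _,
      fun t l => ?_, fun t ht => ?_, ?_, ?_⟩, ⟨fun t l => hV.mono t _,
      fun t l => ?_, fun t ht => ?_, ?_, ?_⟩⟩, ?_⟩
    · have := hV.inter t (2 * l + 1)
      rwa [show 2 * l + 1 + 2 = 2 * (l + 1) + 1 by ring] at this
    · simp only [hV.stab t ht]
    · simp only [h0, ilv_odd]
    · simp only [hN, ilv_odd]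
    · have := hV.inter t (2 * l)
      rwa [show 2 * l + 2 = 2 * (l + 1) by ring] at this
    · simp only [hV.stab t ht]
    · simp only [h0, ilv_even]
    · simp only [hN, ilv_even]
    · funext t
      exact (eq_ilv fun l => ⟨rfl, rfl⟩).symm
  · rintro ⟨⟨C, D⟩, ⟨hC, hD⟩, rfl⟩
    have oC := fun t l => Ch_out hab hC t (l := l)
    have oD := fun t l => Ch_out hcd hD t (l := l)
    obtain ⟨h1, h2, h3, h4, h5⟩ := hC
    obtain ⟨g1, g2, g3, g4, g5⟩ := hD
    simp only at *
    refine ⟨⟨fun t j => ?_, fun t j => ?_, fun t ht => ?_, ?_⟩, ?_, ?_⟩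
    · refine even_odd_ind (p := fun j => ilv (D t) (C t) j ≤ ilv (D (t + 1)) (C (t + 1)) j)
        (fun l => ?_) j
      simp only [ilv_even, ilv_odd]
      exact ⟨g1 t l, h1 t l⟩
    · refine even_odd_ind (p := fun j => ilv (D (t + 1)) (C (t + 1)) j < ilv (D t) (C t) (j + 2))
        (fun l => ?_) j
      rw [show 2 * l + 2 = 2 * (l + 1) by ring, show 2 * l + 1 + 2 = 2 * (l + 1) + 1 by ring]
      simp only [ilv_even, ilv_odd]
      exact ⟨g2 t l, h2 t l⟩
    · simp only [h3 t ht, g3 t ht]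
    · refine ⟨2 * k + 2, fun t j => ?_⟩
      refine even_odd_ind (p := fun j => (2 * k + 2 : ℤ) < |j| → ilv (D t) (C t) j =
        ilv (D 0) (C 0) j) (fun l => ⟨fun h => ?_, fun h => ?_⟩) j
      · simp only [ilv_even]
        have : l < 0 ∨ k ≤ l := by
          rcases abs_cases (2 * l) with ⟨e, _⟩ | ⟨e, _⟩ <;> omega
        rw [oD t l this, oD 0 l this]
      · simp only [ilv_odd]
        have : l < 0 ∨ k ≤ l := by
          rcases abs_cases (2 * l + 1) with ⟨e, _⟩ | ⟨e, _⟩ <;> omega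
        rw [oC t l this, oC 0 l this]
    · simp only [h4, g4]
    · simp only [h5, g5]

/-- weight as a function of the row totals -/
def GW {R : Type*} [CommRing R] (x : ℕ → R) (N : ℕ) (τ : ℕ → ℤ) : R :=
  ∏ t ∈ Finset.range N, x t ^ (τ (t + 1) - τ t).toNat

theorem tot_ilv {N k : ℕ} {a b c d : ℤ → ℤ} (hab : ∀ l : ℤ, l < 0 ∨ k ≤ l → a l = b l)
    (hcd : ∀ l : ℤ, l < 0 ∨ k ≤ l → c l = d l) {C D : ℕ → ℤ → ℤ} (hC : C ∈ Ch N a b)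
    (hD : D ∈ Ch N c d) (t : ℕ) : tot (fun t => ilv (D t) (C t)) t =
      (sm k (C t) - sm k (C 0)) + (sm k (D t) - sm k (D 0)) := by
  have hV : (fun t => ilv (D t) (C t)) ∈ Conf N (ilv c a) (ilv d b) := by
    rw [Conf_eq N k hab hcd]; exact ⟨(C, D), ⟨hC, hD⟩, rfl⟩
  rw [tot_pair hV.1.fs]
  simp only [loP, hiP, min_add_max, ilv_even, ilv_odd]
  rw [finsum_eq_sum_of_support_subset (s := Finset.univ.image fun i : Fin k => ((i : ℕ) : ℤ)),
    Finset.sum_image]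
  · simp only [sm, Finset.sum_sub_distrib, Finset.sum_add_distrib]; ring
  · intro i _ j _ h
    simpa [Fin.ext_iff] using h
  · intro l hl
    rcases fin_or_out k l with ⟨i, rfl⟩ | h
    · simp
    · exfalso
      apply hl
      simp only [Ch_out hab hC _ h, Ch_out hcd hD _ h]; ring

theorem prod_DH {R : Type*} [CommRing R] (x : ℕ → R) (N k : ℕ) {a b c d : ℤ → ℤ}
    (ha : StrictMono a) (hb : StrictMono b) (hc : StrictMono c) (hd : StrictMono d)
    (hab : ∀ l : ℤ, l < 0 ∨ k ≤ l → a l = b l) (hcd : ∀ l : ℤ, l < 0 ∨ k ≤ l → c l = d l) :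
    (Conf N (ilv c a) (ilv d b)).Finite ∧
    DH x N k a b * DH x N k c d = ∑ᶠ P ∈ Conf N (ilv c a) (ilv d b), GW x N (tot P) := by
  classical
  obtain ⟨f1, e1⟩ := DH_chain x N k ha hb hab
  obtain ⟨f2, e2⟩ := DH_chain x N k hc hd hcd
  rw [Conf_eq N k hab hcd]
  refine ⟨(f1.prod f2).image _, ?_⟩
  rw [finsum_mem_image]
  · have hs : Ch N a b ×ˢ Ch N c d = ↑(f1.toFinset ×ˢ f2.toFinset) := by simp
    rw [hs, finsum_mem_coe_finset, Finset.sum_product, e1, e2,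
      finsum_mem_eq_finite_toFinset_sum _ f1, finsum_mem_eq_finite_toFinset_sum _ f2,
      Finset.sum_mul_sum]
    refine Finset.sum_congr rfl fun C hC => Finset.sum_congr rfl fun D hD => ?_
    rw [Set.Finite.mem_toFinset] at hC hD
    unfold wtC GW
    rw [← Finset.prod_mul_distrib]
    refine Finset.prod_congr rfl fun t _ => ?_
    rw [tot_ilv hab hcd hC hD, tot_ilv hab hcd hC hD, ← pow_add]
    congr 1
    have m1 : sm k (C t) ≤ sm k (C (t + 1)) := Finset.sum_le_sum fun i _ => hC.1 t _
    have m2 : sm k (D t) ≤ sm k (D (t + 1)) := Finset.sum_le_sum fun i _ => hD.1 t _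
    omega
  · rintro ⟨C, D⟩ _ ⟨C', D'⟩ _ h
    simp only at h
    have h' : ∀ t j, ilv (D t) (C t) j = ilv (D' t) (C' t) j := fun t j =>
      congrFun (congrFun h t) j
    ext t l
    · have := h' t (2 * l + 1); simpa only [ilv_odd] using this
    · have := h' t (2 * l); simpa only [ilv_even] using this

theorem reach_closed {N : ℕ} {S : Set (VV N)}
    (hS : ∀ i x y, (theC N).st i x y → (x ∈ S ↔ y ∈ S)) {x h : VV N}
    (hr : (theC N).Reach x h) : x ∈ S ↔ h ∈ S := by
  obtain ⟨w, hw⟩ := hr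
  induction w generalizing x with
  | nil => simp only [Crys.path] at hw; rw [hw]
  | cons i w ih =>
    obtain ⟨y, h1, h2⟩ := hw
    rw [hS i x y h1, ih h2]

theorem HW_EE {N : ℕ} {h : VV N} (hh : (theC N).HW h) {i : ℕ} (hi : i + 2 ≤ N) (j : ℤ) :
    EE i h.1 j ≤ 0 := by
  have e : mxv (EE i h.1) = 0 := hh ⟨i, hi⟩
  obtain ⟨R, h1, h2⟩ := h.2.exmax i
  rw [← e, h2]; exact h1 j

section
variable {N : ℕ} {p q : ℤ → ℤ}

/-- highest weight chain of a straight shape -/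
def Chw (N : ℕ) (p q : ℤ → ℤ) : ℕ → ℤ → ℤ := fun t l => if (N : ℤ) - l ≤ t then p l else q l

theorem Chw_mem (hp : StrictMono p) (hq : StrictMono q)
    (ho : ∀ l : ℤ, l < 0 ∨ N ≤ l → p l = q l) (hle : ∀ l, q l ≤ p l) : Chw N p q ∈ Ch N p q := by
  unfold Chw
  refine ⟨fun t l => ?_, fun t l => ?_, fun t ht => ?_, ?_, ?_⟩
  · have := hle l
    push_cast
    split_ifs <;> omega
  · have := hp (show l < l + 1 by omega)
    have := hq (show l < l + 1 by omega)
    push_cast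
    split_ifs <;> omega
  · funext l
    have := ho l
    simp only
    split_ifs
    · rfl
    · omega
    · exact (ho l (by omega)).symm
    · rfl
  · funext l
    dsimp only
    split_ifs with h
    · exact ho l (by simp at h; omega)
    · rfl
  · funext l
    dsimp only
    split_ifs with h
    · rfl
    · exact (ho l (by omega)).symm

theorem hw_unique_row (hp : StrictMono p) (hq : StrictMono q)
    (ho : ∀ l : ℤ, l < 0 ∨ N ≤ l → p l = q l) (hql : ∀ l : ℤ, l < N → q l = l)
    {h : VV N} (hh : (theC N).HW h) (hC : h.1 ∈ Conf N (ilv q p) (ilv q q)) :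
    h.1 = fun t => ilv q (Chw N p q t) := by
  obtain ⟨hV, h0, hN⟩ := id hC
  set P := h.1 with hPdef
  have ev : ∀ t l, P t (2 * l) = q l := by
    intro t l
    rw [hV.squeeze (by rw [h0, hN, ilv_even, ilv_even]), h0, ilv_even]
  have out : ∀ (t : ℕ) (l : ℤ), (l < 0 ∨ N ≤ l) → P t (2 * l + 1) = p l := by
    intro t l hl
    rw [hV.squeeze (by rw [h0, hN, ilv_odd, ilv_odd, ho l hl]), h0, ilv_odd, ho l hl]
  have lev : ∀ t l, N ≤ t → P t (2 * l + 1) = p l := by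
    intro t l hl
    rw [hV.stab t hl, hN, ilv_odd]
  have lae : ∀ i l, la i P (2 * l) = 0 := by
    intro i l
    unfold la
    rw [show 2 * l - 2 = 2 * (l - 1) by ring, ev, ev, ev]
    have := hq (show l - 1 < l by omega)
    omega
  have lbe : ∀ i l, lb i P (2 * l) = 0 := by
    intro i l
    unfold lb
    rw [show 2 * l + 2 = 2 * (l + 1) by ring, ev, ev, ev]
    have := hq (show l < l + 1 by omega)
    omega
  have upper : ∀ n : ℕ, ∀ l : ℤ, (N : ℤ) - n ≤ l → ∀ t : ℕ, (N : ℤ) - l ≤ t →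
      P t (2 * l + 1) = p l := by
    intro n
    induction n with
    | zero => intro l hl t _; exact out t l (by simp at hl; omega)
    | succ n ih =>
      intro l hl t ht
      rcases (show (N : ℤ) - n ≤ l ∨ l = N - (n + 1) by push_cast at hl; omega) with h1 | h1
      · exact ih l h1 t ht
      -- the new row
      have step : ∀ i : ℕ, i + 2 ≤ N → (N : ℤ) - l ≤ i + 1 →
          P (i + 1) (2 * l + 1) = P (i + 2) (2 * l + 1) := by
        intro i hi hil
        have zero : ∀ m : ℕ, EE i P (2 * (l + 1)) = EE i P (2 * (l + 1 + m)) := by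
          intro m
          induction m with
          | zero => simp
          | succ m ihm =>
            rw [ihm]
            set l' := l + 1 + (m : ℤ) with hl'
            rw [show 2 * (l + 1 + ((m + 1 : ℕ) : ℤ)) = 2 * l' + 1 + 1 by push_cast; omega]
            have d1 := EE_diff hV.fs i (2 * l')
            have d2 := EE_diff hV.fs i (2 * l' + 1)
            rw [lbe] at d1
            rw [show 2 * l' + 1 + 1 = 2 * (l' + 1) by ring, lae] at d2
            have e0 := ih l' (by omega) i (by omega)
            have e1 := ih l' (by omega) (i + 1) (by push_cast; omega)
            have e2 := ih l' (by omega) (i + 2) (by push_cast; omega)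
            have a := hV.la_nonneg i (2 * l' + 1)
            have b := hV.lb_nonneg i (2 * l' + 1)
            have a' : la i P (2 * l' + 1) ≤ 0 := by unfold la; omega
            have b' : lb i P (2 * l' + 1) ≤ 0 := by unfold lb; omega
            rw [show 2 * l' + 1 + 1 = 2 * (l' + 1) by ring]
            omega
        obtain ⟨B, hB, -⟩ := EE_big hV
        have z := zero (max B 0 - l).toNat
        rw [hB i (2 * (l + 1 + ((max B 0 - l).toNat : ℤ)))] at z
        · have d2 := EE_diff hV.fs i (2 * l + 1)
          rw [show 2 * l + 1 + 1 = 2 * (l + 1) by ring, lae, z] at d2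
          have := HW_EE hh hi (2 * l + 1)
          have b := hV.lb_nonneg i (2 * l + 1)
          have e0 := ih (l + 1) (by omega) i (by omega)
          have m1 := hV.mono (i + 1) (2 * l + 1)
          change _ ≤ P (i + 2) _ at m1
          have m2 := hV.mono' (show i + 2 ≤ N from hi) (2 * l + 1)
          rw [lev N l le_rfl] at m2
          have m3 := hp (show l < l + 1 by omega)
          unfold lb at d2
          rw [show 2 * l + 1 + 2 = 2 * (l + 1) + 1 by ring, e0] at d2
          rw [← hPdef] at this
          omega
        · omega
      have all : ∀ m : ℕ, ∀ t : ℕ, (N : ℤ) - l ≤ t → N ≤ t + m → P t (2 * l + 1) = p l := by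
        intro m
        induction m with
        | zero => intro t _ h2; exact lev t l h2
        | succ m ihm =>
          intro t h1 h2
          by_cases h3 : N ≤ t + m
          · exact ihm t h1 h3
          · by_cases h4 : N ≤ t
            · exact lev t l h4
            · have h5 := step (t - 1) (by omega) (by omega)
              rw [show t - 1 + 1 = t by omega, show t - 1 + 2 = t + 1 by omega] at h5
              rw [h5]
              exact ihm (t + 1) (by push_cast; omega) (by omega)
      exact all N t ht (by omega)
  have lower : ∀ t : ℕ, ∀ l, P t (2 * l + 1) + t ≤ q (l + t) := by
    intro t
    induction t with
    | zero => intro l; rw [h0, ilv_odd]; simp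
    | succ t ih =>
      intro l
      have a := hV.inter t (2 * l + 1)
      rw [show 2 * l + 1 + 2 = 2 * (l + 1) + 1 by ring] at a
      have b := ih (l + 1)
      rw [show l + 1 + (t : ℤ) = l + ((t + 1 : ℕ) : ℤ) by push_cast; ring] at b
      push_cast at *
      omega
  funext t
  refine eq_ilv fun l => ⟨ev t l, ?_⟩
  unfold Chw
  split_ifs with hc
  · exact upper ((N : ℤ) - l).toNat l (by omega) t hc
  · have a := lower t l
    have b := hV.mono' (Nat.zero_le t) (2 * l + 1)
    rw [h0, ilv_odd] at b
    rw [hql (l + t) (by omega)] at a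
    rw [hql l (by omega)] at b ⊢
    omega
end

theorem pl_zero {k M : ℕ} {l : ℤ} (h : l < k) : pl k M (fun _ => 0) l = l := by
  unfold pl; rw [if_pos h]; simp

/-- total of the highest weight element -/
theorem tot_Chw {N M : ℕ} {lam : ℕ → ℕ} (hz : ∀ j, N ≤ j → lam j = 0)
    (ha : Antitone lam) (hM : lam 0 ≤ M) (t : ℕ) :
    tot (fun t => ilv (pl N M (fun _ => 0)) (Chw N (pl N M lam) (pl N M (fun _ => 0)) t)) t =
      ((∑ r ∈ Finset.range t, lam r : ℕ) : ℤ) := by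
  have hp := pl_strict (k := N) ha hM
  have hq := pl_strict (k := N) (M := M) (lam := fun _ => 0) antitone_const (Nat.zero_le _)
  have ho : ∀ l : ℤ, l < 0 ∨ N ≤ l → pl N M lam l = pl N M (fun _ => 0) l :=
    fun l h => pl_out hz (fun _ _ => rfl) h
  have hle : ∀ l, pl N M (fun _ => 0) l ≤ pl N M lam l := pl_le fun _ => Nat.zero_le _
  have hC := Chw_mem hp hq ho hle
  have hD : (fun _ => pl N M (fun _ => 0)) ∈ Ch N (pl N M (fun _ => 0)) (pl N M (fun _ => 0)) :=
    ⟨fun _ _ => le_rfl, fun _ l => hq (by omega), fun _ _ => rfl, rfl, rfl⟩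
  rw [tot_ilv ho (fun _ _ => rfl) hC hD, sub_self, add_zero, hC.2.2.2.1]
  unfold sm
  rw [← Finset.sum_sub_distrib, ← Equiv.sum_comp (Fin.revPerm (n := N))]
  have e : ∀ i : Fin N, Chw N (pl N M lam) (pl N M (fun _ => 0)) t ((Fin.revPerm i : Fin N) : ℕ) -
      pl N M (fun _ => 0) ((Fin.revPerm i : Fin N) : ℕ) =
      if (i : ℕ) < t then ((lam i : ℕ) : ℤ) else 0 := by
    intro i
    have hi := i.2
    have e1 : (((Fin.revPerm i : Fin N) : ℕ) : ℤ) = N - 1 - (i : ℕ) := by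
      simp only [Fin.revPerm_apply, Fin.val_rev]; omega
    rw [e1]
    unfold Chw
    by_cases h : (i : ℕ) < t
    · rw [if_pos (by omega), if_pos h, pl_zero (by omega)]
      unfold pl
      rw [if_pos (by omega), show ((N : ℤ) - 1 - (N - 1 - (i : ℕ))).toNat = i by omega]
      ring
    · rw [if_neg (by omega), if_neg h, sub_self]
  rw [Finset.sum_congr rfl fun i _ => e i]
  rw [Fin.sum_univ_eq_sum_range (fun i => if i < t then ((lam i : ℕ) : ℤ) else 0) N]
  push_cast
  rw [← Finset.sum_filter]
  refine Finset.sum_subset_zero_on_sdiff ?_ ?_ (fun _ _ => rfl)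
  · intro i hi
    simp only [Finset.mem_filter, Finset.mem_range] at hi ⊢
    exact hi.2
  · intro i hi
    simp only [Finset.mem_sdiff, Finset.mem_filter, Finset.mem_range] at hi
    rw [hz i (by omega)]; rfl

theorem wt_step {N : ℕ} (i : II N) (x y : VV N) (h : (theC N).st i x y) :
    tot x.1 = tot y.1 + fun t => if t = i.1 + 1 then (-1 : ℤ) else 0 := by
  obtain ⟨R, -, -, e⟩ := (h : rst i.1 x.1 y.1)
  funext t
  rw [Pi.add_apply, e, tot_rse x.2.fs (Nat.succ_ne_zero _)]
  split_ifs <;> ring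

theorem phi_tot {N : ℕ} {h h' : VV N} (hh : (theC N).HW h) (hh' : (theC N).HW h')
    (ht : tot h.1 = tot h'.1) (i : II N) : (theC N).phi i h = (theC N).phi i h' := by
  have e : ∀ x : VV N, (theC N).phi i x = (theC N).eps i x + cwt i.1 x.1 := fun _ => rfl
  rw [e, e, hh i, hh' i]
  unfold cwt
  rw [ht]

theorem ref_char {N : ℕ} {lam : ℕ → ℕ} (hz : ∀ j, N ≤ j → lam j = 0) (ha : Antitone lam)
    {h : VV N} (hh : (theC N).HW h)
    (ht : ∀ t, tot h.1 t = ((∑ r ∈ Finset.range t, lam r : ℕ) : ℤ)) (A : Finset (VV N))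
    (hA : ∀ x, x ∈ A ↔ (theC N).Reach x h) :
    ∑ x ∈ A, GW (xv N) N (tot x.1) = skewSchur N N lam (fun _ => 0) := by
  classical
  set M := lam 0 with hM
  set p := pl N M lam with hpd
  set q := pl N M (fun _ => 0) with hqd
  have hp : StrictMono p := pl_strict (k := N) ha le_rfl
  have hq : StrictMono q :=
    pl_strict (k := N) (M := M) (lam := fun _ => 0) antitone_const (Nat.zero_le _)
  have ho : ∀ l : ℤ, l < 0 ∨ N ≤ l → p l = q l :=
    fun l h => pl_out hz (fun _ _ => rfl) h
  have hle : ∀ l, q l ≤ p l := pl_le fun _ => Nat.zero_le _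
  have hC := Chw_mem hp hq ho hle
  have hD : (fun _ => q) ∈ Ch N q q :=
    ⟨fun _ _ => le_rfl, fun _ l => hq (by omega), fun _ _ => rfl, rfl, rfl⟩
  have oq : ∀ l : ℤ, l < 0 ∨ N ≤ l → q l = q l := fun _ _ => rfl
  have hx0 : (fun t => ilv q (Chw N p q t)) ∈ Conf N (ilv q p) (ilv q q) := by
    rw [Conf_eq N N ho oq]
    exact ⟨(Chw N p q, fun _ => q), ⟨hC, hD⟩, rfl⟩
  obtain ⟨hfin, hprod⟩ := prod_DH (xv N) N N hp hq hq hq ho oq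
  have one : DH (xv N) N N q q = 1 := by
    rw [(DH_chain (xv N) N N hq hq oq).2]
    have e : Ch N q q = {fun _ => q} := by
      ext C
      simp only [Set.mem_singleton_iff]
      constructor
      · intro hc
        obtain ⟨h1, h2, h3, h4, h5⟩ := id hc
        funext t
        by_cases h : t ≤ N
        · funext l
          have a := Ch_mono hc (Nat.zero_le t) l
          have b := Ch_mono hc h l
          rw [h4] at a; rw [h5] at b; omega
        · rw [h3 t (by omega), h5]
      · rintro rfl; exact hD
    rw [e, finsum_mem_singleton]
    simp [wtC]
  have e1 : skewSchur N N lam (fun _ => 0) =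
      ∑ᶠ P ∈ Conf N (ilv q p) (ilv q q), GW (xv N) N (tot P) := by
    rw [← hprod, one, mul_one]; exact skew_DH N N M _ _
  -- the set of configurations as a set of vertices
  set S : Set (VV N) := {x | x.1 ∈ Conf N (ilv q p) (ilv q q)} with hS
  have himg : Conf N (ilv q p) (ilv q q) = Subtype.val '' S := by
    ext P
    constructor
    · intro hP; exact ⟨⟨P, hP.1⟩, hP, rfl⟩
    · rintro ⟨x, hx, rfl⟩; exact hx
  have hSf : S.Finite := by
    rw [himg] at hfin
    exact hfin.of_finite_image Subtype.val_injective.injOn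
  have cl : ∀ i x y, (theC N).st i x y → (x ∈ S ↔ y ∈ S) := by
    intro i x y hst
    exact Conf_rst x.2 y.2 i.2 hst
  set x0 : VV N := ⟨_, hx0.1⟩ with hx0d
  have uniq : ∀ y : VV N, (theC N).HW y → y ∈ S → y = x0 := by
    intro y hy hyS
    exact Subtype.ext (hw_unique_row hp hq ho (fun l hl => pl_zero hl) hy hyS)
  have hwx0 : (theC N).HW x0 := by
    obtain ⟨y, hy, hr⟩ := (theC N).exists_hw x0
    rw [← uniq y hy ((reach_closed cl hr).1 hx0)]; exact hy
  have tt : tot h.1 = tot x0.1 := by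
    funext t
    rw [ht t]; exact (tot_Chw hz ha le_rfl t).symm
  rw [e1, himg, finsum_mem_image Subtype.val_injective.injOn,
    finsum_mem_eq_finite_toFinset_sum _ hSf]
  refine (theC N).sum_eq (fun x : VV N => tot x.1)
    (fun i => fun t => if t = i.1 + 1 then (-1 : ℤ) else 0) wt_step (GW (xv N) N) hh hwx0
    (phi_tot hh hwx0 tt) tt A _ hA ?_
  intro x
  rw [Set.Finite.mem_toFinset]
  constructor
  · intro hx
    obtain ⟨y, hy, hr⟩ := (theC N).exists_hw x
    rw [← uniq y hy ((reach_closed cl hr).1 hx)]; exact hr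
  · intro hr; exact (reach_closed cl hr).2 hx0

/-- shape of a highest weight element -/
noncomputable def shp {N : ℕ} (h : VV N) (j : ℕ) : ℕ := (tot h.1 (j + 1) - tot h.1 j).toNat

theorem tot_zero (P : ℕ → ℤ → ℤ) : tot P 0 = 0 := by
  unfold tot; simp

theorem shp_tot {N : ℕ} (h : VV N) (t : ℕ) :
    tot h.1 t = ((∑ r ∈ Finset.range t, shp h r : ℕ) : ℤ) := by
  induction t with
  | zero => simp [tot_zero]
  | succ t ih =>
    rw [Finset.sum_range_succ, Nat.cast_add, ← ih]
    have := h.2.tot_le (show t ≤ t + 1 by omega)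
    unfold shp
    omega

theorem shp_zero {N : ℕ} (h : VV N) (j : ℕ) (hj : N ≤ j) : shp h j = 0 := by
  unfold shp tot
  rw [h.2.stab (j + 1) (by omega), h.2.stab j hj]; simp

theorem shp_anti {N : ℕ} {h : VV N} (hh : (theC N).HW h) : Antitone (shp h) := by
  refine antitone_nat_of_succ_le fun i => ?_
  by_cases hi : i + 2 ≤ N
  · have := (EE_le_lims h.2 i (HW_EE hh hi)).2
    unfold cwt at this
    unfold shp
    have e : tot h.1 (i + 1 + 1) = tot h.1 (i + 2) := rfl
    omega
  · rw [shp_zero h (i + 1) (by omega)]; exact Nat.zero_le _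

theorem char_ZZ {N : ℕ} (S : Set (VV N)) (hf : S.Finite)
    (cl : ∀ i x y, (theC N).st i x y → (x ∈ S ↔ y ∈ S)) :
    IsSchurNonneg N (∑ᶠ x ∈ S, GW (xv N) N (tot x.1)) := by
  classical
  choose top htop using (theC N).exists_hw
  set H : Finset (VV N) := hf.toFinset.image top with hH
  rw [finsum_mem_eq_finite_toFinset_sum _ hf]
  have hsum : ∑ x ∈ hf.toFinset, GW (xv N) N (tot x.1) =
      ∑ h ∈ H, skewSchur N N (shp h) (fun _ => 0) := by
    rw [← Finset.sum_fiberwise_of_maps_to (s := hf.toFinset) (t := H) (g := top)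
      (fun x hx => Finset.mem_image_of_mem _ hx)]
    refine Finset.sum_congr rfl fun h hh => ?_
    obtain ⟨x, hx, rfl⟩ := Finset.mem_image.1 hh
    rw [Set.Finite.mem_toFinset] at hx
    refine ref_char (shp_zero _) (shp_anti (htop x).1) (htop x).1 (shp_tot _) _ fun y => ?_
    rw [Finset.mem_filter, Set.Finite.mem_toFinset]
    constructor
    · rintro ⟨_, e⟩; rw [← e]; exact (htop y).2
    · intro hr
      refine ⟨(reach_closed cl hr).2 ((reach_closed cl (htop x).2).1 hx), ?_⟩
      exact (theC N).reach_unique (htop y).1 (htop x).1 (htop y).2 hr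
  rw [hsum]
  refine ⟨H.card, fun _ => 1, fun _ => N, fun i => shp (H.equivFin.symm i).1, fun i => ?_,
    fun i j hj => shp_zero _ j hj, ?_⟩
  · obtain ⟨x, hx, e⟩ := Finset.mem_image.1 (H.equivFin.symm i).2
    dsimp only
    rw [← e]; exact shp_anti (htop x).1
  · rw [← Finset.sum_coe_sort, ← H.equivFin.symm.sum_comp]
    simp

/-- For any two skew shapes `λ/μ` and `ν/ρ`,
`s_{(λ/μ)∨(ν/ρ)} s_{(λ/μ)∧(ν/ρ)} ≥_s s_{λ/μ} s_{ν/ρ}`, where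
`(λ/μ)∨(ν/ρ) = (λ∨ν)/(μ∨ρ)` and `(λ/μ)∧(ν/ρ) = (λ∧ν)/(μ∧ρ)`, with `∨`, `∧`
the coordinatewise max and min of partitions. -/
theorem schur_nonneg_vee_wedge (k : ℕ) (lam mu nu rho : ℕ → ℕ)
    (hlam : Antitone lam) (hmu : Antitone mu) (hnu : Antitone nu) (hrho : Antitone rho)
    (hlamk : ∀ j, k ≤ j → lam j = 0) (hmuk : ∀ j, k ≤ j → mu j = 0)
    (hnuk : ∀ j, k ≤ j → nu j = 0) (hrhok : ∀ j, k ≤ j → rho j = 0)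
    (hml : ∀ i, mu i ≤ lam i) (hrn : ∀ i, rho i ≤ nu i)
    (N : ℕ) :
    IsSchurNonneg N
      (skewSchur N k (fun i => max (lam i) (nu i)) (fun i => max (mu i) (rho i))
          * skewSchur N k (fun i => min (lam i) (nu i)) (fun i => min (mu i) (rho i))
        - skewSchur N k lam mu * skewSchur N k nu rho) := by
  set M := max (lam 0) (nu 0) with hM
  have m1 : mu 0 ≤ M := (hml 0).trans (le_max_left _ _)
  have m2 : rho 0 ≤ M := (hrn 0).trans (le_max_right _ _)
  have ha : StrictMono (pl k M lam) := pl_strict hlam (le_max_left _ _)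
  have hb : StrictMono (pl k M mu) := pl_strict hmu m1
  have hc : StrictMono (pl k M nu) := pl_strict hnu (le_max_right _ _)
  have hd : StrictMono (pl k M rho) := pl_strict hrho m2
  have hab : ∀ l : ℤ, l < 0 ∨ k ≤ l → pl k M lam l = pl k M mu l := fun l h => pl_out hlamk hmuk h
  have hcd : ∀ l : ℤ, l < 0 ∨ k ≤ l → pl k M nu l = pl k M rho l := fun l h => pl_out hnuk hrhok h
  have hac : ∀ l : ℤ, l < 0 ∨ k ≤ l → pl k M lam l = pl k M nu l := fun l h => pl_out hlamk hnuk h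
  rw [skew_DH N k M, skew_DH N k M, skew_DH N k M lam, skew_DH N k M nu, pl_max, pl_max, pl_min,
    pl_min]
  obtain ⟨fY, eY⟩ := prod_DH (xv N) N k ha hb hc hd hab hcd
  obtain ⟨fX, eX⟩ := prod_DH (xv N) N k (strict_max ha hc) (strict_max hb hd) (strict_min ha hc)
    (strict_min hb hd) (fun l h => by rw [hab l h, hcd l h]) (fun l h => by rw [hab l h, hcd l h])
  rw [eX, eY]
  have key := char_XYZ (N := N) (b := pl k M mu) (d := pl k M rho) (GW (xv N) N) ha hc ?_ fX
  · unfold XX YY at key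
    rw [key, add_sub_cancel_left]
    set S : Set (VV N) := {x | x.1 ∈ ZZ N (pl k M lam) (pl k M mu) (pl k M nu) (pl k M rho)} with hS
    have himg : ZZ N (pl k M lam) (pl k M mu) (pl k M nu) (pl k M rho) = Subtype.val '' S := by
      ext P
      constructor
      · intro hP; exact ⟨⟨P, hP.1.1⟩, hP, rfl⟩
      · rintro ⟨x, hx, rfl⟩; exact hx
    have hSf : S.Finite := by
      have hZf : (ZZ N (pl k M lam) (pl k M mu) (pl k M nu) (pl k M rho)).Finite :=
        fX.subset fun P hP => hP.1
      rw [himg] at hZf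
      exact hZf.of_finite_image Subtype.val_injective.injOn
    rw [himg, finsum_mem_image Subtype.val_injective.injOn]
    exact char_ZZ S hSf fun i x y hst => ZZ_rst x.2 y.2 i.2 hst
  · refine ⟨k, fun l hl => ?_⟩
    have hl' : l < 0 ∨ (k : ℤ) ≤ l := by
      rcases abs_cases l with ⟨e, _⟩ | ⟨e, _⟩ <;> omega
    have h1 := hab l hl'
    have h2 := hcd l hl'
    have h3 := hac l hl'
    exact ⟨h1.symm, h3.symm, by rw [← h2, h3]⟩
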